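/- Let ν > n/2 − 1 and 1 ≤ p < p̃_ν, where p̃_ν = (ν + n − 1)/(n/2 − 1), and assume the Hardy inequality holds for (p, ν). Then for every integer m ≥ 1 the map F ↦ □^m F is a bijection from A^p_ν onto A^p_{ν+mp}, and there is a constant C > 0 such that ‖F‖_{L^p_ν} ≤ C ‖□^m F‖_{L^p_{ν+mp}} for all F ∈ A^p_ν. -/

import Mathlib

open MeasureTheory Complex Set
open scoped ENNReal

noncomputable section

/-- The Lorentz form `Δ(y) = y₁² − y₂² − ⋯ − yₙ²` on `ℝⁿ`
(written as `2 y₀² − ∑ yᵢ²` with 0-based indexing). -/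
def lor {n : ℕ} [NeZero n] (y : Fin n → ℝ) : ℝ := 2 * y 0 ^ 2 - ∑ i, y i ^ 2

/-- The holomorphic extension of the Lorentz form to `ℂⁿ`. -/
def lorC {n : ℕ} [NeZero n] (z : Fin n → ℂ) : ℂ := 2 * z 0 ^ 2 - ∑ i, z i ^ 2

/-- Componentwise imaginary part. -/
def imP {n : ℕ} (z : Fin n → ℂ) : Fin n → ℝ := fun i => (z i).im

/-- The forward light cone `Λ`. -/
def cone (n : ℕ) [NeZero n] : Set (Fin n → ℝ) := {y | 0 < lor y ∧ 0 < y 0}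

/-- The tube domain `T_Λ` over the forward light cone. -/
def tube (n : ℕ) [NeZero n] : Set (Fin n → ℂ) := {z | imP z ∈ cone n}

/-- The weighted measure `dV_ν = Δ(Im z)^{ν − n/2} dz` on `T_Λ`. -/
def dV (n : ℕ) [NeZero n] (ν : ℝ) : Measure (Fin n → ℂ) :=
  ((volume : Measure (Fin n → ℂ)).restrict (tube n)).withDensity
    (fun z => ENNReal.ofReal (lor (imP z) ^ (ν - (n : ℝ) / 2)))

/-- `∫ |F|^p dV_ν` (as an extended nonnegative real). -/
def lpInt (n : ℕ) [NeZero n] (p ν : ℝ) (F : (Fin n → ℂ) → ℂ) : ℝ≥0∞ :=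
  ∫⁻ z, ENNReal.ofReal (‖F z‖ ^ p) ∂(dV n ν)

/-- The `L^p_ν` norm `(∫ |F|^p dV_ν)^{1/p}`. -/
def lpNorm (n : ℕ) [NeZero n] (p ν : ℝ) (F : (Fin n → ℂ) → ℂ) : ℝ≥0∞ :=
  (lpInt n p ν F) ^ (1 / p)

/-- The Bergman space `A^p_ν`: holomorphic on `T_Λ` and in `L^p_ν`. -/
def memA (n : ℕ) [NeZero n] (p ν : ℝ) (F : (Fin n → ℂ) → ℂ) : Prop :=
  DifferentiableOn ℂ F (tube n) ∧ lpInt n p ν F < ⊤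

/-- Partial derivative `∂/∂zᵢ`. -/
def pd {n : ℕ} (i : Fin n) (F : (Fin n → ℂ) → ℂ) : (Fin n → ℂ) → ℂ :=
  fun z => fderiv ℂ F z (Pi.single i 1)

/-- The wave (Box) operator `□ = −(∂₁² − ∂₂² − ⋯ − ∂ₙ²)`, so that
`□ e^{i z·ξ} = Δ(ξ) e^{i z·ξ}`. -/
def BoxOp {n : ℕ} [NeZero n] (F : (Fin n → ℂ) → ℂ) : (Fin n → ℂ) → ℂ :=
  fun z => -(2 * pd 0 (pd 0 F) z - ∑ i, pd i (pd i F) z)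

/-- The (unnormalized) Bergman kernel `B_β(z,w) = Δ((z − w̄)/i)^{−(β+n)}`. -/
def berg (n : ℕ) [NeZero n] (β : ℝ) (z w : Fin n → ℂ) : ℂ :=
  lorC (fun i => (z i - (starRingEnd ℂ) (w i)) / Complex.I) ^ (-(β + (n : ℝ)) : ℂ)

/-- The Hardy inequality holds for `(p, ν)`:
`∫ |F|^p dV_ν ≤ C ∫ |Δ(Im z) □F(z)|^p dV_ν(z)` for all `F ∈ A^p_ν`. -/
def hardy (n : ℕ) [NeZero n] (p ν : ℝ) : Prop :=
  ∃ C > (0 : ℝ), ∀ F, memA n p ν F →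
    lpInt n p ν F ≤ ENNReal.ofReal C *
      lpInt n p ν (fun z => (lor (imP z) : ℂ) * BoxOp F z)

/-- `g` is the orthogonal projection of `f ∈ L²_ν` onto the closed subspace `A²_ν`:
`g ∈ A²_ν` and `f − g ⊥ A²_ν`. -/
def isProj (n : ℕ) [NeZero n] (ν : ℝ) (f g : (Fin n → ℂ) → ℂ) : Prop :=
  memA n 2 ν g ∧ ∀ h, memA n 2 ν h →
    ∫ z, f z * (starRingEnd ℂ) (h z) ∂(dV n ν) =
      ∫ z, g z * (starRingEnd ℂ) (h z) ∂(dV n ν)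

/-- The Bergman projection `P_ν` admits a bounded extension to `L^p_ν`:
`‖P_ν f‖_{L^p_ν} ≤ C ‖f‖_{L^p_ν}` for all `f ∈ L²_ν ∩ L^p_ν`. -/
def projBounded (n : ℕ) [NeZero n] (p ν : ℝ) : Prop :=
  ∃ C > (0 : ℝ), ∀ f g : (Fin n → ℂ) → ℂ,
    AEStronglyMeasurable f (dV n ν) → lpInt n 2 ν f < ⊤ → lpInt n p ν f < ⊤ →
    isProj n ν f g → lpNorm n p ν g ≤ ENNReal.ofReal C * lpNorm n p ν f

/-- A bounded (continuous) linear functional on `A^p_ν`. -/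
def isBddFunc (n : ℕ) [NeZero n] (p ν : ℝ) (γ : ((Fin n → ℂ) → ℂ) → ℂ) : Prop :=
  (∀ F G, memA n p ν F → memA n p ν G → γ (F + G) = γ F + γ G) ∧
  (∀ (c : ℂ) (F), memA n p ν F → γ (fun z => c * F z) = c * γ F) ∧
  ∃ C : ℝ, ∀ F, memA n p ν F → ‖γ F‖ ≤ C * (lpNorm n p ν F).toReal

set_option linter.unusedSectionVars false
set_option linter.unusedSimpArgs false

/-! ### Geometry of the light cone -/

/-- The bilinear form polarising the Lorentz form, over any commutative ring. -/
def bil {R : Type*} [CommRing R] {n : ℕ} [NeZero n] (x y : Fin n → R) : R :=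
  2 * (x 0 * y 0) - ∑ i, x i * y i

section bil
variable {R : Type*} [CommRing R] {n : ℕ} [NeZero n]

lemma bil_eq (x y : Fin n → R) :
    bil x y = x 0 * y 0 - ∑ i ∈ Finset.univ.erase 0, x i * y i := by
  have := Finset.add_sum_erase Finset.univ (fun i => x i * y i) (Finset.mem_univ (0 : Fin n))
  unfold bil; rw [← this]; ring

lemma bil_comm (x y : Fin n → R) : bil x y = bil y x := by
  simp only [bil, mul_comm]

lemma bil_add_left (x y z : Fin n → R) : bil (x + y) z = bil x z + bil y z := by
  simp only [bil, Pi.add_apply, add_mul, Finset.sum_add_distrib]; ring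

lemma bil_smul_left (c : R) (x y : Fin n → R) : bil (c • x) y = c * bil x y := by
  simp only [bil, Pi.smul_apply, smul_eq_mul, mul_assoc, ← Finset.mul_sum]; ring

lemma bil_add_right (x y z : Fin n → R) : bil x (y + z) = bil x y + bil x z := by
  rw [bil_comm, bil_add_left, bil_comm y, bil_comm z]

lemma bil_smul_right (c : R) (x y : Fin n → R) : bil x (c • y) = c * bil x y := by
  rw [bil_comm, bil_smul_left, bil_comm]

lemma bil_neg_left (x y : Fin n → R) : bil (-x) y = - bil x y := by
  rw [← neg_one_smul R x, bil_smul_left]; ring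

lemma bil_sub_left (x y z : Fin n → R) : bil (x - y) z = bil x z - bil y z := by
  rw [sub_eq_add_neg, bil_add_left, bil_neg_left]; ring

lemma bil_sub_right (x y z : Fin n → R) : bil x (y - z) = bil x y - bil x z := by
  rw [bil_comm, bil_sub_left, bil_comm y, bil_comm z]

end bil

section cone
variable {n : ℕ} [NeZero n]

lemma lor_eq (y : Fin n → ℝ) : lor y = bil y y := by
  simp [lor, bil, pow_two]

lemma lorC_eq (y : Fin n → ℂ) : lorC y = bil y y := by
  simp [lorC, bil, pow_two]

/-- The squared Euclidean norm of the space part. -/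
def spc (y : Fin n → ℝ) : ℝ := ∑ i ∈ Finset.univ.erase 0, y i * y i

lemma spc_nonneg (y : Fin n → ℝ) : 0 ≤ spc y :=
  Finset.sum_nonneg fun _ _ => mul_self_nonneg _

lemma lor_spc (y : Fin n → ℝ) : lor y = y 0 * y 0 - spc y := by
  rw [lor_eq, bil_eq]; rfl

lemma spc_cs (x y : Fin n → ℝ) :
    (∑ i ∈ Finset.univ.erase 0, x i * y i) ^ 2 ≤ spc x * spc y := by
  have := Finset.sum_mul_sq_le_sq_mul_sq (Finset.univ.erase (0 : Fin n)) x y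
  simpa [spc, pow_two] using this

lemma bil_pos {x y : Fin n → ℝ} (hx : x ∈ cone n) (hy : 0 ≤ lor y) (hy0 : 0 < y 0) :
    0 < bil x y := by
  obtain ⟨h1, h2⟩ := hx
  rw [lor_spc] at h1 hy
  rw [bil_eq]
  have h3 := spc_cs x y
  have h4 : spc x * spc y < (x 0 * y 0) ^ 2 := by
    have := spc_nonneg x
    have := spc_nonneg y
    have h : spc x * spc y ≤ spc x * (y 0 * y 0) := by gcongr; linarith
    have h' : spc x * (y 0 * y 0) < (x 0 * x 0) * (y 0 * y 0) := by
      gcongr; linarith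
    nlinarith
  have := abs_lt_of_sq_lt_sq (h3.trans_lt h4) (by positivity)
  linarith [(abs_lt.1 this).2]

lemma cone_add_closed {x y : Fin n → ℝ} (hx : x ∈ cone n) (hy : 0 ≤ lor y) (hy0 : 0 < y 0) :
    lor x + lor y ≤ lor (x + y) ∧ x + y ∈ cone n := by
  have h := bil_pos hx hy hy0
  have h2 : lor (x + y) = lor x + lor y + 2 * bil x y := by
    simp only [lor_eq, bil_add_left, bil_add_right, bil_comm y x]; ring
  obtain ⟨h3, h4⟩ := hx
  refine ⟨by linarith, by linarith, ?_⟩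
  simp only [Pi.add_apply]; linarith

lemma cone_add {x y : Fin n → ℝ} (hx : x ∈ cone n) (hy : y ∈ cone n) :
    lor x + lor y ≤ lor (x + y) ∧ x + y ∈ cone n :=
  cone_add_closed hx hy.1.le hy.2

lemma reverse_cs {x y : Fin n → ℝ} (hx : x ∈ cone n) : lor x * lor y ≤ bil x y ^ 2 := by
  obtain ⟨h1, h2⟩ := hx
  rw [lor_spc] at *
  rw [lor_spc, bil_eq]
  have h3 := spc_cs x y
  set m := ∑ i ∈ Finset.univ.erase 0, x i * y i
  have hx0 := spc_nonneg x
  have hy0 := spc_nonneg y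
  rcases hx0.eq_or_lt with h | h
  · rw [← h] at h3 ⊢
    have : m = 0 := by nlinarith
    rw [this]; nlinarith [mul_nonneg (mul_self_nonneg (x 0)) hy0]
  · -- `spc x * (bil² - lor x * lor y) ≥ (x₀ m - y₀ spc x)²`
    have key : 0 ≤ spc x * ((x 0 * y 0 - m) ^ 2 - (x 0 * x 0 - spc x) * (y 0 * y 0 - spc y)) := by
      nlinarith [sq_nonneg (x 0 * m - y 0 * spc x), mul_nonneg h1.le (sub_nonneg.2 h3)]
    nlinarith [nonneg_of_mul_nonneg_right key h]

lemma isOpen_cone : IsOpen (cone n) := by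
  have h : Continuous (lor : (Fin n → ℝ) → ℝ) := by unfold lor; fun_prop
  exact (isOpen_lt continuous_const h).inter (isOpen_lt continuous_const (continuous_apply 0))

lemma continuous_imP {k : ℕ} : Continuous (imP : (Fin k → ℂ) → Fin k → ℝ) := by
  unfold imP; fun_prop

lemma continuous_lor : Continuous (lor : (Fin n → ℝ) → ℝ) := by unfold lor; fun_prop

lemma continuous_lorC : Continuous (lorC : (Fin n → ℂ) → ℂ) := by unfold lorC; fun_prop

lemma isOpen_tube : IsOpen (tube n) := isOpen_cone.preimage continuous_imP

lemma measurableSet_tube : MeasurableSet (tube n) := isOpen_tube.measurableSet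

/-- Componentwise real part. -/
def reP (z : Fin n → ℂ) : Fin n → ℝ := fun i => (z i).re

lemma lorC_re (z : Fin n → ℂ) : (lorC z).re = lor (reP z) - lor (imP z) := by
  simp only [lorC_eq, lor_eq, bil, reP, imP]
  simp only [sub_re, mul_re, mul_im, re_sum, Finset.sum_sub_distrib]
  simp; ring

lemma lorC_im (z : Fin n → ℂ) : (lorC z).im = 2 * bil (reP z) (imP z) := by
  simp only [lorC_eq, bil, reP, imP]
  simp only [sub_im, mul_re, mul_im, im_sum, Finset.sum_add_distrib]
  have : ∑ i, (z i).im * (z i).re = ∑ i, (z i).re * (z i).im :=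
    Finset.sum_congr rfl fun _ _ => mul_comm _ _
  rw [this]; simp; ring

lemma lor_le_norm_lorC {z : Fin n → ℂ} (hz : imP z ∈ cone n) : lor (imP z) ≤ ‖lorC z‖ := by
  have h := reverse_cs (y := reP z) hz
  rw [bil_comm] at h
  have h1 : ‖lorC z‖ ^ 2 = (lor (reP z) - lor (imP z)) ^ 2 + (2 * bil (reP z) (imP z)) ^ 2 := by
    rw [← lorC_re, ← lorC_im, ← Complex.normSq_eq_norm_sq, Complex.normSq_apply]; ring
  have h0 := hz.1
  refine abs_le_of_sq_le_sq' ?_ (norm_nonneg _) |>.2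
  rw [h1]
  rcases le_total 0 (lor (reP z)) with h2 | h2
  · nlinarith [mul_nonneg h2 h0.le]
  · nlinarith [sq_nonneg (bil (reP z) (imP z)), mul_nonneg (neg_nonneg.2 h2) h0.le]

lemma lorC_ne_zero {z : Fin n → ℂ} (hz : imP z ∈ cone n) : lorC z ≠ 0 := by
  rw [← norm_pos_iff]; exact hz.1.trans_le (lor_le_norm_lorC hz)

/-- The `δ`-interior of the cone: points `y` with `y₀ - |y'| > δ`. -/
def coneIn (n : ℕ) [NeZero n] (δ : ℝ) : Set (Fin n → ℝ) := {y | δ < y 0 ∧ spc y < (y 0 - δ) ^ 2}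

lemma isOpen_coneIn (δ : ℝ) : IsOpen (coneIn n δ) := by
  have h : Continuous (spc : (Fin n → ℝ) → ℝ) := by unfold spc; fun_prop
  exact (isOpen_lt continuous_const (continuous_apply 0)).inter (isOpen_lt h (by fun_prop))

lemma exists_coneIn {y : Fin n → ℝ} (hy : y ∈ cone n) : ∃ δ > 0, y ∈ coneIn n δ := by
  obtain ⟨h1, h2⟩ := hy
  rw [lor_spc] at h1
  have hs : √(spc y) < y 0 := by
    rw [Real.sqrt_lt' h2]; nlinarith
  refine ⟨(y 0 - √(spc y)) / 2, by linarith, by linarith [Real.sqrt_nonneg (spc y)], ?_⟩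
  have := Real.sq_sqrt (spc_nonneg y)
  nlinarith [Real.sqrt_nonneg (spc y)]

lemma coneIn_add {δ : ℝ} {y v : Fin n → ℝ} (hy : y ∈ coneIn n δ) (hv : v ∈ cone n) :
    y + v ∈ coneIn n δ := by
  obtain ⟨h1, h2⟩ := hy
  obtain ⟨h3, h4⟩ := hv
  rw [lor_spc] at h3
  refine ⟨by simp only [Pi.add_apply]; linarith, ?_⟩
  have e : spc (y + v) = spc y + spc v + 2 * ∑ i ∈ Finset.univ.erase 0, y i * v i := by
    simp only [spc, Pi.add_apply, Finset.mul_sum, ← Finset.sum_add_distrib]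
    exact Finset.sum_congr rfl fun _ _ => by ring
  have h5 := spc_cs y v
  have h6 : (∑ i ∈ Finset.univ.erase 0, y i * v i) ≤ (y 0 - δ) * v 0 := by
    refine le_of_abs_le (abs_le_of_sq_le_sq (h5.trans ?_) (by nlinarith))
    have : spc y * spc v ≤ (y 0 - δ) ^ 2 * (v 0 * v 0) := by
      gcongr
      · exact spc_nonneg v
      · linarith
    linarith
  simp only [Pi.add_apply]
  nlinarith

lemma norm_le_of_coneIn {δ : ℝ} (hδ : 0 < δ) {z : Fin n → ℂ} (hz : imP z ∈ coneIn n δ) (i : Fin n) :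
    ‖z i‖ ≤ 2 / δ * ‖lorC z‖ := by
  set x := reP z with hx
  set y := imP z with hy
  obtain ⟨h1, h2⟩ := hz
  have hys := spc_nonneg y
  have hxs := spc_nonneg x
  have hm : (∑ i ∈ Finset.univ.erase 0, x i * y i) ^ 2 ≤ spc x * (y 0 - δ) ^ 2 :=
    (spc_cs x y).trans (by gcongr)
  set m := ∑ i ∈ Finset.univ.erase 0, x i * y i with hmdef
  have hxm : 2 * (x 0 * m) ≤ (y 0 - δ) * (x 0 * x 0 + spc x) := by
    refine le_of_abs_le (abs_le_of_sq_le_sq ?_ (by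
      have := mul_self_nonneg (x 0); exact mul_nonneg (by linarith) (by linarith)))
    have : (x 0 * x 0) * m ^ 2 ≤ (x 0 * x 0) * (spc x * (y 0 - δ) ^ 2) := by
      gcongr; exact mul_self_nonneg _
    nlinarith [sq_nonneg ((y 0 - δ) * (x 0 * x 0 - spc x))]
  have hQ : δ / 2 * (x 0 * x 0 + spc x + (y 0 * y 0 + spc y)) ≤
      lor y * y 0 + (2 * bil x y * x 0 - lor x * y 0) := by
    rw [lor_spc, lor_spc, bil_eq, ← hmdef]
    have h3 : spc y ≤ y 0 * y 0 := by nlinarith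
    have h4 : δ * (y 0 * y 0) ≤ (y 0 * y 0 - spc y) * y 0 := by
      have : δ * y 0 ≤ y 0 * y 0 - spc y := by nlinarith
      nlinarith
    have h5 : 0 ≤ (y 0 - δ) * (x 0 * x 0 + spc x) - 2 * (x 0 * m) := by linarith
    nlinarith [mul_self_nonneg (x 0)]
  have hQ2 : lor y * y 0 + (2 * bil x y * x 0 - lor x * y 0) ≤ ‖lorC z‖ * ‖z 0‖ := by
    have : lor y * y 0 + (2 * bil x y * x 0 - lor x * y 0) =
        ((lorC z).im * (z 0).re - (lorC z).re * (z 0).im) := by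
      rw [lorC_re, lorC_im]; simp only [hx, hy, reP, imP]; ring
    rw [this]
    have : (lorC z).im * (z 0).re - (lorC z).re * (z 0).im =
        (starRingEnd ℂ (lorC z) * (z 0)).im * (-1) := by
      simp [mul_im]; ring
    rw [this, ← Complex.norm_conj (lorC z), ← norm_mul]
    have := Complex.abs_im_le_norm (starRingEnd ℂ (lorC z) * (z 0))
    rw [abs_le] at this
    linarith
  have hE : ∀ j, ‖z j‖ ^ 2 ≤ x 0 * x 0 + spc x + (y 0 * y 0 + spc y) := by
    intro j
    have h3 : ‖z j‖ ^ 2 = x j * x j + y j * y j := by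
      rw [← Complex.normSq_eq_norm_sq, Complex.normSq_apply]; simp [hx, hy, reP, imP]
    rw [h3]
    by_cases hj : j = 0
    · subst hj; linarith
    · have hj' : j ∈ Finset.univ.erase (0 : Fin n) := by simp [hj]
      have h4 : x j * x j ≤ spc x :=
        Finset.single_le_sum (f := fun i => x i * x i) (fun _ _ => mul_self_nonneg _) hj'
      have h5 : y j * y j ≤ spc y :=
        Finset.single_le_sum (f := fun i => y i * y i) (fun _ _ => mul_self_nonneg _) hj'
      linarith [mul_self_nonneg (x 0), mul_self_nonneg (y 0)]
  have h0 : δ / 2 * ‖z 0‖ ≤ ‖lorC z‖ := by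
    have h00 : 0 < ‖z 0‖ := by
      rw [norm_pos_iff]; intro h
      have : y 0 = 0 := by simp [hy, imP, h]
      linarith
    refine le_of_mul_le_mul_right (a := ‖z 0‖) ?_ h00
    have := mul_le_mul_of_nonneg_left (hE 0) (by positivity : 0 ≤ δ / 2)
    nlinarith
  have h1 : (δ / 2 * ‖z i‖) ^ 2 ≤ ‖lorC z‖ ^ 2 := by
    have := mul_le_mul_of_nonneg_left (hE i) (by positivity : 0 ≤ δ / 2)
    have h3 : δ / 2 * (‖lorC z‖ * ‖z 0‖) ≤ ‖lorC z‖ * ‖lorC z‖ := by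
      nlinarith [norm_nonneg (lorC z)]
    nlinarith
  have h2 := abs_le_of_sq_le_sq' h1 (norm_nonneg _) |>.2
  calc ‖z i‖ = 2 / δ * (δ / 2 * ‖z i‖) := by field_simp
    _ ≤ _ := by gcongr

end cone

/-! ### Homogeneity of the tube domain -/

/-- The linear similarity of the Lorentz form mapping the base point `e = (1, 0, …, 0)` to `y`,
where `r ^ 2 = Δ(y)`. -/
def boost {K : Type*} [Field K] {n : ℕ} [NeZero n] (r : K) (y : Fin n → K) :
    (Fin n → K) →ₗ[K] (Fin n → K) where
  toFun z := (bil z (r • Pi.single 0 1 + y) / (r + y 0)) • (r • Pi.single 0 1 + y) - r • z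
  map_add' a b := by
    ext i; simp only [bil_add_left, Pi.sub_apply, Pi.smul_apply, Pi.add_apply, smul_eq_mul]; ring
  map_smul' c a := by
    ext i
    simp only [bil_smul_left, Pi.sub_apply, Pi.smul_apply, Pi.add_apply, smul_eq_mul,
      RingHom.id_apply]; ring

section boost
variable {K : Type*} [Field K] {n : ℕ} [NeZero n]

lemma boost_apply (r : K) (y z : Fin n → K) : boost r y z =
    (bil z (r • Pi.single 0 1 + y) / (r + y 0)) • (r • Pi.single 0 1 + y) - r • z := rfl

lemma bil_single_zero (z : Fin n → K) : bil z (Pi.single 0 1) = z 0 := by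
  simp [bil, Pi.single_apply]; ring

lemma bil_single_ne {i : Fin n} (hi : i ≠ 0) (z : Fin n → K) : bil z (Pi.single i 1) = - z i := by
  simp [bil, Pi.single_apply, hi.symm]

variable {r : K} {y : Fin n → K}

lemma boost_zero_coord (h0 : r + y 0 ≠ 0) (z : Fin n → K) : boost r y z 0 = bil z y := by
  rw [boost_apply, bil_add_right, bil_smul_right, bil_single_zero]
  simp; field_simp; ring

lemma boost_base (h0 : r + y 0 ≠ 0) : boost r y (Pi.single 0 1) = y := by
  rw [boost_apply, bil_comm, bil_single_zero]
  have : (r • Pi.single 0 1 + y : Fin n → K) 0 = r + y 0 := by simp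
  rw [this, div_self h0, one_smul]; abel

lemma bil_boost (hr : r ^ 2 = bil y y) (h0 : r + y 0 ≠ 0) (z w : Fin n → K) :
    bil (boost r y z) (boost r y w) = r ^ 2 * bil z w := by
  have hb : bil (r • Pi.single 0 1 + y : Fin n → K) (r • Pi.single 0 1 + y) =
      2 * r * (r + y 0) := by
    simp only [bil_add_right, bil_add_left, bil_smul_right, bil_smul_left, bil_single_zero,
      bil_comm _ y, ← hr]
    simp; ring
  simp only [boost_apply]
  set b := (r • Pi.single 0 1 + y : Fin n → K)
  simp only [bil_sub_left, bil_sub_right, bil_smul_left, bil_smul_right, hb, bil_comm b w]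
  field_simp; ring

lemma boost_boost (hr : r ^ 2 = bil y y) (h0 : r + y 0 ≠ 0) (z : Fin n → K) :
    boost r y (boost r y z) = r ^ 2 • z := by
  have hb : bil (r • Pi.single 0 1 + y : Fin n → K) (r • Pi.single 0 1 + y) =
      2 * r * (r + y 0) := by
    simp only [bil_add_right, bil_add_left, bil_smul_right, bil_smul_left, bil_single_zero,
      bil_comm _ y, ← hr]
    simp; ring
  simp only [boost_apply]
  set b := (r • Pi.single 0 1 + y : Fin n → K)
  simp only [bil_sub_left, bil_smul_left, hb]
  ext i
  simp only [Pi.sub_apply, Pi.smul_apply, smul_eq_mul]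
  field_simp; ring

end boost

section tube
variable {n : ℕ} [NeZero n]

/-- The vector `z - w̄`. -/
def zeta {n : ℕ} (z w : Fin n → ℂ) : Fin n → ℂ := fun i => z i - (starRingEnd ℂ) (w i)

/-- The real vector `y` seen as a complex vector. -/
def toC {n : ℕ} (y : Fin n → ℝ) : Fin n → ℂ := fun i => (y i : ℂ)

lemma toC_add (x y : Fin n → ℝ) : toC (x + y) = toC x + toC y := by ext; simp [toC]

lemma toC_single (i : Fin n) : toC (Pi.single i 1) = Pi.single i 1 := by
  ext j; by_cases h : j = i
  · subst h; simp [toC]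
  · simp [toC, h]

lemma toC_smul (c : ℝ) (x : Fin n → ℝ) : toC (c • x) = (c : ℂ) • toC x := by ext; simp [toC]

lemma bil_toC (x y : Fin n → ℝ) : bil (toC x) (toC y) = (bil x y : ℝ) := by
  simp [bil, toC]

/-- The base point `i e` of the tube. -/
def bpt (n : ℕ) [NeZero n] : Fin n → ℂ := I • Pi.single 0 1

lemma imP_add (z w : Fin n → ℂ) : imP (z + w) = imP z + imP w := by ext; simp [imP]

lemma imP_toC (y : Fin n → ℝ) : imP (toC y) = 0 := by ext; simp [imP, toC]

lemma imP_zeta (z w : Fin n → ℂ) : imP (zeta z w) = imP z + imP w := by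
  ext; simp [imP, zeta]

lemma imP_I_smul_toC (y : Fin n → ℝ) : imP (I • toC y) = y := by ext; simp [imP, toC]

lemma imP_bpt : imP (bpt n) = Pi.single 0 1 := by
  rw [bpt, ← toC_single, imP_I_smul_toC]

lemma reP_add_imP (z : Fin n → ℂ) : toC (reP z) + I • toC (imP z) = z := by
  ext i; simp [toC, reP, imP, mul_comm I]

lemma base_mem_cone : (Pi.single 0 1 : Fin n → ℝ) ∈ cone n := by
  refine ⟨?_, by simp⟩
  rw [lor_eq, bil_single_zero]; simp

lemma lor_base : lor (Pi.single 0 1 : Fin n → ℝ) = 1 := by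
  rw [lor_eq, bil_single_zero]; simp

lemma bpt_mem : bpt n ∈ tube n := by
  rw [tube, mem_ofPred, imP_bpt]; exact base_mem_cone

lemma zeta_mem {z w : Fin n → ℂ} (hz : z ∈ tube n) (hw : w ∈ tube n) : zeta z w ∈ tube n := by
  rw [tube, mem_ofPred, imP_zeta]; exact (cone_add hz hw).2

lemma lorC_zeta_ne {z w : Fin n → ℂ} (hz : z ∈ tube n) (hw : w ∈ tube n) :
    lorC (zeta z w) ≠ 0 := lorC_ne_zero (zeta_mem hz hw)

lemma lor_le_norm_zeta {z w : Fin n → ℂ} (hz : z ∈ tube n) (hw : w ∈ tube n) :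
    lor (imP z) + lor (imP w) ≤ ‖lorC (zeta z w)‖ := by
  refine (cone_add hz hw).1.trans ?_
  rw [← imP_zeta]; exact lor_le_norm_lorC (zeta_mem hz hw)

lemma imP_boost (r : ℝ) (y : Fin n → ℝ) (z : Fin n → ℂ) :
    imP (boost (r : ℂ) (toC y) z) = boost r y (imP z) := by
  have h : z = toC (reP z) + I • toC (imP z) := (reP_add_imP z).symm
  have e : ∀ v : Fin n → ℝ, boost (r : ℂ) (toC y) (toC v) = toC (boost r y v) := by
    intro v
    simp only [boost_apply]
    rw [← toC_single, ← toC_smul, ← toC_add, bil_toC]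
    ext i; simp [toC]; ring
  conv_lhs => rw [h, map_add, map_smul, e, e, imP_add, imP_toC, imP_I_smul_toC, zero_add]

lemma conj_boost (r : ℝ) (y : Fin n → ℝ) (z : Fin n → ℂ) :
    (fun i => starRingEnd ℂ (boost (r : ℂ) (toC y) z i)) =
      boost (r : ℂ) (toC y) (fun i => starRingEnd ℂ (z i)) := by
  ext i
  have h2 : (starRingEnd ℂ) 2 = 2 := Complex.conj_ofNat 2
  simp [boost_apply, bil, toC, Pi.single_apply, apply_ite, h2]

lemma boost_mem_cone {r : ℝ} {y v : Fin n → ℝ} (hy : y ∈ cone n) (hr : 0 < r)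
    (hr2 : r ^ 2 = lor y) (hv : v ∈ cone n) : boost r y v ∈ cone n := by
  have h0 : r + y 0 ≠ 0 := by have := hy.2; positivity
  refine ⟨?_, ?_⟩
  · rw [lor_eq, bil_boost (by rw [hr2, lor_eq]) h0, ← lor_eq]
    have := hv.1; positivity
  · rw [boost_zero_coord h0]; exact bil_pos hv hy.1.le hy.2

/-- The tube is homogeneous under affine maps which are similarities of the Lorentz form. -/
lemma exists_homogeneity {z₀ : Fin n → ℂ} (hz₀ : z₀ ∈ tube n) :
    ∃ τ : (Fin n → ℂ) → (Fin n → ℂ), τ (bpt n) = z₀ ∧ Differentiable ℂ τ ∧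
      (∀ w, τ w ∈ tube n ↔ w ∈ tube n) ∧
      (∀ z w, lorC (zeta (τ z) (τ w)) = lor (imP z₀) * lorC (zeta z w)) ∧
      (∀ w, lor (imP (τ w)) = lor (imP z₀) * lor (imP w)) ∧
      MeasurableEmbedding τ ∧
      (volume.restrict (tube n)).map τ =
        ENNReal.ofReal ((lor (imP z₀) ^ n)⁻¹) • volume.restrict (tube n) := by
  set y := imP z₀ with hy
  set r := √(lor y) with hr
  have hyc : y ∈ cone n := hz₀
  have hr0 : 0 < r := Real.sqrt_pos.2 hyc.1
  have hr2 : r ^ 2 = lor y := Real.sq_sqrt hyc.1.le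
  have h0 : r + y 0 ≠ 0 := by have := hyc.2; positivity
  have hr2' : r ^ 2 = bil y y := by rw [hr2, lor_eq]
  have hC2 : (r : ℂ) ^ 2 = bil (toC y) (toC y) := by rw [bil_toC, ← hr2']; norm_cast
  have hC0 : (r : ℂ) + toC y 0 ≠ 0 := by simp only [toC]; exact_mod_cast h0
  set L := boost (r : ℂ) (toC y) with hL
  have hLL : ∀ z, L (L z) = (r : ℂ) ^ 2 • z := boost_boost hC2 hC0
  have hmem : ∀ w, L w ∈ tube n ↔ w ∈ tube n := by
    have h1 : ∀ w, w ∈ tube n → L w ∈ tube n := by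
      intro w hw
      rw [tube, mem_ofPred, hL, imP_boost]; exact boost_mem_cone hyc hr0 hr2 hw
    refine fun w => ⟨fun h => ?_, h1 w⟩
    have h2 := h1 _ h
    have h3 : imP (L (L w)) = (r ^ 2) • imP w := by
      rw [hLL]; ext i; simp [imP, ← ofReal_pow]
    have h4 : imP (L (L w)) ∈ cone n := h2
    rw [h3] at h4
    refine ⟨?_, ?_⟩
    · have := h4.1
      rw [lor_eq, bil_smul_left, bil_smul_right, ← lor_eq] at this
      have h5 : 0 < r ^ 2 * r ^ 2 := by positivity
      rw [← mul_assoc] at this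
      exact (pos_iff_pos_of_mul_pos this).1 h5
    · have := h4.2
      simp only [Pi.smul_apply, smul_eq_mul] at this
      exact (pos_iff_pos_of_mul_pos this).1 (by positivity)
  set x := toC (reP z₀) with hx
  have himx : imP x = 0 := imP_toC _
  have hdet : |LinearMap.det (L.restrictScalars ℝ)| = lor y ^ n := by
    have h1 : (L.restrictScalars ℝ) ∘ₗ (L.restrictScalars ℝ) = (r ^ 2) • LinearMap.id := by
      ext z i <;> simp [hLL, ← ofReal_pow]
    have h2 := congrArg LinearMap.det h1
    rw [LinearMap.det_comp, LinearMap.det_smul, LinearMap.det_id, mul_one,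
      Module.finrank_pi_fintype,
      hr2] at h2
    simp only [Complex.finrank_real_complex, Finset.sum_const, Finset.card_univ, Fintype.card_fin,
      smul_eq_mul] at h2
    rw [pow_mul, ← pow_two] at h2
    exact (sq_eq_sq₀ (abs_nonneg _) (pow_nonneg hyc.1.le _)).1 (by rw [sq_abs, h2])
  have hdet0 : LinearMap.det (L.restrictScalars ℝ) ≠ 0 := by
    rw [← abs_pos, hdet]; exact pow_pos hyc.1 _
  have hLc : Continuous L := L.continuous_of_finiteDimensional
  have hτmem : ∀ w, x + L w ∈ tube n ↔ w ∈ tube n := by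
    intro w
    rw [← hmem w, tube, mem_ofPred, mem_ofPred, imP_add, himx, zero_add]
  have hinj : Function.Injective L := by
    intro a b hab
    have h1 := congrArg L hab
    rw [hLL, hLL] at h1
    have h2 : (r : ℂ) ^ 2 ≠ 0 := pow_ne_zero _ (by exact_mod_cast hr0.ne')
    exact smul_right_injective _ h2 h1
  have hemb : MeasurableEmbedding (fun w => x + L w) := by
    refine Continuous.measurableEmbedding (by fun_prop) (fun a b h => hinj ?_)
    exact add_left_cancel h
  refine ⟨fun w => x + L w, ?_, ?_, hτmem, ?_, ?_, hemb, ?_⟩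
  · simp only
    rw [bpt, map_smul, hL, boost_base hC0, hx, reP_add_imP]
  · exact (differentiable_const _).add (LinearMap.toContinuousLinearMap L).differentiable
  · intro z w
    have : zeta (x + L z) (x + L w) = L (zeta z w) := by
      have h1 : zeta z w = z - (fun i => starRingEnd ℂ (w i)) := rfl
      rw [h1, map_sub, hL, ← conj_boost]
      ext i; simp [zeta, hx, toC]
    rw [this, lorC_eq, hL, bil_boost hC2 hC0, ← lorC_eq, ← ofReal_pow, hr2]
  · intro w
    simp only
    rw [imP_add, himx, zero_add, hL, imP_boost, lor_eq, bil_boost hr2' h0, ← lor_eq, hr2]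
  · have h1 : (volume : Measure (Fin n → ℂ)).map (fun w => x + L w) =
        ENNReal.ofReal ((lor y ^ n)⁻¹) • volume := by
      have h2 : (fun w => x + L w) = (fun w => x + w) ∘ (L.restrictScalars ℝ) := rfl
      have hLm : Measurable (L.restrictScalars ℝ) := hLc.measurable
      rw [h2, ← Measure.map_map (measurable_const_add x) hLm,
        Measure.map_linearMap_addHaar_eq_smul_addHaar _ hdet0, Measure.map_smul,
        map_add_left_eq_self, abs_inv, hdet]
    have h2 : tube n = (fun w => x + L w) ⁻¹' tube n := by ext w; exact (hτmem w).symm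
    conv_lhs => rw [h2]
    rw [← Measure.restrict_map hemb.measurable measurableSet_tube, h1, Measure.restrict_smul]

lemma norm_bil_zeta_le {z w : Fin n → ℂ} (hz : z ∈ tube n) (hw : w ∈ tube n) :
    ‖bil (zeta z w) (toC (imP z))‖ ≤ 4 * ‖lorC (zeta z w)‖ := by
  set y := imP z with hy
  set r := √(lor y) with hr
  have hyc : y ∈ cone n := hz
  have hr0 : 0 < r := Real.sqrt_pos.2 hyc.1
  have hr2 : r ^ 2 = lor y := Real.sq_sqrt hyc.1.le
  have h0 : r + y 0 ≠ 0 := by have := hyc.2; positivity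
  have hr2' : r ^ 2 = bil y y := by rw [hr2, lor_eq]
  have hC2 : (r : ℂ) ^ 2 = bil (toC y) (toC y) := by rw [bil_toC, ← hr2']; norm_cast
  have hC0 : (r : ℂ) + toC y 0 ≠ 0 := by simp only [toC]; exact_mod_cast h0
  rw [← boost_zero_coord hC0]
  have hey : boost r y y = r ^ 2 • Pi.single 0 1 := by
    rw [← boost_boost hr2' h0, boost_base h0]
  have him : imP (boost (r : ℂ) (toC y) (zeta z w)) ∈ coneIn n (r ^ 2 / 2) := by
    rw [imP_boost, imP_zeta, map_add, ← hy, hey]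
    refine coneIn_add ⟨?_, ?_⟩ (boost_mem_cone hyc hr0 hr2 hw)
    · simp; positivity
    · have : spc (r ^ 2 • Pi.single 0 1 : Fin n → ℝ) = 0 := by
        refine Finset.sum_eq_zero fun i hi => ?_
        simp [(Finset.mem_erase.1 hi).1]
      rw [this]; simp; ring_nf; positivity
  have := norm_le_of_coneIn (by positivity) him 0
  rw [lorC_eq (boost _ _ _), bil_boost hC2 hC0, norm_mul, ← lorC_eq] at this
  refine this.trans (le_of_eq ?_)
  have h5 : ‖(r : ℂ) ^ 2‖ = r ^ 2 := by
    rw [← ofReal_pow, norm_real, Real.norm_of_nonneg]; positivity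
  rw [h5]; field_simp; ring

end tube

/-! ### Integrals of powers of the kernel -/

section kernel
variable {n : ℕ} [NeZero n]

/-- The modulus `|Δ(z - w̄)|` of the kernel. -/
def kk (z w : Fin n → ℂ) : ℝ≥0∞ := ‖lorC (zeta z w)‖ₑ

/-- The weight `Δ(Im w)`. -/
def dl (w : Fin n → ℂ) : ℝ≥0∞ := ENNReal.ofReal (lor (imP w))

lemma lorC_zeta_symm (z w : Fin n → ℂ) :
    lorC (zeta w z) = starRingEnd ℂ (lorC (zeta z w)) := by
  have h2 : (starRingEnd ℂ) 2 = 2 := Complex.conj_ofNat 2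
  simp only [lorC, zeta, map_sub, map_mul, map_sum, map_pow, h2, Complex.conj_conj]
  congr 1
  · ring
  · exact Finset.sum_congr rfl fun _ _ => by ring

lemma kk_comm (z w : Fin n → ℂ) : kk z w = kk w z := by
  rw [kk, kk, lorC_zeta_symm]
  simp only [enorm_eq_nnnorm, RCLike.nnnorm_conj]

lemma kk_ne_top (z w : Fin n → ℂ) : kk z w ≠ ⊤ := enorm_ne_top

lemma dl_ne_top (w : Fin n → ℂ) : dl w ≠ ⊤ := ENNReal.ofReal_ne_top

lemma dl_ne_zero {w : Fin n → ℂ} (hw : w ∈ tube n) : dl w ≠ 0 := by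
  rw [dl, Ne, ENNReal.ofReal_eq_zero, not_le]; exact hw.1

lemma kk_ne_zero {z w : Fin n → ℂ} (hz : z ∈ tube n) (hw : w ∈ tube n) : kk z w ≠ 0 := by
  rw [kk, Ne, enorm_eq_zero]; exact lorC_zeta_ne hz hw

lemma dl_le_kk {z w : Fin n → ℂ} (hz : z ∈ tube n) (hw : w ∈ tube n) : dl w ≤ kk z w := by
  rw [kk, dl, ← ofReal_norm]
  exact ENNReal.ofReal_le_ofReal (by linarith [lor_le_norm_zeta hz hw, hz.1])

lemma dl_le_kk' {z w : Fin n → ℂ} (hz : z ∈ tube n) (hw : w ∈ tube n) : dl z ≤ kk z w := by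
  rw [kk_comm]; exact dl_le_kk hw hz

lemma continuous_zeta : Continuous (fun q : (Fin n → ℂ) × (Fin n → ℂ) => zeta q.1 q.2) := by
  unfold zeta; fun_prop

@[fun_prop]
lemma measurable_kk {α : Type*} [MeasurableSpace α] {f g : α → Fin n → ℂ} (hf : Measurable f)
    (hg : Measurable g) : Measurable (fun a => kk (f a) (g a)) := by
  have h : Measurable (fun a => zeta (f a) (g a)) := by
    refine measurable_pi_lambda _ fun i => ?_
    exact ((measurable_pi_apply i).comp hf).sub
      (Complex.continuous_conj.measurable.comp ((measurable_pi_apply i).comp hg))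
  have h2 : Measurable (fun a => lorC (zeta (f a) (g a))) := continuous_lorC.measurable.comp h
  exact h2.enorm

@[fun_prop]
lemma measurable_dl {α : Type*} [MeasurableSpace α] {f : α → Fin n → ℂ} (hf : Measurable f) :
    Measurable (fun a => dl (f a)) := by
  have h : Measurable (fun w : Fin n → ℂ => ENNReal.ofReal (lor (imP w))) :=
    (continuous_lor.comp continuous_imP).measurable.ennreal_ofReal
  exact h.comp hf

/-- Change of variables under the homogeneity of the tube, with all the data needed to compute
integrals of kernels. -/
lemma exists_homogeneity' {z₀ : Fin n → ℂ} (hz₀ : z₀ ∈ tube n) :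
    ∃ τ : (Fin n → ℂ) → (Fin n → ℂ), τ (bpt n) = z₀ ∧
      (∀ w, τ w ∈ tube n ↔ w ∈ tube n) ∧
      (∀ z w, kk (τ z) (τ w) = dl z₀ * kk z w) ∧
      (∀ w, dl (τ w) = dl z₀ * dl w) ∧
      (∀ f : (Fin n → ℂ) → ℝ≥0∞, ∫⁻ w in tube n, f w =
        dl z₀ ^ (n : ℝ) * ∫⁻ w in tube n, f (τ w)) := by
  obtain ⟨τ, h1, -, h3, h4, h5, h6, h7⟩ := exists_homogeneity hz₀
  have h0 : 0 < lor (imP z₀) := hz₀.1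
  refine ⟨τ, h1, h3, fun z w => ?_, fun w => ?_, fun f => ?_⟩
  · rw [kk, h4, enorm_mul, kk, dl]
    congr 1
    rw [← ofReal_norm, norm_real, Real.norm_of_nonneg h0.le]
  · rw [dl, h5, ENNReal.ofReal_mul h0.le]; rfl
  · rw [← h6.lintegral_map, h7, lintegral_smul_measure, smul_eq_mul, ← mul_assoc, dl,
      ENNReal.rpow_natCast, ← ENNReal.ofReal_pow h0.le, ← ENNReal.ofReal_mul (by positivity),
      mul_inv_cancel₀ (by positivity), ENNReal.ofReal_one, one_mul]

lemma one_add_norm_le_kk {w : Fin n → ℂ} (hw : w ∈ tube n) :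
    1 + ‖w‖ ≤ 6 * ‖lorC (zeta (bpt n) w)‖ := by
  have h1 : 1 ≤ ‖lorC (zeta (bpt n) w)‖ := by
    have := lor_le_norm_zeta bpt_mem hw
    rw [imP_bpt, lor_base] at this
    linarith [hw.1]
  have h2 : imP (zeta (bpt n) w) ∈ coneIn n (1 / 2) := by
    rw [imP_zeta, imP_bpt]
    refine coneIn_add ⟨by simp; norm_num, ?_⟩ hw
    have : spc (Pi.single 0 1 : Fin n → ℝ) = 0 := by
      refine Finset.sum_eq_zero fun i hi => ?_
      simp [(Finset.mem_erase.1 hi).1]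
    rw [this]; simp; norm_num
  have h3 : ‖w‖ ≤ 5 * ‖lorC (zeta (bpt n) w)‖ := by
    refine (pi_norm_le_iff_of_nonneg (by positivity)).2 fun i => ?_
    have h4 := norm_le_of_coneIn (by norm_num) h2 i
    have h5 : ‖w i‖ ≤ ‖zeta (bpt n) w i‖ + ‖bpt n i‖ := by
      rw [← RCLike.norm_conj (w i)]
      have : starRingEnd ℂ (w i) = bpt n i - zeta (bpt n) w i := by simp [zeta]
      rw [this, add_comm]; exact norm_sub_le _ _
    have h6 : ‖bpt n i‖ ≤ 1 := by
      by_cases h : i = 0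
      · subst h; simp [bpt]
      · simp [bpt, h]
    linarith
  linarith

lemma lintegral_kk_base {s : ℝ} (hs : 2 * n < s) :
    ∫⁻ w in tube n, kk (bpt n) w ^ (-s) < ⊤ := by
  have hs0 : 0 < s := lt_of_le_of_lt (by positivity) hs
  have h1 : ∀ w ∈ tube n, kk (bpt n) w ^ (-s) ≤
      ENNReal.ofReal (6 ^ s) * ENNReal.ofReal ((1 + ‖w‖) ^ (-s)) := by
    intro w hw
    have h2 := one_add_norm_le_kk hw
    have h3 : 0 < ‖lorC (zeta (bpt n) w)‖ := by linarith [norm_nonneg w]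
    rw [kk, ← ofReal_norm, ENNReal.ofReal_rpow_of_pos h3, ← ENNReal.ofReal_mul (by positivity)]
    refine ENNReal.ofReal_le_ofReal ?_
    have h4 : (6 * ‖lorC (zeta (bpt n) w)‖) ^ (-s) ≤ (1 + ‖w‖) ^ (-s) :=
      Real.rpow_le_rpow_of_nonpos (by positivity) h2 (by linarith)
    rw [Real.mul_rpow (by norm_num) h3.le] at h4
    have h5 : (6 : ℝ) ^ s * 6 ^ (-s) = 1 := by
      rw [← Real.rpow_add (by norm_num)]; simp
    calc ‖lorC (zeta (bpt n) w)‖ ^ (-s) = 6 ^ s * (6 ^ (-s) * ‖lorC (zeta (bpt n) w)‖ ^ (-s)) := by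
          rw [← mul_assoc, h5, one_mul]
      _ ≤ _ := by gcongr
  refine (setLIntegral_mono' measurableSet_tube h1).trans_lt ?_
  rw [lintegral_const_mul' _ _ ENNReal.ofReal_ne_top]
  refine ENNReal.mul_lt_top ENNReal.ofReal_lt_top
    ((setLIntegral_le_lintegral _ _).trans_lt (finite_integral_one_add_norm ?_))
  rw [Module.finrank_pi_fintype]
  simpa [mul_comm] using hs

/-- The Forelli–Rudin type estimate for the tube. -/
lemma exists_J {α β : ℝ} (hβ : 0 ≤ β) (hαβ : 2 * n < α - β) :
    ∃ C : ℝ≥0∞, C ≠ ⊤ ∧ ∀ z ∈ tube n,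
      ∫⁻ w in tube n, kk z w ^ (-α) * dl w ^ β ≤ C * dl z ^ (n + β - α) := by
  refine ⟨∫⁻ w in tube n, kk (bpt n) w ^ (-(α - β)), (lintegral_kk_base hαβ).ne, fun z hz => ?_⟩
  obtain ⟨τ, h1, h2, h3, h4, h5⟩ := exists_homogeneity' hz
  have hz0 := dl_ne_zero hz
  have hzt := dl_ne_top z
  rw [h5, mul_comm]
  have h6 : ∀ w ∈ tube n, kk z (τ w) ^ (-α) * dl (τ w) ^ β ≤
      kk (bpt n) w ^ (-(α - β)) * dl z ^ (β - α) := by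
    intro w hw
    have hk0 := kk_ne_zero bpt_mem hw
    have hkt := kk_ne_top (bpt n) w
    conv_lhs => rw [← h1]
    rw [h3, h4, ENNReal.mul_rpow_of_ne_top hzt hkt, ENNReal.mul_rpow_of_ne_top hzt (dl_ne_top w)]
    calc dl z ^ (-α) * kk (bpt n) w ^ (-α) * (dl z ^ β * dl w ^ β)
        ≤ dl z ^ (-α) * kk (bpt n) w ^ (-α) * (dl z ^ β * kk (bpt n) w ^ β) := by
          gcongr; exact dl_le_kk bpt_mem hw
      _ = (kk (bpt n) w ^ (-α) * kk (bpt n) w ^ β) * (dl z ^ β * dl z ^ (-α)) := by ring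
      _ = _ := by
          rw [← ENNReal.rpow_add _ _ hk0 hkt, ← ENNReal.rpow_add _ _ hz0 hzt]
          congr 2; ring
  refine (mul_le_mul_left (setLIntegral_mono' measurableSet_tube h6) _).trans ?_
  rw [lintegral_mul_const' _ _ (ENNReal.rpow_ne_top_of_ne_zero hz0 hzt), mul_assoc,
    ← ENNReal.rpow_add _ _ hz0 hzt]
  refine le_of_eq ?_
  congr 2; ring

end kernel

/-! ### Weighted estimates for positive kernel operators -/

lemma jensen_lintegral {α : Type*} [MeasurableSpace α] {μ : Measure α} {k f : α → ℝ≥0∞}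
    (hk : Measurable k) (hf : Measurable f) {p : ℝ} (hp : 1 ≤ p) :
    (∫⁻ a, k a * f a ∂μ) ^ p ≤ (∫⁻ a, k a ∂μ) ^ (p - 1) * ∫⁻ a, k a * f a ^ p ∂μ := by
  have hp0 : 0 < p := by linarith
  have h := eLpNorm'_le_eLpNorm'_mul_rpow_measure_univ (μ := μ.withDensity k) (f := f)
    zero_lt_one hp hf.aestronglyMeasurable
  simp only [eLpNorm', enorm_eq_self, ENNReal.rpow_one, div_one] at h
  rw [lintegral_withDensity_eq_lintegral_mul _ hk hf,
    lintegral_withDensity_eq_lintegral_mul _ hk (hf.pow_const p),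
    withDensity_apply _ MeasurableSet.univ, Measure.restrict_univ] at h
  simp only [Pi.mul_apply] at h
  refine (ENNReal.rpow_le_rpow h hp0.le).trans (le_of_eq ?_)
  rw [ENNReal.mul_rpow_of_nonneg _ _ hp0.le, ← ENNReal.rpow_mul, ← ENNReal.rpow_mul, mul_comm]
  congr 2
  · field_simp
  · field_simp; simp

section kernel
variable {n : ℕ} [NeZero n]

/-- The positive integral operator with kernel `|Δ(z - w̄)|^{-s} Δ(Im w)^β`. -/
def SOp (s β : ℝ) (f : (Fin n → ℂ) → ℝ≥0∞) (z : Fin n → ℂ) : ℝ≥0∞ :=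
  ∫⁻ w in tube n, kk z w ^ (-s) * dl w ^ β * f w

/-- The weighted integral `∫ f Δ^γ` over the tube. -/
def wInt (γ : ℝ) (f : (Fin n → ℂ) → ℝ≥0∞) : ℝ≥0∞ := ∫⁻ w in tube n, dl w ^ γ * f w

lemma dl_rpow_ne_top {w : Fin n → ℂ} (hw : w ∈ tube n) (t : ℝ) : dl w ^ t ≠ ⊤ :=
  ENNReal.rpow_ne_top_of_ne_zero (dl_ne_zero hw) (dl_ne_top w)

lemma dl_rpow_add {w : Fin n → ℂ} (hw : w ∈ tube n) (s t : ℝ) :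
    dl w ^ (s + t) = dl w ^ s * dl w ^ t :=
  ENNReal.rpow_add _ _ (dl_ne_zero hw) (dl_ne_top w)

lemma SOp_rpow_le {s β τ p : ℝ} (hp : 1 ≤ p) {f : (Fin n → ℂ) → ℝ≥0∞} (hf : Measurable f)
    (z : Fin n → ℂ) :
    SOp s β f z ^ p ≤ (∫⁻ w in tube n, kk z w ^ (-s) * dl w ^ (β - τ)) ^ (p - 1) *
      ∫⁻ w in tube n, kk z w ^ (-s) * (dl w ^ (β + τ * (p - 1)) * f w ^ p) := by
  have h := jensen_lintegral (μ := volume.restrict (tube n))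
    (k := fun w => kk z w ^ (-s) * dl w ^ (β - τ)) (f := fun w => dl w ^ τ * f w)
    (by fun_prop) (by fun_prop) hp
  convert h using 2
  · refine setLIntegral_congr_fun measurableSet_tube fun w hw => ?_
    have := dl_rpow_add hw (β - τ) τ
    rw [sub_add_cancel] at this
    simp only [this]; ring
  · refine setLIntegral_congr_fun measurableSet_tube fun w hw => ?_
    have : β + τ * (p - 1) = (β - τ) + τ * p := by ring
    rw [ENNReal.mul_rpow_of_nonneg _ _ (by linarith), ← ENNReal.rpow_mul, this, dl_rpow_add hw]
    ring

lemma schur {s β γ τ p : ℝ} (hp : 1 ≤ p) (h1 : τ ≤ β) (h2 : 2 * n < s - β + τ)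
    (h3 : 0 ≤ γ + (s - n - β) - τ * (p - 1)) (h4 : n + γ < β + τ * (p - 1)) :
    ∃ C : ℝ≥0∞, C ≠ ⊤ ∧ ∀ f : (Fin n → ℂ) → ℝ≥0∞, Measurable f →
      wInt (γ + p * (s - n - β)) (fun z => SOp s β f z ^ p) ≤ C * wInt γ (fun w => f w ^ p) := by
  obtain ⟨C₁, hC₁, hJ₁⟩ := exists_J (n := n) (α := s) (β := β - τ) (by linarith) (by linarith)
  obtain ⟨C₂, hC₂, hJ₂⟩ := exists_J (n := n) (α := s) (β := γ + (s - n - β) - τ * (p - 1))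
    h3 (by linarith)
  refine ⟨C₁ ^ (p - 1) * C₂,
    ENNReal.mul_ne_top (ENNReal.rpow_ne_top_of_nonneg (by linarith) hC₁) hC₂, fun f hf => ?_⟩
  set γ' := γ + (s - n - β) - τ * (p - 1) with hγ'
  have h5 : ∀ z ∈ tube n, dl z ^ (γ + p * (s - n - β)) * SOp s β f z ^ p ≤
      C₁ ^ (p - 1) * ∫⁻ w in tube n, dl z ^ γ' * (kk z w ^ (-s) *
        (dl w ^ (β + τ * (p - 1)) * f w ^ p)) := by
    intro z hz
    rw [lintegral_const_mul _ (by fun_prop), ← mul_assoc]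
    refine (mul_le_mul_right (SOp_rpow_le (τ := τ) hp hf z) _).trans ?_
    rw [← mul_assoc]
    refine mul_le_mul_left ?_ _
    refine (mul_le_mul_right (ENNReal.rpow_le_rpow (hJ₁ z hz) (by linarith : 0 ≤ p - 1)) _).trans ?_
    rw [ENNReal.mul_rpow_of_nonneg _ _ (by linarith : 0 ≤ p - 1), ← ENNReal.rpow_mul]
    rw [mul_left_comm, ← dl_rpow_add hz]
    refine le_of_eq ?_
    congr 2
    rw [hγ']; ring
  refine (setLIntegral_mono' measurableSet_tube h5).trans ?_
  have hC : C₁ ^ (p - 1) ≠ ⊤ := ENNReal.rpow_ne_top_of_nonneg (by linarith) hC₁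
  rw [lintegral_const_mul' _ _ hC, mul_assoc]
  refine mul_le_mul_right ?_ _
  rw [lintegral_lintegral_swap (by fun_prop), wInt, ← lintegral_const_mul' _ _ hC₂]
  refine setLIntegral_mono' measurableSet_tube fun w hw => ?_
  calc ∫⁻ z in tube n, dl z ^ γ' * (kk z w ^ (-s) * (dl w ^ (β + τ * (p - 1)) * f w ^ p))
      = (∫⁻ z in tube n, kk w z ^ (-s) * dl z ^ γ') * (dl w ^ (β + τ * (p - 1)) * f w ^ p) := by
        rw [← lintegral_mul_const _ (by fun_prop)]
        refine lintegral_congr fun z => ?_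
        rw [kk_comm w z]; ring
    _ ≤ (C₂ * dl w ^ (n + γ' - s)) * (dl w ^ (β + τ * (p - 1)) * f w ^ p) :=
        mul_le_mul_left (hJ₂ w hw) _
    _ = C₂ * ((dl w ^ (n + γ' - s) * dl w ^ (β + τ * (p - 1))) * f w ^ p) := by ring
    _ = _ := by
        rw [← dl_rpow_add hw]
        congr 3
        rw [hγ']; ring

lemma SOp_pointwise {s β γ τ p : ℝ} (hp : 1 ≤ p) (h1 : τ ≤ β) (h2 : 2 * n < s - β + τ)
    (h3 : 0 ≤ γ + (s - n - β) - τ * (p - 1)) (h4 : n + γ < β + τ * (p - 1))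
    {z : Fin n → ℂ} (hz : z ∈ tube n) :
    ∃ C : ℝ≥0∞, C ≠ ⊤ ∧ ∀ f : (Fin n → ℂ) → ℝ≥0∞, Measurable f →
      SOp s β f z ^ p ≤ C * wInt γ (fun w => f w ^ p) := by
  obtain ⟨C₁, hC₁, hJ₁⟩ := exists_J (n := n) (α := s) (β := β - τ) (by linarith) (by linarith)
  have hn : (0 : ℝ) ≤ n := by positivity
  set E := β + τ * (p - 1) - γ with hE
  refine ⟨(C₁ * dl z ^ (n + (β - τ) - s)) ^ (p - 1) * dl z ^ (E - s),
    ENNReal.mul_ne_top (ENNReal.rpow_ne_top_of_nonneg (by linarith)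
      (ENNReal.mul_ne_top hC₁ (dl_rpow_ne_top hz _))) (dl_rpow_ne_top hz _), fun f hf => ?_⟩
  refine (SOp_rpow_le (τ := τ) hp hf z).trans ?_
  rw [mul_assoc]
  refine mul_le_mul' (ENNReal.rpow_le_rpow (hJ₁ z hz) (by linarith)) ?_
  rw [wInt, ← lintegral_const_mul' _ _ (dl_rpow_ne_top hz _)]
  refine setLIntegral_mono' measurableSet_tube fun w hw => ?_
  have hk0 := kk_ne_zero hz hw
  have hkt := kk_ne_top z w
  have e : β + τ * (p - 1) = E + γ := by rw [hE]; ring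
  rw [e, dl_rpow_add hw]
  calc kk z w ^ (-s) * (dl w ^ E * dl w ^ γ * f w ^ p)
      ≤ kk z w ^ (-s) * (kk z w ^ E * dl w ^ γ * f w ^ p) := by
        gcongr
        · linarith
        · exact dl_le_kk hz hw
    _ = kk z w ^ (E - s) * (dl w ^ γ * f w ^ p) := by
        rw [sub_eq_add_neg, ENNReal.rpow_add _ _ hk0 hkt]; ring
    _ ≤ _ := by
        refine mul_le_mul_left ?_ _
        have e2 : E - s = -(s - E) := by ring
        rw [e2, ENNReal.rpow_neg, ENNReal.rpow_neg, ENNReal.inv_le_inv]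
        exact ENNReal.rpow_le_rpow (dl_le_kk' hz hw) (by linarith)

end kernel

/-! ### Holomorphic kernel operators -/

section kernel
variable {n : ℕ} [NeZero n]

lemma norm_bil_le {x y : Fin n → ℂ} {a b : ℝ} (hx : ∀ i, ‖x i‖ ≤ a) (hy : ∀ i, ‖y i‖ ≤ b) :
    ‖bil x y‖ ≤ (n + 2) * (a * b) := by
  have ha : 0 ≤ a := (norm_nonneg _).trans (hx 0)
  have h : ∀ i, ‖x i * y i‖ ≤ a * b := fun i => by
    rw [norm_mul]; exact mul_le_mul (hx i) (hy i) (norm_nonneg _) ha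
  have h2 : ‖∑ i, x i * y i‖ ≤ n * (a * b) := by
    refine (norm_sum_le _ _).trans ((Finset.sum_le_sum fun i _ => h i).trans ?_)
    simp
  have h3 : ‖2 * (x 0 * y 0)‖ ≤ 2 * (a * b) := by
    rw [norm_mul]; simpa using h 0
  refine (norm_sub_le _ _).trans ?_
  linarith

/-- The linear functional `bil x`. -/
def bilL (x : Fin n → ℂ) : (Fin n → ℂ) →L[ℂ] ℂ :=
  (2 * x 0) • ContinuousLinearMap.proj 0 - ∑ i, x i • ContinuousLinearMap.proj i

lemma bilL_apply (x y : Fin n → ℂ) : bilL x y = bil x y := by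
  simp [bilL, bil, mul_assoc]

lemma continuous_bilL : Continuous (bilL : (Fin n → ℂ) → _) := by
  unfold bilL; fun_prop

lemma norm_bilL_le {x : Fin n → ℂ} {a : ℝ} (hx : ∀ i, ‖x i‖ ≤ a) : ‖bilL x‖ ≤ (n + 2) * a := by
  have ha : 0 ≤ a := (norm_nonneg _).trans (hx 0)
  refine ContinuousLinearMap.opNorm_le_bound _ (by positivity) fun y => ?_
  rw [bilL_apply, mul_assoc]
  exact norm_bil_le hx (norm_le_pi_norm y)

lemma hasFDerivAt_lorC (z : Fin n → ℂ) : HasFDerivAt lorC ((2 : ℂ) • bilL z) z := by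
  have h : ∀ i, HasFDerivAt (fun z : Fin n → ℂ => z i ^ 2)
      ((2 * z i) • (ContinuousLinearMap.proj i : (Fin n → ℂ) →L[ℂ] ℂ)) z := by
    intro i
    have := (ContinuousLinearMap.proj (R := ℂ) (φ := fun _ : Fin n => ℂ) i).hasFDerivAt (x := z)
    exact (this.pow 2).congr_fderiv (by ext; simp)
  have h2 := ((h 0).const_mul 2).sub (HasFDerivAt.fun_sum fun i (_ : i ∈ Finset.univ) => h i)
  refine h2.congr_fderiv ?_
  ext v
  simp [bilL, mul_sub, Finset.mul_sum, mul_assoc]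

lemma hasFDerivAt_lorC_zeta (z w : Fin n → ℂ) :
    HasFDerivAt (fun z => lorC (zeta z w)) ((2 : ℂ) • bilL (zeta z w)) z := by
  have h : HasFDerivAt (fun z => zeta z w) (ContinuousLinearMap.id ℂ (Fin n → ℂ)) z := by
    have : (fun z => zeta z w) = fun z => z - (fun i => starRingEnd ℂ (w i)) := rfl
    rw [this]; exact (hasFDerivAt_id z).sub_const _
  exact ((hasFDerivAt_lorC (zeta z w)).comp z h).congr_fderiv (ContinuousLinearMap.comp_id _)

/-- Kernels at nearby (or fixed) points of the tube are comparable, locally uniformly. -/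
lemma exists_comparison (z₀ : Fin n → ℂ) {z₁ : Fin n → ℂ} (hz₁ : z₁ ∈ tube n) :
    ∃ ε > 0, ∃ C > 0, Metric.ball z₁ ε ⊆ tube n ∧ ∀ z ∈ Metric.ball z₁ ε, ∀ w ∈ tube n,
      ‖lorC (zeta z₀ w)‖ ≤ C * ‖lorC (zeta z w)‖ ∧ (∀ i, ‖zeta z w i‖ ≤ C * ‖lorC (zeta z w)‖) ∧
      1 ≤ C * ‖lorC (zeta z w)‖ := by
  obtain ⟨δ, hδ, h1⟩ := exists_coneIn hz₁
  have ho : IsOpen (imP ⁻¹' coneIn n δ ∩ tube n ∩ {z | lor (imP z₁) / 2 < lor (imP z)} :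
      Set (Fin n → ℂ)) :=
    (((isOpen_coneIn δ).preimage continuous_imP).inter isOpen_tube).inter
      (isOpen_lt continuous_const (continuous_lor.comp continuous_imP))
  have hl : 0 < lor (imP z₁) := hz₁.1
  obtain ⟨ε, hε, hb⟩ := Metric.isOpen_iff.1 ho z₁ ⟨⟨h1, hz₁⟩, by
    show lor (imP z₁) / 2 < lor (imP z₁); linarith⟩
  set R := ‖z₀ - z₁‖ + ε with hR
  have hR0 : 0 < R := by positivity
  set A := 2 / lor (imP z₁) with hA
  have hA0 : 0 < A := by positivity
  set B := 2 / δ with hB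
  have hB0 : 0 < B := by positivity
  have key : ∀ z ∈ Metric.ball z₁ ε, ∀ w ∈ tube n,
      ‖lorC (zeta z₀ w)‖ ≤ (1 + 2 * ((n + 2) * (B * R)) + (n + 2) * (R * R) * A) *
        ‖lorC (zeta z w)‖ ∧ (∀ i, ‖zeta z w i‖ ≤ B * ‖lorC (zeta z w)‖) ∧
      1 ≤ A * ‖lorC (zeta z w)‖ := by
    intro z hz w hw
    obtain ⟨⟨h2, h3⟩, h4⟩ := hb hz
    have hi : ∀ i, ‖zeta z w i‖ ≤ B * ‖lorC (zeta z w)‖ := by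
      refine norm_le_of_coneIn hδ ?_
      rw [imP_zeta]; exact coneIn_add h2 hw
    have hone : 1 ≤ A * ‖lorC (zeta z w)‖ := by
      have h5 := lor_le_norm_zeta h3 hw
      have h6 : lor (imP z₁) / 2 < lor (imP z) := h4
      have h7 := hw.1
      rw [hA, div_mul_eq_mul_div, le_div_iff₀ hl]; linarith
    refine ⟨?_, hi, hone⟩
    have e : zeta z₀ w = zeta z w + (z₀ - z) := by ext i; simp [zeta]
    have hh : ∀ i, ‖(z₀ - z) i‖ ≤ R := by
      intro i
      refine (norm_le_pi_norm _ i).trans ?_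
      have : z₀ - z = (z₀ - z₁) + (z₁ - z) := by abel
      rw [this]
      refine (norm_add_le _ _).trans ?_
      rw [Metric.mem_ball, dist_comm, dist_eq_norm] at hz
      linarith
    have h8 := norm_bil_le hi hh
    have h9 := norm_bil_le hh hh
    have h10 : lorC (zeta z₀ w) = lorC (zeta z w) + 2 * bil (zeta z w) (z₀ - z) +
        bil (z₀ - z) (z₀ - z) := by
      rw [e, lorC_eq, lorC_eq, bil_add_left, bil_add_right, bil_add_right,
        bil_comm (z₀ - z) (zeta z w)]; ring
    rw [h10]
    refine (norm_add₃_le).trans ?_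
    have h11 : ‖2 * bil (zeta z w) (z₀ - z)‖ = 2 * ‖bil (zeta z w) (z₀ - z)‖ := by simp
    rw [h11]
    have h12 : (n + 2) * (R * R) * 1 ≤ (n + 2) * (R * R) * (A * ‖lorC (zeta z w)‖) := by gcongr
    nlinarith
  refine ⟨ε, hε, (1 + 2 * ((n + 2) * (B * R)) + (n + 2) * (R * R) * A) + B + A, by positivity,
    fun z hz => (hb hz).1.2, fun z hz w hw => ?_⟩
  obtain ⟨h2, h3, h4⟩ := key z hz w hw
  have h5 := norm_nonneg (lorC (zeta z w))
  have h6 : 0 ≤ 1 + 2 * ((n + 2) * (B * R)) + (n + 2) * (R * R) * A := by positivity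
  refine ⟨h2.trans ?_, fun i => (h3 i).trans ?_, h4.trans ?_⟩ <;>
  · refine mul_le_mul_of_nonneg_right ?_ h5; linarith

/-- The integral operator with kernel `Δ(z - w̄)^{-s}`. -/
def TOp (s : ℕ) (f : (Fin n → ℂ) → ℂ) (z : Fin n → ℂ) : ℂ :=
  ∫ w in tube n, (lorC (zeta z w) ^ s)⁻¹ * f w

/-- Absolute convergence of the integral defining `TOp s f z`. -/
def TConv (s : ℕ) (f : (Fin n → ℂ) → ℂ) (z : Fin n → ℂ) : Prop :=
  IntegrableOn (fun w => (lorC (zeta z w) ^ s)⁻¹ * f w) (tube n)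

lemma continuous_zeta_right (z : Fin n → ℂ) : Continuous (fun w => zeta z w) := by
  unfold zeta; fun_prop

lemma measurable_lorC_zeta (z : Fin n → ℂ) (s : ℕ) :
    Measurable (fun w => (lorC (zeta z w) ^ s)⁻¹) :=
  ((continuous_lorC.comp (continuous_zeta_right z)).measurable.pow_const s).inv

lemma tconv_of_le {s t : ℕ} {f g : (Fin n → ℂ) → ℂ} (hg : Measurable g) {z₀ z : Fin n → ℂ}
    (hf : TConv s f z₀) {C : ℝ} (h : ∀ w ∈ tube n, ‖(lorC (zeta z w) ^ t)⁻¹ * g w‖ ≤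
      C * ‖(lorC (zeta z₀ w) ^ s)⁻¹ * f w‖) : TConv t g z := by
  refine Integrable.mono' (hf.norm.const_mul C)
    ((measurable_lorC_zeta z t).mul hg).aestronglyMeasurable ?_
  exact (ae_restrict_iff' measurableSet_tube).2 (ae_of_all _ h)

lemma norm_inv_pow_le {a b C : ℝ} (ha : 0 < a) (hC : 0 < C) (h : a ≤ C * b) (s : ℕ) :
    (b ^ s)⁻¹ ≤ C ^ s * (a ^ s)⁻¹ := by
  have hb : 0 < b := by
    by_contra hb
    nlinarith
  have h1 : a ^ s ≤ C ^ s * b ^ s := by rw [← mul_pow]; gcongr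
  rw [inv_eq_one_div, div_le_iff₀ (by positivity)]
  calc (1 : ℝ) = a ^ s * (a ^ s)⁻¹ := by field_simp
    _ ≤ C ^ s * b ^ s * (a ^ s)⁻¹ := by gcongr
    _ = _ := by ring

lemma TConv.of_point {s : ℕ} {f : (Fin n → ℂ) → ℂ} (hf : Measurable f) {z₀ z : Fin n → ℂ}
    (hz₀ : z₀ ∈ tube n) (hz : z ∈ tube n) (h : TConv s f z₀) : TConv s f z := by
  obtain ⟨ε, hε, C, hC, -, h2⟩ := exists_comparison z₀ hz
  refine tconv_of_le hf h (C := C ^ s) fun w hw => ?_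
  obtain ⟨h3, -, -⟩ := h2 z (Metric.mem_ball_self hε) w hw
  rw [norm_mul, norm_mul, ← mul_assoc, norm_inv, norm_inv, norm_pow, norm_pow]
  refine mul_le_mul_of_nonneg_right (norm_inv_pow_le ?_ hC h3 s) (norm_nonneg _)
  exact norm_pos_iff.2 (lorC_zeta_ne hz₀ hw)

lemma TConv.succ {s : ℕ} {f : (Fin n → ℂ) → ℂ} (hf : Measurable f) {z : Fin n → ℂ}
    (hz : z ∈ tube n) (h : TConv s f z) : TConv (s + 1) f z := by
  obtain ⟨ε, hε, C, hC, -, h2⟩ := exists_comparison z hz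
  refine tconv_of_le hf h (C := C) fun w hw => ?_
  obtain ⟨-, -, h3⟩ := h2 z (Metric.mem_ball_self hε) w hw
  have h4 : 0 < ‖lorC (zeta z w)‖ := norm_pos_iff.2 (lorC_zeta_ne hz hw)
  rw [norm_mul, norm_mul, ← mul_assoc, norm_inv, norm_inv, norm_pow, norm_pow, pow_succ, mul_inv,
    mul_comm C]
  gcongr
  rw [inv_eq_one_div, div_le_iff₀ h4]; exact h3

lemma measurable_conj_mul {f : (Fin n → ℂ) → ℂ} (hf : Measurable f) (i : Fin n) :
    Measurable (fun w => starRingEnd ℂ (w i) * f w) :=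
  (Complex.continuous_conj.comp (continuous_apply i)).measurable.mul hf

lemma TConv.succ_conj_mul {s : ℕ} {f : (Fin n → ℂ) → ℂ} (hf : Measurable f) {z : Fin n → ℂ}
    (hz : z ∈ tube n) (h : TConv s f z) (i : Fin n) :
    TConv (s + 1) (fun w => starRingEnd ℂ (w i) * f w) z := by
  obtain ⟨ε, hε, C, hC, -, h2⟩ := exists_comparison z hz
  refine tconv_of_le (measurable_conj_mul hf i) h (C := ‖z i‖ * C + C) fun w hw => ?_
  obtain ⟨-, h5, h3⟩ := h2 z (Metric.mem_ball_self hε) w hw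
  have h4 : 0 < ‖lorC (zeta z w)‖ := norm_pos_iff.2 (lorC_zeta_ne hz hw)
  have h6 : ‖starRingEnd ℂ (w i)‖ ≤ (‖z i‖ * C + C) * ‖lorC (zeta z w)‖ := by
    have : starRingEnd ℂ (w i) = z i - zeta z w i := by simp [zeta]
    rw [this]
    refine (norm_sub_le _ _).trans ?_
    nlinarith [h5 i, norm_nonneg (z i), mul_le_mul_of_nonneg_left h3 (norm_nonneg (z i))]
  rw [norm_mul, norm_mul, norm_mul, ← mul_assoc, ← mul_assoc, norm_inv, norm_inv, norm_pow,
    norm_pow, pow_succ, mul_inv]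
  refine mul_le_mul_of_nonneg_right ?_ (norm_nonneg _)
  calc (‖lorC (zeta z w)‖ ^ s)⁻¹ * ‖lorC (zeta z w)‖⁻¹ * ‖starRingEnd ℂ (w i)‖
      ≤ (‖lorC (zeta z w)‖ ^ s)⁻¹ * ‖lorC (zeta z w)‖⁻¹ *
        ((‖z i‖ * C + C) * ‖lorC (zeta z w)‖) := by gcongr
    _ = _ := by field_simp

/-- The derivative of the kernel `Δ(z - w̄)^{-s} f(w)` with respect to `z`. -/
def kerD (s : ℕ) (f : (Fin n → ℂ) → ℂ) (z w : Fin n → ℂ) : (Fin n → ℂ) →L[ℂ] ℂ :=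
  (-(2 * s) * ((lorC (zeta z w) ^ (s + 1))⁻¹ * f w)) • bilL (zeta z w)

lemma hasFDerivAt_ker (s : ℕ) (f : (Fin n → ℂ) → ℂ) {z w : Fin n → ℂ} (hz : z ∈ tube n)
    (hw : w ∈ tube n) :
    HasFDerivAt (fun z => (lorC (zeta z w) ^ s)⁻¹ * f w) (kerD s f z w) z := by
  have h0 := lorC_zeta_ne hz hw
  have h := ((hasDerivAt_inv (pow_ne_zero s h0)).comp_hasFDerivAt z
    ((hasFDerivAt_lorC_zeta z w).pow s)).mul_const (f w)
  refine h.congr_fderiv ?_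
  ext v
  rcases s with _ | s
  · simp [kerD]
  · simp [kerD]; field_simp; ring

lemma exists_hasFDerivAt_TOp {s : ℕ} {f : (Fin n → ℂ) → ℂ} (hf : Measurable f) {z : Fin n → ℂ}
    (hz : z ∈ tube n) (h : TConv s f z) :
    IntegrableOn (kerD s f z) (tube n) ∧
      HasFDerivAt (TOp s f) (∫ w in tube n, kerD s f z w) z := by
  obtain ⟨ε, hε, C, hC, h1, h2⟩ := exists_comparison z hz
  have hm : AEStronglyMeasurable (kerD s f z) (volume.restrict (tube n)) := by
    refine AEStronglyMeasurable.smul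
      (f := fun w => (-(2 * s) * ((lorC (zeta z w) ^ (s + 1))⁻¹ * f w)))
      (g := fun w => bilL (zeta z w)) ?_ ?_
    · exact (((measurable_lorC_zeta z (s + 1)).mul hf).const_mul _).aestronglyMeasurable
    · exact (continuous_bilL.comp (continuous_zeta_right z)).aestronglyMeasurable
  have hbd : ∀ x ∈ Metric.ball z ε, ∀ w ∈ tube n, ‖kerD s f x w‖ ≤
      (2 * s * ((n + 2) * C) * C ^ s) * ‖(lorC (zeta z w) ^ s)⁻¹ * f w‖ := by
    intro x hx w hw
    obtain ⟨h3, h4, -⟩ := h2 x hx w hw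
    have h5 : 0 < ‖lorC (zeta x w)‖ := norm_pos_iff.2 (lorC_zeta_ne (h1 hx) hw)
    have h6 : 0 < ‖lorC (zeta z w)‖ := norm_pos_iff.2 (lorC_zeta_ne hz hw)
    have h7 := norm_inv_pow_le h6 hC h3 s
    rw [kerD, norm_smul]
    calc ‖-(2 * (s : ℂ)) * ((lorC (zeta x w) ^ (s + 1))⁻¹ * f w)‖ * ‖bilL (zeta x w)‖
        ≤ ‖-(2 * (s : ℂ)) * ((lorC (zeta x w) ^ (s + 1))⁻¹ * f w)‖ *
          ((n + 2) * (C * ‖lorC (zeta x w)‖)) := by gcongr; exact norm_bilL_le h4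
      _ = 2 * s * ((n + 2) * C) * ((‖lorC (zeta x w)‖ ^ s)⁻¹ * ‖f w‖) := by
          simp only [norm_mul, norm_neg, norm_inv, norm_pow, pow_succ]
          simp only [RCLike.norm_ofNat, RCLike.norm_natCast]
          field_simp
      _ ≤ 2 * s * ((n + 2) * C) * (C ^ s * (‖lorC (zeta z w)‖ ^ s)⁻¹ * ‖f w‖) := by gcongr
      _ = _ := by rw [norm_mul, norm_inv, norm_pow]; ring
  have hint : Integrable (fun w => (2 * s * ((n + 2) * C) * C ^ s) *
      ‖(lorC (zeta z w) ^ s)⁻¹ * f w‖) (volume.restrict (tube n)) := h.norm.const_mul _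
  refine ⟨hint.mono' hm ((ae_restrict_iff' measurableSet_tube).2
    (ae_of_all _ fun w hw => hbd z (Metric.mem_ball_self hε) w hw)), ?_⟩
  refine hasFDerivAt_integral_of_dominated_of_fderiv_le (Metric.ball_mem_nhds z hε) ?_ h hm
    ((ae_restrict_iff' measurableSet_tube).2 (ae_of_all _ fun w hw x hx => hbd x hx w hw)) hint
    ((ae_restrict_iff' measurableSet_tube).2 (ae_of_all _ fun w hw x hx =>
      hasFDerivAt_ker s f (h1 hx) hw))
  exact Filter.Eventually.of_forall fun x =>
    ((measurable_lorC_zeta x s).mul hf).aestronglyMeasurable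

lemma differentiableOn_TOp {s : ℕ} {f : (Fin n → ℂ) → ℂ} (hf : Measurable f) {z₀ : Fin n → ℂ}
    (hz₀ : z₀ ∈ tube n) (h : TConv s f z₀) : DifferentiableOn ℂ (TOp s f) (tube n) :=
  fun _ hz => (exists_hasFDerivAt_TOp hf hz
    (h.of_point hf hz₀ hz)).2.differentiableAt.differentiableWithinAt

/-- The sign of the `i`-th coordinate in the Lorentz form. -/
def eps (i : Fin n) : ℂ := if i = 0 then 1 else -1

lemma bil_single (i : Fin n) (z : Fin n → ℂ) : bil z (Pi.single i 1) = eps i * z i := by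
  by_cases h : i = 0
  · subst h; simp [eps, bil_single_zero]
  · simp [eps, h, bil_single_ne h]

lemma eps_mul_eps (i : Fin n) : eps i * eps i = (1 : ℂ) := by
  by_cases h : i = 0 <;> simp [eps, h]

lemma sum_eps : ∑ i : Fin n, eps i = (2 - n : ℂ) := by
  have h : ∀ i : Fin n, eps i = (2 * (if i = 0 then 1 else 0) - 1 : ℂ) := by
    intro i; by_cases h : i = 0 <;> simp [eps, h]; norm_num
  simp [h, Finset.sum_sub_distrib]

lemma pd_TOp {s : ℕ} {f : (Fin n → ℂ) → ℂ} (hf : Measurable f) {z : Fin n → ℂ}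
    (hz : z ∈ tube n) (h : TConv s f z) (i : Fin n) :
    IntegrableOn (fun w => (lorC (zeta z w) ^ (s + 1))⁻¹ * (zeta z w i * f w)) (tube n) ∧
    pd i (TOp s f) z = -(2 * s) * eps i *
      ∫ w in tube n, (lorC (zeta z w) ^ (s + 1))⁻¹ * (zeta z w i * f w) := by
  have hA := (h.succ hf hz).const_mul (z i)
  have hB := h.succ_conj_mul hf hz i
  refine ⟨?_, ?_⟩
  · refine (hA.sub hB).congr (ae_of_all _ fun w => ?_)
    simp [zeta]; ring
  obtain ⟨h1, h2⟩ := exists_hasFDerivAt_TOp hf hz h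
  rw [pd, h2.fderiv, ContinuousLinearMap.integral_apply h1, ← integral_const_mul]
  refine integral_congr_ae (ae_of_all _ fun w => ?_)
  simp only [kerD, smul_apply, bilL_apply, bil_single, smul_eq_mul]; ring

lemma pd_TOp' {s : ℕ} {f : (Fin n → ℂ) → ℂ} (hf : Measurable f) {z : Fin n → ℂ}
    (hz : z ∈ tube n) (h : TConv s f z) (i : Fin n) :
    pd i (TOp s f) z = -(2 * s) * eps i *
      (z i * TOp (s + 1) f z - TOp (s + 1) (fun w => starRingEnd ℂ (w i) * f w) z) := by
  rw [(pd_TOp hf hz h i).2]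
  congr 1
  have e1 := integral_sub ((h.succ hf hz).const_mul (z i)) (h.succ_conj_mul hf hz i)
  rw [integral_const_mul] at e1
  refine Eq.trans ?_ e1
  refine integral_congr_ae (ae_of_all _ fun w => ?_)
  simp [zeta]; ring

lemma pd_congr {F G : (Fin n → ℂ) → ℂ} (h : EqOn F G (tube n)) (i : Fin n) :
    EqOn (pd i F) (pd i G) (tube n) := by
  intro z hz
  rw [pd, pd, Filter.EventuallyEq.fderiv_eq]
  exact Filter.eventuallyEq_of_mem (isOpen_tube.mem_nhds hz) h

lemma BoxOp_congr {F G : (Fin n → ℂ) → ℂ} (h : EqOn F G (tube n)) :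
    EqOn (BoxOp F) (BoxOp G) (tube n) := by
  intro z hz
  have := fun i => pd_congr (pd_congr h i) i hz
  simp [BoxOp, this]

lemma pd_pd_TOp {s : ℕ} {f : (Fin n → ℂ) → ℂ} (hf : Measurable f) {z : Fin n → ℂ}
    (hz : z ∈ tube n) (h : TConv s f z) (i : Fin n) :
    DifferentiableAt ℂ (pd i (TOp s f)) z ∧
    IntegrableOn (fun w => (lorC (zeta z w) ^ (s + 2))⁻¹ * (zeta z w i ^ 2 * f w)) (tube n) ∧
    pd i (pd i (TOp s f)) z = -(2 * s) * eps i * TOp (s + 1) f z + 4 * s * (s + 1) *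
      ∫ w in tube n, (lorC (zeta z w) ^ (s + 2))⁻¹ * (zeta z w i ^ 2 * f w) := by
  have hA := h.succ hf hz
  have hB := h.succ_conj_mul hf hz i
  have hfi := measurable_conj_mul hf i
  have e : EqOn (pd i (TOp s f)) (fun z => -(2 * s) * eps i *
      (z i * TOp (s + 1) f z - TOp (s + 1) (fun w => starRingEnd ℂ (w i) * f w) z)) (tube n) :=
    fun x hx => pd_TOp' hf hx (h.of_point hf hz hx) i
  have hdA := (exists_hasFDerivAt_TOp hf hz hA).2.differentiableAt.hasFDerivAt
  have hdB := (exists_hasFDerivAt_TOp hfi hz hB).2.differentiableAt.hasFDerivAt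
  have hproj := (ContinuousLinearMap.proj (R := ℂ) (φ := fun _ : Fin n => ℂ) i).hasFDerivAt (x := z)
  have hd := ((hproj.mul hdA).sub hdB).const_mul (-(2 * s) * eps i : ℂ)
  have hd' := hd.congr_of_eventuallyEq (Filter.eventuallyEq_of_mem (isOpen_tube.mem_nhds hz) e)
  obtain ⟨iA, pA⟩ := pd_TOp hf hz hA i
  obtain ⟨iB, pB⟩ := pd_TOp hfi hz hB i
  have hi : IntegrableOn (fun w => (lorC (zeta z w) ^ (s + 2))⁻¹ * (zeta z w i ^ 2 * f w))
      (tube n) := by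
    refine ((iA.const_mul (z i)).sub iB).congr (ae_of_all _ fun w => ?_)
    simp [zeta]; ring
  refine ⟨hd'.differentiableAt, hi, ?_⟩
  rw [pd, hd'.fderiv]
  have e2 : (∫ w in tube n, (lorC (zeta z w) ^ (s + 2))⁻¹ * (zeta z w i ^ 2 * f w)) =
      z i * (∫ w in tube n, (lorC (zeta z w) ^ (s + 1 + 1))⁻¹ * (zeta z w i * f w)) -
      ∫ w in tube n, (lorC (zeta z w) ^ (s + 1 + 1))⁻¹ *
        (zeta z w i * (starRingEnd ℂ (w i) * f w)) := by
    rw [← integral_const_mul, ← integral_sub (iA.const_mul (z i)) iB]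
    refine integral_congr_ae (ae_of_all _ fun w => ?_)
    simp [zeta]; ring
  rw [e2]
  rw [pd] at pA pB
  simp only [smul_apply, sub_apply,
    add_apply, pA, pB, ContinuousLinearMap.proj_apply, smul_eq_mul]
  have e3 := eps_mul_eps i
  push_cast
  simp only [Pi.single_eq_same]
  linear_combination (4 * (s : ℂ) * (s + 1)) * (z i * (∫ w in tube n,
    (lorC (zeta z w) ^ (s + 1 + 1))⁻¹ * (zeta z w i * f w)) -
      ∫ w in tube n, (lorC (zeta z w) ^ (s + 1 + 1))⁻¹ *
        (zeta z w i * (starRingEnd ℂ (w i) * f w))) * e3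

lemma BoxOp_TOp {s : ℕ} {f : (Fin n → ℂ) → ℂ} (hf : Measurable f) {z : Fin n → ℂ}
    (hz : z ∈ tube n) (h : TConv s f z) :
    BoxOp (TOp s f) z = -(4 * s * (s + 1 - n / 2)) * TOp (s + 1) f z := by
  have h1 := fun i => pd_pd_TOp hf hz h i
  simp only [BoxOp, (h1 _).2.2]
  have e : TOp (s + 1) f z = 2 * (∫ w in tube n, (lorC (zeta z w) ^ (s + 2))⁻¹ *
      (zeta z w 0 ^ 2 * f w)) - ∑ i, ∫ w in tube n, (lorC (zeta z w) ^ (s + 2))⁻¹ *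
      (zeta z w i ^ 2 * f w) := by
    rw [← integral_const_mul, ← integral_finsetSum _ fun i _ => (h1 i).2.1,
      ← integral_sub ((h1 0).2.1.const_mul 2) (integrable_finsetSum _ fun i _ => (h1 i).2.1), TOp]
    refine setIntegral_congr_fun measurableSet_tube fun w hw => ?_
    have h0 := lorC_zeta_ne hz hw
    rw [← Finset.mul_sum, ← Finset.sum_mul]
    have : lorC (zeta z w) = 2 * zeta z w 0 ^ 2 - ∑ i, zeta z w i ^ 2 := rfl
    have e2 : 2 * ((lorC (zeta z w) ^ (s + 2))⁻¹ * (zeta z w 0 ^ 2 * f w)) -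
      (lorC (zeta z w) ^ (s + 2))⁻¹ * ((∑ i, zeta z w i ^ 2) * f w) =
      (lorC (zeta z w) ^ (s + 2))⁻¹ * (lorC (zeta z w) * f w) := by rw [this]; ring
    rw [e2]; field_simp; ring
  rw [Finset.sum_add_distrib, ← Finset.mul_sum, ← Finset.sum_mul, ← Finset.mul_sum, sum_eps]
  have : eps (0 : Fin n) = 1 := by simp [eps]
  rw [this]
  linear_combination (4 * (s : ℂ) * (s + 1)) * e

end kernel

/-! ### The Cayley transform -/

section cayley
variable {n : ℕ} [NeZero n]

/-- The involution `(z₀, z') ↦ (z₀, -z')`. -/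
def spaceFlip (n : ℕ) [NeZero n] : (Fin n → ℂ) →L[ℂ] (Fin n → ℂ) :=
  (ContinuousLinearMap.proj (R := ℂ) (φ := fun _ : Fin n => ℂ) 0).smulRight
    (2 • Pi.single 0 1 : Fin n → ℂ) - ContinuousLinearMap.id ℂ (Fin n → ℂ)

lemma spaceFlip_apply (z : Fin n → ℂ) : spaceFlip n z = (2 * z 0) • Pi.single 0 1 - z := by
  ext i; simp [spaceFlip]; ring

lemma spaceFlip_spaceFlip (z : Fin n → ℂ) : spaceFlip n (spaceFlip n z) = z := by
  ext i; simp [spaceFlip_apply]; ring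

lemma bil_spaceFlip (z w : Fin n → ℂ) : bil (spaceFlip n z) (spaceFlip n w) = bil z w := by
  simp only [spaceFlip_apply, bil_sub_left, bil_sub_right, bil_smul_left, bil_smul_right,
    bil_single_zero, bil_comm (Pi.single 0 1) w]
  simp; ring

/-- The Jordan inverse `ω ↦ ω⁻¹ = (ω₀, -ω') / Δ(ω)`. -/
def jinv (ω : Fin n → ℂ) : Fin n → ℂ := (lorC ω)⁻¹ • spaceFlip n ω

lemma lorC_jinv (ω : Fin n → ℂ) : lorC (jinv ω) = (lorC ω)⁻¹ := by
  by_cases h : lorC ω = 0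
  · rw [jinv, h, inv_zero, zero_smul]; simp [lorC]
  · rw [jinv, lorC_eq, bil_smul_left, bil_smul_right, bil_spaceFlip, ← lorC_eq]; field_simp

lemma jinv_jinv {ω : Fin n → ℂ} (h : lorC ω ≠ 0) : jinv (jinv ω) = ω := by
  conv_lhs => rw [jinv, lorC_jinv, jinv, map_smul, spaceFlip_spaceFlip, inv_inv, smul_smul]
  rw [mul_inv_cancel₀ h, one_smul]

/-- The reflection `h ↦ h - 2 B(ω, h) / Δ(ω) ω`. -/
def lorRefl (ω : Fin n → ℂ) : (Fin n → ℂ) →L[ℂ] (Fin n → ℂ) :=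
  ContinuousLinearMap.id ℂ (Fin n → ℂ) - (bilL ω).smulRight ((2 * (lorC ω)⁻¹) • ω)

lemma lorRefl_lorRefl {ω : Fin n → ℂ} (h : lorC ω ≠ 0) (z : Fin n → ℂ) :
    lorRefl ω (lorRefl ω z) = z := by
  have e : ∀ x, lorRefl ω x = x - (bil ω x * (2 * (lorC ω)⁻¹)) • ω := by
    intro x; ext i; simp [lorRefl, bilL_apply, mul_assoc]
  rw [e, e, bil_sub_right, bil_smul_right, ← lorC_eq]
  ext i; simp only [Pi.sub_apply, Pi.smul_apply, smul_eq_mul]; field_simp; ring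

lemma hasFDerivAt_jinv {ω : Fin n → ℂ} (h : lorC ω ≠ 0) :
    HasFDerivAt jinv ((lorC ω)⁻¹ • (spaceFlip n ∘L lorRefl ω)) ω := by
  have h1 := ((hasDerivAt_inv h).comp_hasFDerivAt ω (hasFDerivAt_lorC ω)).smul
    (spaceFlip n).hasFDerivAt
  refine HasFDerivAt.congr_fderiv h1 ?_
  refine ContinuousLinearMap.ext fun v => ?_
  ext i
  simp [lorRefl, bilL_apply]
  field_simp; ring

lemma norm_det_of_involutive {L : (Fin n → ℂ) →ₗ[ℂ] (Fin n → ℂ)} (h : ∀ z, L (L z) = z) :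
    ‖LinearMap.det L‖ = 1 := by
  have h1 : L ∘ₗ L = LinearMap.id := LinearMap.ext h
  have h2 := congrArg (fun x => ‖LinearMap.det x‖) h1
  simp only [LinearMap.det_comp, LinearMap.det_id, norm_mul, norm_one] at h2
  nlinarith [norm_nonneg (LinearMap.det L)]

/-- The Cayley transform from the bounded realisation to the tube. -/
def cay (ζ : Fin n → ℂ) : Fin n → ℂ := (2 * I) • jinv (Pi.single 0 1 - ζ) - bpt n

/-- The inverse Cayley transform. -/
def caySymm (w : Fin n → ℂ) : Fin n → ℂ := Pi.single 0 1 - jinv ((2 * I)⁻¹ • (w + bpt n))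

/-- The defining function of the bounded realisation. -/
def rho (ζ : Fin n → ℂ) : ℝ := 1 - 2 * ∑ i, normSq (ζ i) + normSq (lorC ζ)

/-- The bounded realisation of the tube (the Lie ball). -/
def lieBall (n : ℕ) [NeZero n] : Set (Fin n → ℂ) := {ζ | 0 < rho ζ ∧ normSq (lorC ζ) < 1}

lemma continuous_rho : Continuous (rho : (Fin n → ℂ) → ℝ) := by
  have := Complex.continuous_normSq.comp (continuous_lorC (n := n))
  have h2 : ∀ i, Continuous fun ζ : Fin n → ℂ => normSq (ζ i) := fun i =>
    Complex.continuous_normSq.comp (continuous_apply i)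
  exact (continuous_const.sub (continuous_const.mul
    (continuous_finsetSum _ fun i _ => h2 i))).add this

lemma isOpen_lieBall : IsOpen (lieBall n) :=
  (isOpen_lt continuous_const continuous_rho).inter
    (isOpen_lt (Complex.continuous_normSq.comp continuous_lorC) continuous_const)

lemma lorC_smul (c : ℂ) (ζ : Fin n → ℂ) : lorC (c • ζ) = c ^ 2 * lorC ζ := by
  rw [lorC_eq, bil_smul_left, bil_smul_right, lorC_eq]; ring

lemma rho_smul (c : ℂ) (ζ : Fin n → ℂ) :
    rho (c • ζ) = 1 - 2 * (normSq c * ∑ i, normSq (ζ i)) + normSq c ^ 2 * normSq (lorC ζ) := by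
  simp only [rho, lorC_smul, Pi.smul_apply, smul_eq_mul, map_mul, ← Finset.mul_sum, map_pow]

lemma smul_mem_lieBall {c : ℂ} (hc : normSq c ≤ 1) {ζ : Fin n → ℂ} (hζ : ζ ∈ lieBall n) :
    c • ζ ∈ lieBall n := by
  obtain ⟨h1, h2⟩ := hζ
  have hs := normSq_nonneg c
  have hQ := normSq_nonneg (lorC ζ)
  refine ⟨?_, ?_⟩
  · rw [rho_smul]
    rw [rho] at h1
    set N := ∑ i, normSq (ζ i)
    rcases hs.eq_or_lt with h | h
    · rw [← h]; norm_num
    · have h3 : normSq c * (2 * N) < normSq c * (1 + normSq (lorC ζ)) := by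
        gcongr; linarith
      have h4 : normSq c * normSq (lorC ζ) ≤ 1 := by nlinarith
      nlinarith [mul_nonneg (sub_nonneg.2 hc) (sub_nonneg.2 h4)]
  · rw [lorC_smul, map_mul, map_pow]
    have : normSq c ^ 2 ≤ 1 := by nlinarith
    nlinarith

lemma zero_mem_lieBall : (0 : Fin n → ℂ) ∈ lieBall n := by
  constructor <;> simp [rho, lorC]

lemma norm_lt_of_mem_lieBall {ζ : Fin n → ℂ} (hζ : ζ ∈ lieBall n) : ‖ζ‖ < 1 := by
  obtain ⟨h1, h2⟩ := hζ
  rw [rho] at h1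
  refine (pi_norm_lt_iff one_pos).2 fun i => ?_
  have h3 : normSq (ζ i) ≤ ∑ i, normSq (ζ i) :=
    Finset.single_le_sum (f := fun i => normSq (ζ i)) (fun _ _ => normSq_nonneg _)
      (Finset.mem_univ i)
  rw [normSq_eq_norm_sq (ζ i)] at h3
  nlinarith [norm_nonneg (ζ i)]

lemma lorC_one_sub (ζ : Fin n → ℂ) : lorC (Pi.single 0 1 - ζ) = 1 - 2 * ζ 0 + lorC ζ := by
  rw [lorC_eq, lorC_eq, bil_sub_left, bil_sub_right, bil_sub_right, bil_single_zero,
    bil_single_zero, bil_comm, bil_single_zero]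
  simp; ring

lemma lor_imP_cay {ζ : Fin n → ℂ} (h : lorC (Pi.single 0 1 - ζ) ≠ 0) :
    lor (imP (cay ζ)) * normSq (lorC (Pi.single 0 1 - ζ)) = rho ζ ∧
    imP (cay ζ) 0 * normSq (lorC (Pi.single 0 1 - ζ)) =
      1 - normSq (lorC ζ) - 2 * (ζ 0 - starRingEnd ℂ (ζ 0) * lorC ζ).re := by
  set ω : Fin n → ℂ := Pi.single 0 1 - ζ with hω
  set X := jinv ω with hX
  have hP : normSq (lorC ω) ≠ 0 := by simpa using h
  have him : imP (cay ζ) = (2 : ℝ) • reP X - Pi.single 0 1 := by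
    ext i
    simp only [imP, cay, reP, ← hω, ← hX, Pi.sub_apply, Pi.smul_apply, smul_eq_mul, sub_im, mul_im,
      mul_re, re_ofNat, im_ofNat, I_re, I_im, bpt]
    by_cases hi : i = 0
    · subst hi; simp
    · simp [hi]
  have hX0 : X 0 = (lorC ω)⁻¹ * ω 0 := by
    simp [hX, jinv, spaceFlip_apply]; left; ring
  -- twice the form of the real part of `X`
  have hre : ∀ Y : Fin n → ℂ, 2 * lor (reP Y) =
      (lorC Y).re + (2 * normSq (Y 0) - ∑ i, normSq (Y i)) := by
    intro Y
    have h1 := lorC_re Y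
    have h2 : 2 * normSq (Y 0) - ∑ i, normSq (Y i) = lor (reP Y) + lor (imP Y) := by
      simp only [lor, reP, imP, normSq_apply, Finset.sum_add_distrib, pow_two]; ring
    linarith
  have hXn : 2 * normSq (X 0) - ∑ i, normSq (X i) =
      (normSq (lorC ω))⁻¹ * (2 * normSq (ω 0) - ∑ i, normSq (ω i)) := by
    have : ∀ i, normSq (X i) = (normSq (lorC ω))⁻¹ * normSq (ω i) := by
      intro i
      by_cases hi : i = 0
      · subst hi; rw [hX0, map_mul, map_inv₀]
      · simp [hX, jinv, spaceFlip_apply, hi]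
    simp only [this, ← Finset.mul_sum]; ring
  have hlor : lor (imP (cay ζ)) = 4 * lor (reP X) - 4 * (X 0).re + 1 := by
    rw [him, lor_eq, bil_sub_left, bil_sub_right, bil_sub_right, bil_smul_left, bil_smul_right,
      bil_single_zero, bil_single_zero, bil_comm (Pi.single 0 1), bil_single_zero, ← lor_eq]
    simp [reP]; ring
  have hq : lorC ω = 1 - 2 * ζ 0 + lorC ζ := lorC_one_sub ζ
  have hN : 2 * normSq (ω 0) - ∑ i, normSq (ω i) =
      normSq (1 - ζ 0) + normSq (ζ 0) - ∑ i, normSq (ζ i) := by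
    have h1 := Finset.add_sum_erase Finset.univ (fun i => normSq (ω i))
      (Finset.mem_univ (0 : Fin n))
    have h2 := Finset.add_sum_erase Finset.univ (fun i => normSq (ζ i))
      (Finset.mem_univ (0 : Fin n))
    have h3 : ∑ i ∈ Finset.univ.erase 0, normSq (ω i) =
        ∑ i ∈ Finset.univ.erase 0, normSq (ζ i) :=
      Finset.sum_congr rfl fun i hi => by simp [hω, (Finset.mem_erase.1 hi).1]
    rw [h3] at h1
    have h4 : ω 0 = 1 - ζ 0 := by simp [hω]
    simp only [h4] at *
    linarith
  have hX0re : (X 0).re * normSq (lorC ω) = (starRingEnd ℂ (lorC ω) * ω 0).re := by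
    have e : X 0 = ((normSq (lorC ω))⁻¹ : ℝ) * (starRingEnd ℂ (lorC ω) * ω 0) := by
      rw [hX0, inv_def]; ring
    rw [e, re_ofReal_mul]; field_simp
  have h4 : ω 0 = 1 - ζ 0 := by simp [hω]
  have hinv : (lorC X).re * normSq (lorC ω) = (lorC ω).re := by
    rw [hX, lorC_jinv, inv_re]; field_simp
  refine ⟨?_, ?_⟩
  · have h5 := hre X
    rw [hXn] at h5
    have h6 : 2 * lor (reP X) * normSq (lorC ω) = (lorC ω).re +
        (2 * normSq (ω 0) - ∑ i, normSq (ω i)) := by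
      rw [h5, add_mul, hinv, mul_right_comm, inv_mul_cancel₀ hP, one_mul]
    rw [hlor, rho]
    have e : (4 * lor (reP X) - 4 * (X 0).re + 1) * normSq (lorC ω) =
      2 * (2 * lor (reP X) * normSq (lorC ω)) - 4 * ((X 0).re * normSq (lorC ω)) +
        normSq (lorC ω) := by ring
    rw [e, h6, hX0re, hN, h4, hq]
    simp only [normSq_apply, mul_re, conj_re, conj_im, add_re, sub_re, add_im, sub_im, one_re,
      one_im, mul_im, re_ofNat, im_ofNat]
    ring
  · have e : imP (cay ζ) 0 * normSq (lorC ω) = 2 * ((X 0).re * normSq (lorC ω)) -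
        normSq (lorC ω) := by
      rw [him]; simp [reP]; ring
    rw [e, hX0re, h4, hq]
    simp only [normSq_apply, mul_re, conj_re, conj_im, add_re, sub_re, add_im, sub_im, one_re,
      one_im, mul_im, re_ofNat, im_ofNat]
    ring

lemma four_mul_normSq_lt {ζ : Fin n → ℂ} (h : 0 < rho ζ) :
    4 * normSq (ζ 0 - starRingEnd ℂ (ζ 0) * lorC ζ) < (1 - normSq (lorC ζ)) ^ 2 := by
  rw [rho] at h
  have h1 : ‖ζ 0 ^ 2 - lorC ζ‖ ≤ ∑ i, normSq (ζ i) - normSq (ζ 0) := by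
    have e1 := Finset.add_sum_erase Finset.univ (fun i => normSq (ζ i))
      (Finset.mem_univ (0 : Fin n))
    have e2 : ζ 0 ^ 2 - lorC ζ = ∑ i ∈ Finset.univ.erase 0, ζ i * ζ i := by
      rw [lorC_eq, bil_eq]; ring
    rw [e2]
    refine (norm_sum_le _ _).trans ?_
    have e3 : ∑ i ∈ Finset.univ.erase 0, ‖ζ i * ζ i‖ = ∑ i ∈ Finset.univ.erase 0, normSq (ζ i) :=
      Finset.sum_congr rfl fun i _ => by rw [norm_mul, normSq_eq_norm_sq, pow_two]
    rw [e3]; linarith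
  have h2 : ‖ζ 0 ^ 2 - lorC ζ‖ < (1 + normSq (lorC ζ)) / 2 - normSq (ζ 0) := by linarith
  have h3 : ‖ζ 0 ^ 2 - lorC ζ‖ ^ 2 < ((1 + normSq (lorC ζ)) / 2 - normSq (ζ 0)) ^ 2 := by
    gcongr
  rw [← normSq_eq_norm_sq] at h3
  have e : normSq (ζ 0 ^ 2 - lorC ζ) = normSq (ζ 0) ^ 2 + normSq (lorC ζ) -
      ((1 + normSq (lorC ζ)) * normSq (ζ 0) -
        normSq (ζ 0 - starRingEnd ℂ (ζ 0) * lorC ζ)) := by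
    simp only [normSq_apply, pow_two, mul_re, conj_re, conj_im, add_re, sub_re, add_im, sub_im,
      mul_im]
    ring
  rw [e] at h3
  nlinarith

lemma lorC_one_sub_ne {ζ : Fin n → ℂ} (hζ : ζ ∈ lieBall n) : lorC (Pi.single 0 1 - ζ) ≠ 0 := by
  obtain ⟨h1, h2⟩ := hζ
  have h3 := four_mul_normSq_lt h1
  intro h0
  rw [lorC_one_sub] at h0
  have h4 : 1 - normSq (lorC ζ) = 2 * (ζ 0 - starRingEnd ℂ (ζ 0) * lorC ζ).re := by
    have h5 : lorC ζ = 2 * ζ 0 - 1 := by linear_combination h0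
    rw [h5]
    simp only [normSq_apply, mul_re, conj_re, conj_im, sub_re, sub_im, one_re,
      one_im, mul_im, re_ofNat, im_ofNat]
    ring
  rw [h4, normSq_apply] at h3
  nlinarith [mul_self_nonneg (ζ 0 - starRingEnd ℂ (ζ 0) * lorC ζ).im]

lemma cay_mem {ζ : Fin n → ℂ} (hζ : ζ ∈ lieBall n) : cay ζ ∈ tube n := by
  have h0 := lorC_one_sub_ne hζ
  obtain ⟨h1, h2⟩ := lor_imP_cay h0
  have hP : 0 < normSq (lorC (Pi.single 0 1 - ζ)) := normSq_pos.2 h0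
  refine ⟨?_, ?_⟩
  · have : 0 < lor (imP (cay ζ)) * normSq (lorC (Pi.single 0 1 - ζ)) := by rw [h1]; exact hζ.1
    exact (pos_iff_pos_of_mul_pos this).2 hP
  · have h3 := four_mul_normSq_lt hζ.1
    have h4 := hζ.2
    have : 0 < imP (cay ζ) 0 * normSq (lorC (Pi.single 0 1 - ζ)) := by
      rw [h2]
      rw [normSq_apply] at h3
      have := mul_self_nonneg (ζ 0 - starRingEnd ℂ (ζ 0) * lorC ζ).im
      nlinarith
    exact (pos_iff_pos_of_mul_pos this).2 hP

lemma cay_caySymm {w : Fin n → ℂ} (hw : w ∈ tube n) :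
    lorC (Pi.single 0 1 - caySymm w) ≠ 0 ∧ cay (caySymm w) = w := by
  have h1 : w + bpt n ∈ tube n := (cone_add (x := imP w) (y := imP (bpt n)) hw bpt_mem).2
  have h0 := lorC_ne_zero h1
  have hI : (2 * I : ℂ) ≠ 0 := by simp
  have h2 : lorC ((2 * I)⁻¹ • (w + bpt n)) ≠ 0 := by
    rw [lorC_smul]; exact mul_ne_zero (pow_ne_zero _ (inv_ne_zero hI)) h0
  have e : (Pi.single 0 1 : Fin n → ℂ) - caySymm w = jinv ((2 * I)⁻¹ • (w + bpt n)) := by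
    simp [caySymm]
  refine ⟨?_, ?_⟩
  · rw [e, lorC_jinv]; exact inv_ne_zero h2
  · rw [cay, e, jinv_jinv h2, smul_smul, mul_inv_cancel₀ hI, one_smul, add_sub_cancel_right]

lemma caySymm_mem {w : Fin n → ℂ} (hw : w ∈ tube n) : caySymm w ∈ lieBall n := by
  obtain ⟨h0, h1⟩ := cay_caySymm hw
  obtain ⟨h2, h3⟩ := lor_imP_cay h0
  rw [h1] at h2 h3
  have hP : 0 < normSq (lorC (Pi.single 0 1 - caySymm w)) := normSq_pos.2 h0
  have h4 : 0 < rho (caySymm w) := by rw [← h2]; exact mul_pos hw.1 hP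
  refine ⟨h4, ?_⟩
  have h5 : 0 < imP w 0 * normSq (lorC (Pi.single 0 1 - caySymm w)) := mul_pos hw.2 hP
  rw [h3] at h5
  have h6 := four_mul_normSq_lt h4
  rw [normSq_apply (caySymm w 0 - _)] at h6
  by_contra h7
  have := mul_self_nonneg
    (caySymm w 0 - starRingEnd ℂ (caySymm w 0) * lorC (caySymm w)).im
  nlinarith

lemma caySymm_cay {ζ : Fin n → ℂ} (h : lorC (Pi.single 0 1 - ζ) ≠ 0) : caySymm (cay ζ) = ζ := by
  have hI : (2 * I : ℂ) ≠ 0 := by simp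
  rw [caySymm, cay, sub_add_cancel, smul_smul, inv_mul_cancel₀ hI, one_smul, jinv_jinv h,
    sub_sub_cancel]

lemma cay_image : Set.image cay (lieBall n) = tube n := by
  ext w
  refine ⟨?_, fun hw => ⟨caySymm w, caySymm_mem hw, (cay_caySymm hw).2⟩⟩
  rintro ⟨ζ, hζ, rfl⟩; exact cay_mem hζ

lemma cay_injOn : InjOn cay (lieBall n) := by
  intro a ha b hb hab
  rw [← caySymm_cay (lorC_one_sub_ne ha), hab, caySymm_cay (lorC_one_sub_ne hb)]

/-- The derivative of the Cayley transform. -/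
def cayD (ζ : Fin n → ℂ) : (Fin n → ℂ) →L[ℂ] (Fin n → ℂ) :=
  -((2 * I) • (lorC (Pi.single 0 1 - ζ))⁻¹ • (spaceFlip n ∘L lorRefl (Pi.single 0 1 - ζ)))

lemma hasFDerivAt_cay {ζ : Fin n → ℂ} (h : lorC (Pi.single 0 1 - ζ) ≠ 0) :
    HasFDerivAt cay (cayD ζ) ζ := by
  have h1 : HasFDerivAt (fun ζ : Fin n → ℂ => Pi.single 0 1 - ζ)
      (-ContinuousLinearMap.id ℂ (Fin n → ℂ)) ζ := (hasFDerivAt_id ζ).const_sub _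
  have h2 := (((hasFDerivAt_jinv h).comp ζ h1).const_smul (2 * I)).sub_const (bpt n)
  refine HasFDerivAt.congr_fderiv h2 ?_
  refine ContinuousLinearMap.ext fun v => ?_
  simp [cayD]

lemma abs_det_cayD {ζ : Fin n → ℂ} (h : lorC (Pi.single 0 1 - ζ) ≠ 0) :
    |((cayD ζ).restrictScalars ℝ).det| = (4 / normSq (lorC (Pi.single 0 1 - ζ))) ^ n := by
  set ω : Fin n → ℂ := Pi.single 0 1 - ζ with hω
  have h1 : ((cayD ζ).restrictScalars ℝ).det =
      normSq (LinearMap.det (cayD ζ : (Fin n → ℂ) →ₗ[ℂ] (Fin n → ℂ))) := by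
    have := LinearMap.det_restrictScalars (R := ℝ)
      (f := (cayD ζ : (Fin n → ℂ) →ₗ[ℂ] (Fin n → ℂ)))
    rw [Algebra.norm_complex_apply] at this
    exact this
  have h2 : (cayD ζ : (Fin n → ℂ) →ₗ[ℂ] (Fin n → ℂ)) = (-(2 * I) * (lorC ω)⁻¹) •
      ((spaceFlip n : (Fin n → ℂ) →ₗ[ℂ] (Fin n → ℂ)) ∘ₗ
        (lorRefl ω : (Fin n → ℂ) →ₗ[ℂ] (Fin n → ℂ))) := by
    refine LinearMap.ext fun v => ?_
    simp [cayD, smul_smul, ← hω]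
  rw [h1, h2, LinearMap.det_smul, LinearMap.det_comp, abs_of_nonneg (normSq_nonneg _), map_mul,
    map_mul, map_pow, normSq_eq_norm_sq (LinearMap.det _), normSq_eq_norm_sq (LinearMap.det _),
    norm_det_of_involutive (fun z => spaceFlip_spaceFlip z),
    norm_det_of_involutive (fun z => lorRefl_lorRefl h z)]
  simp only [Module.finrank_fintype_fun_eq_card, Fintype.card_fin, map_mul, map_neg, map_inv₀,
    normSq_neg, normSq_I]
  norm_num [normSq_ofNat, div_eq_mul_inv]

end cayley

/-! ### The reproducing formula -/

section reproducing
variable {n : ℕ} [NeZero n]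

lemma measurable_indicator_of_continuousOn {X : Type*} [TopologicalSpace X] [MeasurableSpace X]
    [BorelSpace X] {f : X → ℂ} {s : Set X} (hs : MeasurableSet s) (hf : ContinuousOn f s) :
    Measurable (s.indicator f) := by
  classical
  rw [← Set.piecewise_eq_indicator]
  exact hf.measurable_piecewise continuous_const.continuousOn hs

lemma measurePreserving_unit_smul {c : ℂ} (hc : ‖c‖ = 1) :
    MeasurePreserving (fun ζ : Fin n → ℂ => c • ζ) := by
  let u : Circle := ⟨c, by simp [Submonoid.unitSphere, hc]⟩
  have := volume_preserving_pi (ι := Fin n) (α' := fun _ => ℂ) (β' := fun _ => ℂ)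
    (f := fun _ => rotation u) fun _ => (rotation u).measurePreserving
  exact this

lemma measurableEmbedding_smul {c : ℂ} (hc : c ≠ 0) :
    MeasurableEmbedding (fun ζ : Fin n → ℂ => c • ζ) :=
  (Homeomorph.smulOfNeZero c hc).measurableEmbedding

lemma smul_mem_lieBall_iff {c : ℂ} (hc : ‖c‖ = 1) {ζ : Fin n → ℂ} :
    c • ζ ∈ lieBall n ↔ ζ ∈ lieBall n := by
  have h0 : c ≠ 0 := by rintro rfl; simp at hc
  refine ⟨fun h => ?_, smul_mem_lieBall (by rw [normSq_eq_norm_sq, hc]; norm_num)⟩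
  have := smul_mem_lieBall (c := c⁻¹) (by rw [normSq_eq_norm_sq, norm_inv, hc]; norm_num) h
  rwa [smul_smul, inv_mul_cancel₀ h0, one_smul] at this

lemma rho_smul_of_norm {c : ℂ} (hc : ‖c‖ = 1) (ζ : Fin n → ℂ) : rho (c • ζ) = rho ζ := by
  rw [rho_smul, normSq_eq_norm_sq, hc, rho]; ring

lemma circle_mean {Φ : (Fin n → ℂ) → ℂ} (hΦ : DifferentiableOn ℂ Φ (lieBall n))
    {ζ : Fin n → ℂ} (hζ : ζ ∈ lieBall n) :
    ∫ θ in Ioc 0 (2 * Real.pi), Φ (circleMap 0 1 θ • ζ) = (2 * Real.pi : ℝ) * Φ 0 := by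
  have hm : ∀ t ∈ Metric.closedBall (0 : ℂ) 1, t • ζ ∈ lieBall n := by
    intro t ht
    refine smul_mem_lieBall ?_ hζ
    rw [mem_closedBall_zero_iff] at ht
    rw [normSq_eq_norm_sq]; nlinarith [norm_nonneg t]
  have hd : ∀ t ∈ Metric.closedBall (0 : ℂ) 1, DifferentiableAt ℂ (fun t : ℂ => Φ (t • ζ)) t := by
    intro t ht
    exact ((hΦ _ (hm t ht)).differentiableAt (isOpen_lieBall.mem_nhds (hm t ht))).comp t
      (differentiableAt_id.smul_const ζ)
  have := circleAverage_of_differentiable_on_off_countable (f := fun t : ℂ => Φ (t • ζ))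
    (c := 0) (R := 1) (s := ∅) countable_empty
    (fun t ht => (hd t (by simpa using ht)).continuousAt.continuousWithinAt)
    (fun t ht => hd t (Metric.ball_subset_closedBall (by simpa using ht.1)))
  rw [Real.circleAverage_def, zero_smul,
    intervalIntegral.integral_of_le (by positivity), inv_smul_eq_iff₀ (by positivity)] at this
  rw [this, real_smul]

lemma integral_lieBall {k : ℕ} {Φ : (Fin n → ℂ) → ℂ} (hΦ : DifferentiableOn ℂ Φ (lieBall n))
    (hi : IntegrableOn (fun ζ => (rho ζ : ℂ) ^ k * Φ ζ) (lieBall n)) :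
    ∫ ζ in lieBall n, (rho ζ : ℂ) ^ k * Φ ζ =
      ((∫ ζ in lieBall n, rho ζ ^ k : ℝ) : ℂ) * Φ 0 := by
  have hD := (isOpen_lieBall (n := n)).measurableSet
  set G : (Fin n → ℂ) → ℂ := (lieBall n).indicator fun ζ => (rho ζ : ℂ) ^ k * Φ ζ with hG
  have hGm : Measurable G := measurable_indicator_of_continuousOn hD
    (((continuous_ofReal.comp continuous_rho).pow k).continuousOn.mul hΦ.continuousOn)
  have hGi : Integrable G := (integrable_indicator_iff hD).2 hi
  have hc : ∀ θ : ℝ, ‖circleMap 0 1 θ‖ = 1 := fun θ => by simp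
  have hc0 : ∀ θ : ℝ, circleMap 0 1 θ ≠ 0 := fun θ h => by
    have := hc θ; rw [h] at this; simp at this
  set μ : Measure ℝ := volume.restrict (Ioc 0 (2 * Real.pi)) with hμ
  have hcont : Continuous fun q : ℝ × (Fin n → ℂ) => circleMap 0 1 q.1 • q.2 :=
    ((continuous_circleMap 0 1).comp continuous_fst).smul continuous_snd
  have hprod : Integrable (Function.uncurry fun (θ : ℝ) ζ => G (circleMap 0 1 θ • ζ))
      (μ.prod volume) := by
    refine (integrable_prod_iff (hGm.comp hcont.measurable).aestronglyMeasurable).2 ⟨?_, ?_⟩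
    · exact Filter.Eventually.of_forall fun θ =>
        ((measurePreserving_unit_smul (hc θ)).integrable_comp_emb
          (measurableEmbedding_smul (hc0 θ))).2 hGi
    · have : ∀ θ : ℝ, ∫ ζ, ‖G (circleMap 0 1 θ • ζ)‖ = ∫ ζ, ‖G ζ‖ := fun θ =>
        (measurePreserving_unit_smul (hc θ)).integral_comp (measurableEmbedding_smul (hc0 θ))
          fun ζ => ‖G ζ‖
      exact (integrable_const (∫ ζ, ‖G ζ‖)).congr
        (Filter.Eventually.of_forall fun θ => (this θ).symm)
  have hsw := integral_integral_swap hprod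
  have h1 : ∀ θ : ℝ, ∫ ζ, G (circleMap 0 1 θ • ζ) = ∫ ζ, G ζ := fun θ =>
    (measurePreserving_unit_smul (hc θ)).integral_comp (measurableEmbedding_smul (hc0 θ)) G
  have h2 : ∀ ζ, ∫ θ, G (circleMap 0 1 θ • ζ) ∂μ =
      (lieBall n).indicator (fun ζ => ((rho ζ ^ k : ℝ) : ℂ) * ((2 * Real.pi : ℝ) * Φ 0)) ζ := by
    intro ζ
    by_cases hζ : ζ ∈ lieBall n
    · have : ∀ θ : ℝ, G (circleMap 0 1 θ • ζ) =
          ((rho ζ : ℂ) ^ k) * Φ (circleMap 0 1 θ • ζ) := by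
        intro θ
        rw [hG, indicator_of_mem ((smul_mem_lieBall_iff (hc θ)).2 hζ), rho_smul_of_norm (hc θ)]
      simp only [this]
      rw [integral_const_mul, circle_mean hΦ hζ, indicator_of_mem hζ, ofReal_pow]
    · have : ∀ θ : ℝ, G (circleMap 0 1 θ • ζ) = 0 := by
        intro θ
        rw [hG, indicator_of_notMem (fun h => hζ ((smul_mem_lieBall_iff (hc θ)).1 h))]
      simp only [this, integral_zero]
      rw [indicator_of_notMem hζ]
  simp only [h1, h2] at hsw
  rw [integral_const, hG, integral_indicator hD, integral_indicator hD, integral_mul_const,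
    integral_complex_ofReal] at hsw
  have h3 : μ.real univ = 2 * Real.pi := by
    rw [hμ, measureReal_restrict_apply MeasurableSet.univ, univ_inter,
      Real.volume_real_Ioc_of_le (by positivity)]
    ring
  rw [h3, real_smul] at hsw
  have h4 : ((2 * Real.pi : ℝ) : ℂ) ≠ 0 := by exact_mod_cast (by positivity)
  apply mul_left_cancel₀ h4
  rw [hsw]; ring

lemma integral_rho_pos (k : ℕ) : 0 < ∫ ζ in lieBall n, rho ζ ^ k := by
  have hD := (isOpen_lieBall (n := n)).measurableSet
  have hvol : volume (lieBall n) < ⊤ := by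
    refine (measure_mono fun ζ hζ => ?_).trans_lt (measure_ball_lt_top (x := (0 : Fin n → ℂ))
      (r := 1))
    simpa using norm_lt_of_mem_lieBall hζ
  have hint : IntegrableOn (fun ζ => rho ζ ^ k) (lieBall n) := by
    refine Measure.integrableOn_of_bounded (M := 2 ^ k) hvol.ne
      (continuous_rho.pow k).aestronglyMeasurable ?_
    refine (ae_restrict_iff' hD).2 (Filter.Eventually.of_forall fun ζ hζ => ?_)
    rw [norm_pow, Real.norm_of_nonneg hζ.1.le]
    have : rho ζ ≤ 2 := by
      have := hζ.2
      have := Finset.sum_nonneg fun i (_ : i ∈ Finset.univ) => normSq_nonneg (ζ i)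
      rw [rho]; linarith
    exact pow_le_pow_left₀ hζ.1.le this k
  rw [setIntegral_pos_iff_support_of_nonneg_ae _ hint]
  · have : Function.support (fun ζ : Fin n → ℂ => rho ζ ^ k) ∩ lieBall n = lieBall n := by
      refine inter_eq_right.2 fun ζ hζ => ?_
      exact (pow_pos hζ.1 k).ne'
    rw [this]
    exact isOpen_lieBall.measure_pos volume ⟨0, zero_mem_lieBall⟩
  · refine (ae_restrict_iff' hD).2 (Filter.Eventually.of_forall fun ζ hζ => ?_)
    exact (pow_pos hζ.1 k).le

/-- The integrand of the reproducing formula. -/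
def repIntegrand (n : ℕ) [NeZero n] (k : ℕ) (f : (Fin n → ℂ) → ℂ) (z w : Fin n → ℂ) : ℂ :=
  (lorC (zeta z w) ^ (n + k))⁻¹ * (f w * (lor (imP w) : ℂ) ^ k)

lemma repIntegrand_cay (k : ℕ) (f : (Fin n → ℂ) → ℂ) {ζ : Fin n → ℂ} (hζ : ζ ∈ lieBall n) :
    |((cayD ζ).restrictScalars ℝ).det| • repIntegrand n k f (bpt n) (cay ζ) =
      (4 ^ n * (-(1 / 4)) ^ (n + k) : ℂ) * ((rho ζ : ℂ) ^ k *
        ((lorC (Pi.single 0 1 - ζ) ^ (n + k))⁻¹ * f (cay ζ))) := by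
  have h0 := lorC_one_sub_ne hζ
  set Q := lorC (Pi.single 0 1 - ζ) with hQ
  have h1 : lorC (zeta (bpt n) (cay ζ)) = starRingEnd ℂ (-4 * Q⁻¹) := by
    have e : zeta (bpt n) (cay ζ) =
        fun i => starRingEnd ℂ (-((2 * I) • jinv (Pi.single 0 1 - ζ)) i) := by
      ext i
      by_cases hi : i = 0
      · subst hi; simp [zeta, cay, bpt]
      · simp [zeta, cay, bpt, hi]
    have e2 : ∀ x : Fin n → ℂ, lorC (fun i => starRingEnd ℂ (-(x i))) = starRingEnd ℂ (lorC x) := by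
      intro x; simp [lorC, map_ofNat]
    rw [e, e2, lorC_smul, lorC_jinv, mul_pow, I_sq]; norm_num [hQ]
  have h2 : (lor (imP (cay ζ)) : ℂ) = rho ζ / (Q * starRingEnd ℂ Q) := by
    have h3 := (lor_imP_cay h0).1
    rw [eq_div_iff (mul_ne_zero h0 (by simpa using h0)), mul_conj, ← h3, hQ]
    push_cast; rfl
  rw [abs_det_cayD h0, ← hQ, repIntegrand, h1, h2, real_smul]
  have h5 : starRingEnd ℂ Q ≠ 0 := by simpa using h0
  push_cast
  rw [← mul_conj]
  simp only [map_mul, map_inv₀, map_neg, map_ofNat, mul_pow, div_pow, inv_pow, mul_inv, pow_add,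
    neg_pow (4 : ℂ), neg_pow (1 / 4 : ℂ), one_pow]
  have h6 : ((-1 : ℂ) ^ n)⁻¹ = (-1) ^ n := by rw [← inv_pow]; norm_num
  have h7 : ((-1 : ℂ) ^ k)⁻¹ = (-1) ^ k := by rw [← inv_pow]; norm_num
  rw [h6, h7]
  field_simp

lemma exists_reproducing (n : ℕ) [NeZero n] (k : ℕ) : ∃ c : ℂ, c ≠ 0 ∧
    ∀ f : (Fin n → ℂ) → ℂ, DifferentiableOn ℂ f (tube n) → ∀ z ∈ tube n,
      IntegrableOn (repIntegrand n k f z) (tube n) →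
        ∫ w in tube n, repIntegrand n k f z w = c * f z := by
  set c₀ : ℂ := 4 ^ n * (-(1 / 4)) ^ (n + k) with hc₀
  refine ⟨c₀ * ((∫ ζ in lieBall n, rho ζ ^ k : ℝ) : ℂ), ?_, ?_⟩
  · refine mul_ne_zero (mul_ne_zero (by norm_num) (pow_ne_zero _ (by norm_num))) ?_
    exact_mod_cast (integral_rho_pos k).ne'
  have hD := (isOpen_lieBall (n := n)).measurableSet
  have hfd : ∀ ζ ∈ lieBall n, HasFDerivWithinAt cay ((cayD ζ).restrictScalars ℝ) (lieBall n) ζ :=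
    fun ζ hζ => ((hasFDerivAt_cay (lorC_one_sub_ne hζ)).restrictScalars ℝ).hasFDerivWithinAt
  have hc₀' : c₀ ≠ 0 := mul_ne_zero (by norm_num) (pow_ne_zero _ (by norm_num))
  have base : ∀ f : (Fin n → ℂ) → ℂ, DifferentiableOn ℂ f (tube n) →
      IntegrableOn (repIntegrand n k f (bpt n)) (tube n) →
        ∫ w in tube n, repIntegrand n k f (bpt n) w =
          c₀ * ((∫ ζ in lieBall n, rho ζ ^ k : ℝ) : ℂ) * f (bpt n) := by
    intro f hf hi
    set Φ : (Fin n → ℂ) → ℂ := fun ζ => (lorC (Pi.single 0 1 - ζ) ^ (n + k))⁻¹ * f (cay ζ) with hΦ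
    have hΦd : DifferentiableOn ℂ Φ (lieBall n) := by
      intro ζ hζ
      have h0 := lorC_one_sub_ne hζ
      have h1 : DifferentiableAt ℂ (fun ζ : Fin n → ℂ => lorC (Pi.single 0 1 - ζ)) ζ :=
        (hasFDerivAt_lorC _).differentiableAt.comp ζ (differentiableAt_id.const_sub _)
      have h2 : DifferentiableAt ℂ (fun ζ => f (cay ζ)) ζ :=
        ((hf _ (cay_mem hζ)).differentiableAt (isOpen_tube.mem_nhds (cay_mem hζ))).comp ζ
          (hasFDerivAt_cay h0).differentiableAt
      exact (((h1.pow _).inv (pow_ne_zero _ h0)).mul h2).differentiableWithinAt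
    rw [← cay_image] at hi ⊢
    rw [integrableOn_image_iff_integrableOn_abs_det_fderiv_smul volume hD hfd cay_injOn] at hi
    rw [integral_image_eq_integral_abs_det_fderiv_smul volume hD hfd cay_injOn]
    rw [integrableOn_congr_fun (fun ζ hζ => repIntegrand_cay k f hζ) hD] at hi
    rw [setIntegral_congr_fun hD (fun ζ hζ => repIntegrand_cay k f hζ), integral_const_mul]
    have hi' : IntegrableOn (fun ζ => (rho ζ : ℂ) ^ k * Φ ζ) (lieBall n) := by
      refine ((hi.const_mul c₀⁻¹).congr ?_)
      refine Filter.Eventually.of_forall fun ζ => ?_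
      simp only [← hc₀]
      rw [inv_mul_cancel_left₀ hc₀']
    rw [integral_lieBall hΦd hi', ← hc₀]
    have : Φ 0 = f (bpt n) := by
      have h1 : lorC (Pi.single 0 1 : Fin n → ℂ) = 1 := by
        rw [lorC_eq, bil_single_zero]; simp
      have h2 : cay (0 : Fin n → ℂ) = bpt n := by
        ext i
        by_cases hi : i = 0
        · subst hi; simp [cay, jinv, h1, spaceFlip_apply, bpt]; ring
        · simp [cay, jinv, h1, spaceFlip_apply, bpt, hi]
      simp [hΦ, h1, h2]
    rw [this]; ring
  intro f hf z hz hi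
  obtain ⟨τ, h1, h2, h3, h4, h5, h6, h7⟩ := exists_homogeneity hz
  set d : ℝ := lor (imP z) with hd
  have hd0 : 0 < d := hz.1
  have hmap : ∀ w, repIntegrand n k f z (τ w) =
      ((d : ℂ) ^ n)⁻¹ * repIntegrand n k (f ∘ τ) (bpt n) w := by
    intro w
    have hdc : (d : ℂ) ≠ 0 := by exact_mod_cast hd0.ne'
    have e : lorC (zeta z (τ w)) = d * lorC (zeta (bpt n) w) := by rw [← h4, h1]
    simp only [repIntegrand, h5, Function.comp, e]
    push_cast
    rw [mul_pow, mul_inv, pow_add, mul_inv, mul_pow]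
    field_simp
  have hr : volume.restrict (tube n) = ENNReal.ofReal (d ^ n) •
      (volume.restrict (tube n)).map τ := by
    rw [h7, smul_smul, ← ENNReal.ofReal_mul (by positivity),
      mul_inv_cancel₀ (by positivity), ENNReal.ofReal_one, one_smul]
  have hi2 : IntegrableOn (repIntegrand n k (f ∘ τ) (bpt n)) (tube n) := by
    rw [IntegrableOn, hr, integrable_smul_measure (by simp; positivity) (by simp),
      h6.integrable_map_iff] at hi
    have hdc : (d : ℂ) ^ n ≠ 0 := pow_ne_zero _ (by exact_mod_cast hd0.ne')
    refine (hi.const_mul ((d : ℂ) ^ n)).congr (Filter.Eventually.of_forall fun w => ?_)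
    simp only [Function.comp]
    rw [hmap, mul_inv_cancel_left₀ hdc]
  have := base (f ∘ τ) (fun w hw => (((hf _ ((h3 w).2 hw)).differentiableAt
    (isOpen_tube.mem_nhds ((h3 w).2 hw))).comp w (h2 w)).differentiableWithinAt) hi2
  rw [hr, integral_smul_measure, h6.integral_map]
  simp only [hmap]
  rw [integral_const_mul, this, ENNReal.toReal_ofReal (by positivity), real_smul, Function.comp, h1]
  have hdc : (d : ℂ) ^ n ≠ 0 := pow_ne_zero _ (by exact_mod_cast hd0.ne')
  push_cast
  field_simp

end reproducing

/-! ### Smoothness, and boundedness of the Box operator -/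

section smooth
variable {n : ℕ} [NeZero n]

lemma contDiffOn_TOp (m : ℕ) : ∀ {s : ℕ} {f : (Fin n → ℂ) → ℂ}, Measurable f →
    ∀ {z₀ : Fin n → ℂ}, z₀ ∈ tube n → TConv s f z₀ → ContDiffOn ℂ m (TOp s f) (tube n) := by
  induction m with
  | zero =>
    intro s f hf z₀ hz₀ h
    simpa using (differentiableOn_TOp hf hz₀ h).continuousOn
  | succ m ih =>
    intro s f hf z₀ hz₀ h
    push_cast
    refine (contDiffOn_succ_iff_fderiv_of_isOpen isOpen_tube).2
      ⟨differentiableOn_TOp hf hz₀ h, by simp, ?_⟩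
    have hpd : ∀ i : Fin n, ContDiffOn ℂ m (pd i (TOp s f)) (tube n) := by
      intro i
      refine ContDiffOn.congr ?_ fun x hx => pd_TOp' hf hx (h.of_point hf hz₀ hx) i
      refine contDiffOn_const.mul ((ContDiffOn.mul ?_ ?_).sub ?_)
      · exact (contDiff_apply ℂ ℂ i).contDiffOn
      · exact ih hf hz₀ (h.succ hf hz₀)
      · exact ih (measurable_conj_mul hf i) hz₀ (h.succ_conj_mul hf hz₀ i)
    have e : fderiv ℂ (TOp s f) = fun z => ∑ i, pd i (TOp s f) z •
        (ContinuousLinearMap.proj (R := ℂ) (φ := fun _ : Fin n => ℂ) i) := by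
      funext z
      refine ContinuousLinearMap.ext fun v => ?_
      conv_lhs => rw [pi_eq_sum_univ' v]
      simp only [map_sum, map_smul, pd, sum_apply, smul_apply,
        ContinuousLinearMap.proj_apply, smul_eq_mul]
      refine Finset.sum_congr rfl fun i _ => ?_
      exact mul_comm _ _
    rw [e]
    exact ContDiffOn.sum fun i _ => (hpd i).smul contDiffOn_const

lemma ContDiffOn.pd {F : (Fin n → ℂ) → ℂ} (hF : ContDiffOn ℂ (⊤ : ℕ∞) F (tube n)) (i : Fin n) :
    ContDiffOn ℂ (⊤ : ℕ∞) (pd i F) (tube n) :=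
  (hF.fderiv_of_isOpen isOpen_tube (m := (⊤ : ℕ∞)) (by simp)).clm_apply contDiffOn_const

lemma ContDiffOn.boxOp {F : (Fin n → ℂ) → ℂ} (hF : ContDiffOn ℂ (⊤ : ℕ∞) F (tube n)) :
    ContDiffOn ℂ (⊤ : ℕ∞) (BoxOp F) (tube n) :=
  (((contDiffOn_const.mul ((hF.pd 0).pd 0)).sub
    (ContDiffOn.sum fun i _ => (hF.pd i).pd i))).neg

lemma ContDiffOn.differentiableAt_tube {F : (Fin n → ℂ) → ℂ}
    (hF : ContDiffOn ℂ (⊤ : ℕ∞) F (tube n)) {z : Fin n → ℂ} (hz : z ∈ tube n) :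
    DifferentiableAt ℂ F z :=
  (hF.contDiffAt (isOpen_tube.mem_nhds hz)).differentiableAt (by simp)

lemma BoxOp_eq (F : (Fin n → ℂ) → ℂ) (z : Fin n → ℂ) :
    BoxOp F z = -∑ i, eps i * pd i (pd i F) z := by
  have h : ∀ i : Fin n, eps i = (2 * (if i = 0 then 1 else 0) - 1 : ℂ) := by
    intro i; by_cases h : i = 0 <;> simp [eps, h]; norm_num
  simp [BoxOp, h, sub_mul, Finset.sum_sub_distrib]

lemma pd_mul {P H : (Fin n → ℂ) → ℂ} {z : Fin n → ℂ} (hP : DifferentiableAt ℂ P z)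
    (hH : DifferentiableAt ℂ H z) (i : Fin n) :
    pd i (fun z => P z * H z) z = pd i P z * H z + P z * pd i H z := by
  rw [pd, fderiv_fun_mul hP hH]
  simp [pd]; ring

lemma BoxOp_mul {P H : (Fin n → ℂ) → ℂ} (hP : ContDiffOn ℂ (⊤ : ℕ∞) P (tube n))
    (hH : ContDiffOn ℂ (⊤ : ℕ∞) H (tube n)) {z : Fin n → ℂ} (hz : z ∈ tube n) :
    BoxOp (fun z => P z * H z) z =
      BoxOp P z * H z + P z * BoxOp H z - 2 * ∑ i, eps i * (pd i P z * pd i H z) := by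
  have h1 : ∀ i, pd i (pd i fun z => P z * H z) z =
      pd i (pd i P) z * H z + P z * pd i (pd i H) z + 2 * (pd i P z * pd i H z) := by
    intro i
    rw [pd_congr (G := fun z => pd i P z * H z + P z * pd i H z) (fun x hx =>
      pd_mul (hP.differentiableAt_tube hx) (hH.differentiableAt_tube hx) i) i hz]
    have hPz := hP.differentiableAt_tube hz
    have hHz := hH.differentiableAt_tube hz
    have hP1 := (hP.pd i).differentiableAt_tube hz
    have hH1 := (hH.pd i).differentiableAt_tube hz
    have : pd i (fun z => pd i P z * H z + P z * pd i H z) z =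
        pd i (fun z => pd i P z * H z) z + pd i (fun z => P z * pd i H z) z := by
      rw [pd, pd, pd, fderiv_fun_add (hP1.fun_mul hHz) (hPz.fun_mul hH1)]; rfl
    rw [this, pd_mul hP1 hHz, pd_mul hPz hH1]; ring
  simp only [BoxOp_eq, h1, mul_add, Finset.sum_add_distrib, Finset.mul_sum, Finset.sum_mul,
    neg_mul, mul_neg, ← Finset.sum_neg_distrib, ← Finset.sum_sub_distrib,
    ← Finset.sum_add_distrib]
  refine Finset.sum_congr rfl fun i _ => ?_
  ring

lemma contDiff_lorC_zeta_pow (b : Fin n → ℂ) (N : ℕ) :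
    ContDiff ℂ (⊤ : ℕ∞) fun z => lorC (zeta z b) ^ N := by
  simp only [lorC, zeta]; fun_prop

lemma pd_lorC_pow (b z : Fin n → ℂ) (N : ℕ) (i : Fin n) :
    pd i (fun z => lorC (zeta z b) ^ (N + 1)) z =
      2 * (N + 1) * (eps i * (zeta z b i * lorC (zeta z b) ^ N)) := by
  rw [pd, ((hasFDerivAt_lorC_zeta z b).pow (N + 1)).fderiv]
  simp [bilL_apply, bil_single]; ring

lemma BoxOp_lorC_pow (b z : Fin n → ℂ) (N : ℕ) :
    BoxOp (fun z => lorC (zeta z b) ^ (N + 2)) z =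
      -(4 * (N + 2) * (N + 1 + n / 2)) * lorC (zeta z b) ^ (N + 1) := by
  have h1 : ∀ i, pd i (pd i fun z => lorC (zeta z b) ^ (N + 2)) z =
      2 * (N + 2) * (eps i * (lorC (zeta z b) ^ (N + 1) +
        zeta z b i * (2 * (N + 1) * (eps i * (zeta z b i * lorC (zeta z b) ^ N))))) := by
    intro i
    have e : pd i (fun z => lorC (zeta z b) ^ (N + 2)) = fun z =>
        (2 * (N + 2) * eps i) * (zeta z b i * lorC (zeta z b) ^ (N + 1)) := by
      funext x; rw [pd_lorC_pow b x (N + 1) i]; push_cast; ring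
    have hz : HasFDerivAt (fun z : Fin n → ℂ => zeta z b i)
        (ContinuousLinearMap.proj (R := ℂ) (φ := fun _ : Fin n => ℂ) i) z :=
      ((ContinuousLinearMap.proj (R := ℂ) (φ := fun _ : Fin n => ℂ) i).hasFDerivAt).sub_const _
    have hd : DifferentiableAt ℂ (fun z => lorC (zeta z b) ^ (N + 1)) z :=
      (contDiff_lorC_zeta_pow b (N + 1)).differentiable (by simp) z
    have h2 : pd i (fun z : Fin n → ℂ => zeta z b i) z = 1 := by
      rw [pd, hz.fderiv]; simp
    have h3 := pd_mul hz.differentiableAt hd i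
    rw [h2, pd_lorC_pow] at h3
    rw [e, pd, fderiv_const_mul (hz.differentiableAt.fun_mul hd)]
    rw [pd] at h3
    rw [smul_apply, h3, smul_eq_mul]; ring
  have h4 : lorC (zeta z b) = ∑ i, eps i * zeta z b i ^ 2 := by
    have h : ∀ i : Fin n, eps i = (2 * (if i = 0 then 1 else 0) - 1 : ℂ) := by
      intro i; by_cases h : i = 0 <;> simp [eps, h]; norm_num
    simp [lorC, h, sub_mul, Finset.sum_sub_distrib]
  rw [BoxOp_eq]
  have h5 : ∀ i : Fin n, eps i * (2 * ((N : ℂ) + 2) * (eps i * (lorC (zeta z b) ^ (N + 1) +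
        zeta z b i * (2 * (N + 1) * (eps i * (zeta z b i * lorC (zeta z b) ^ N)))))) =
      2 * ((N : ℂ) + 2) * lorC (zeta z b) ^ (N + 1) +
        4 * (N + 2) * (N + 1) * lorC (zeta z b) ^ N * (eps i * zeta z b i ^ 2) := by
    intro i
    linear_combination (2 * ((N : ℂ) + 2) * (lorC (zeta z b) ^ (N + 1) +
        zeta z b i * (2 * (N + 1) * (eps i * (zeta z b i * lorC (zeta z b) ^ N))))) *
        eps_mul_eps i
  simp only [h1, h5, Finset.sum_add_distrib, ← Finset.mul_sum, ← h4]
  simp; ring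

end smooth

/-! ### Boundedness of the Box operator on Bergman spaces -/

section bounded
variable {n : ℕ} [NeZero n]

lemma lpInt_eq {p : ℝ} (hp : 0 ≤ p) (ν : ℝ) (F : (Fin n → ℂ) → ℂ) :
    lpInt n p ν F = wInt (ν - n / 2) fun w => ‖F w‖ₑ ^ p := by
  have hm : Measurable fun z : Fin n → ℂ =>
      ENNReal.ofReal (lor (imP z) ^ (ν - (n : ℝ) / 2)) :=
    ((continuous_lor.comp continuous_imP).measurable.pow_const _).ennreal_ofReal
  rw [lpInt, dV, lintegral_withDensity_eq_lintegral_mul_non_measurable _ hm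
    (ae_of_all _ fun _ => ENNReal.ofReal_lt_top), wInt]
  refine setLIntegral_congr_fun measurableSet_tube fun w hw => ?_
  simp only [Pi.mul_apply, dl]
  rw [ENNReal.ofReal_rpow_of_pos hw.1, ← ENNReal.ofReal_rpow_of_nonneg (norm_nonneg _) hp,
    ofReal_norm]

lemma wInt_congr {γ : ℝ} {f g : (Fin n → ℂ) → ℝ≥0∞} (h : EqOn f g (tube n)) :
    wInt γ f = wInt γ g :=
  setLIntegral_congr_fun measurableSet_tube fun w hw => by simp only [h hw]

lemma wInt_mono {γ : ℝ} {f g : (Fin n → ℂ) → ℝ≥0∞} (h : ∀ w ∈ tube n, f w ≤ g w) :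
    wInt γ f ≤ wInt γ g :=
  setLIntegral_mono' measurableSet_tube fun w hw => by gcongr; exact h w hw

lemma wInt_const_mul {γ : ℝ} {C : ℝ≥0∞} (hC : C ≠ ⊤) (f : (Fin n → ℂ) → ℝ≥0∞) :
    wInt γ (fun w => C * f w) = C * wInt γ f := by
  rw [wInt, wInt, ← lintegral_const_mul' _ _ hC]
  exact lintegral_congr fun w => by ring

lemma wInt_dl_mul {γ δ : ℝ} (f : (Fin n → ℂ) → ℝ≥0∞) :
    wInt γ (fun w => dl w ^ δ * f w) = wInt (γ + δ) f := by
  refine setLIntegral_congr_fun measurableSet_tube fun w hw => ?_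
  simp only [dl_rpow_add hw]; ring

/-- Extension by zero of the restriction of `F` to the tube. -/
def ext0 (F : (Fin n → ℂ) → ℂ) : (Fin n → ℂ) → ℂ := (tube n).indicator F

lemma ext0_eqOn (F : (Fin n → ℂ) → ℂ) : EqOn (ext0 F) F (tube n) := fun _ hw =>
  indicator_of_mem hw F

lemma measurable_ext0 {F : (Fin n → ℂ) → ℂ} (hF : DifferentiableOn ℂ F (tube n)) :
    Measurable (ext0 F) :=
  measurable_indicator_of_continuousOn measurableSet_tube hF.continuousOn

/-- The density `g(w) Δ(Im w)^k`. -/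
def wtd (k : ℕ) (g : (Fin n → ℂ) → ℂ) (w : Fin n → ℂ) : ℂ := g w * (lor (imP w) : ℂ) ^ k

lemma measurable_wtd (k : ℕ) {g : (Fin n → ℂ) → ℂ} (hg : Measurable g) : Measurable (wtd k g) :=
  hg.mul ((continuous_ofReal.comp (continuous_lor.comp continuous_imP)).measurable.pow_const k)

lemma enorm_inv_lorC_pow {z w : Fin n → ℂ} (hz : z ∈ tube n) (hw : w ∈ tube n) (s : ℕ) :
    ‖(lorC (zeta z w) ^ s)⁻¹‖ₑ = kk z w ^ (-(s : ℝ)) := by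
  rw [enorm_inv (pow_ne_zero _ (lorC_zeta_ne hz hw)), enorm_pow, ENNReal.rpow_neg,
    ENNReal.rpow_natCast]; rfl

lemma enorm_wtd {k : ℕ} {g : (Fin n → ℂ) → ℂ} {w : Fin n → ℂ} (hw : w ∈ tube n) :
    ‖wtd k g w‖ₑ = dl w ^ (k : ℝ) * ‖g w‖ₑ := by
  rw [wtd, enorm_mul, enorm_pow, ENNReal.rpow_natCast, mul_comm]
  congr 2
  rw [dl, ← ofReal_norm, norm_real, Real.norm_of_nonneg hw.1.le]

lemma lintegral_enorm_TOp {s k : ℕ} {g : (Fin n → ℂ) → ℂ} {z : Fin n → ℂ} (hz : z ∈ tube n) :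
    ∫⁻ w in tube n, ‖(lorC (zeta z w) ^ s)⁻¹ * wtd k g w‖ₑ = SOp s k (fun w => ‖g w‖ₑ) z := by
  refine setLIntegral_congr_fun measurableSet_tube fun w hw => ?_
  simp only []
  rw [enorm_mul, enorm_inv_lorC_pow hz hw, enorm_wtd hw, mul_assoc]

lemma tconv_wtd {s k : ℕ} {g : (Fin n → ℂ) → ℂ} (hg : Measurable g) {z : Fin n → ℂ}
    (hz : z ∈ tube n) (h : SOp s k (fun w => ‖g w‖ₑ) z ≠ ⊤) : TConv s (wtd k g) z := by
  refine ⟨((measurable_lorC_zeta z s).mul (measurable_wtd k hg)).aestronglyMeasurable, ?_⟩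
  rw [HasFiniteIntegral, lintegral_enorm_TOp hz]
  exact h.lt_top

lemma enorm_TOp_le {s k : ℕ} {g : (Fin n → ℂ) → ℂ} {z : Fin n → ℂ} (hz : z ∈ tube n) :
    ‖TOp s (wtd k g) z‖ₑ ≤ SOp s k (fun w => ‖g w‖ₑ) z := by
  rw [← lintegral_enorm_TOp hz]; exact enorm_integral_le_lintegral_enorm _

/-- `F` divided by the `N`-th power of `Δ(w - b̄)`, extended by zero. -/
def damp (N : ℕ) (F : (Fin n → ℂ) → ℂ) (b : Fin n → ℂ) (w : Fin n → ℂ) : ℂ :=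
  ext0 F w * (lorC (zeta w b) ^ N)⁻¹

lemma measurable_damp {N : ℕ} {F : (Fin n → ℂ) → ℂ} (hF : DifferentiableOn ℂ F (tube n))
    (b : Fin n → ℂ) : Measurable (damp N F b) :=
  (measurable_ext0 hF).mul
    ((continuous_lorC.comp (continuous_zeta.comp (by fun_prop : Continuous fun w : Fin n → ℂ =>
      (w, b)))).measurable.pow_const N).inv

lemma SOp_damp {s : ℝ} {k N : ℕ} {F : (Fin n → ℂ) → ℂ} {b : Fin n → ℂ} (hb : b ∈ tube n) :
    SOp s k (fun w => ‖damp N F b w‖ₑ) b = SOp (s + N) k (fun w => ‖ext0 F w‖ₑ) b := by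
  refine setLIntegral_congr_fun measurableSet_tube fun w hw => ?_
  simp only [damp]
  rw [enorm_mul, enorm_inv_lorC_pow hw hb, kk_comm w b, neg_add,
    ENNReal.rpow_add _ _ (kk_ne_zero hb hw) (kk_ne_top _ _)]
  ring

/-- The representation of holomorphic functions by damped kernels. -/
lemma exists_repr (n : ℕ) [NeZero n] (k N : ℕ) : ∃ c : ℂ, c ≠ 0 ∧
    ∀ F : (Fin n → ℂ) → ℂ, DifferentiableOn ℂ F (tube n) → ∀ b ∈ tube n,
      SOp ((n + k : ℕ) + N) k (fun w => ‖ext0 F w‖ₑ) b ≠ ⊤ →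
      TConv (n + k) (wtd k (damp N F b)) b ∧
      EqOn F (fun z => (c * lorC (zeta z b) ^ N) * TOp (n + k) (wtd k (damp N F b)) z)
        (tube n) := by
  obtain ⟨c, hc, h⟩ := exists_reproducing n k
  refine ⟨c⁻¹, inv_ne_zero hc, fun F hF b hb hS => ?_⟩
  have hm := measurable_damp (N := N) hF b
  have hT : TConv (n + k) (wtd k (damp N F b)) b := by
    refine tconv_wtd hm hb ?_
    rw [SOp_damp hb]; exact hS
  refine ⟨hT, fun z hz => ?_⟩
  have hTz := hT.of_point (measurable_wtd k hm) hb hz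
  have hd : DifferentiableOn ℂ (fun w => F w * (lorC (zeta w b) ^ N)⁻¹) (tube n) := by
    intro w hw
    exact ((hF w hw).mul ((((hasFDerivAt_lorC_zeta w b).pow N).differentiableAt.fun_inv
      (pow_ne_zero _ (lorC_zeta_ne hw hb))).differentiableWithinAt))
  have he : EqOn (fun w => (lorC (zeta z w) ^ (n + k))⁻¹ * wtd k (damp N F b) w)
      (repIntegrand n k (fun w => F w * (lorC (zeta w b) ^ N)⁻¹) z) (tube n) := by
    intro w hw
    simp only [repIntegrand, wtd, damp, ext0_eqOn F hw]
  have h2 := h _ hd z hz ((integrableOn_congr_fun he measurableSet_tube).1 hTz)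
  rw [← setIntegral_congr_fun measurableSet_tube he] at h2
  have h0 := pow_ne_zero N (lorC_zeta_ne hz hb)
  simp only [TOp]
  rw [h2]; field_simp

end bounded

section bounded
variable {n : ℕ} [NeZero n]

lemma zeta_self (z : Fin n → ℂ) : zeta z z = (2 * I) • toC (imP z) := by
  ext i
  simp only [zeta, toC, imP, Pi.smul_apply, smul_eq_mul, sub_conj]
  push_cast; ring

lemma norm_lorC_zeta_self {z : Fin n → ℂ} (hz : z ∈ tube n) :
    ‖lorC (zeta z z)‖ = 4 * lor (imP z) := by
  rw [zeta_self, lorC_smul, lorC_eq, bil_toC, ← lor_eq, norm_mul, norm_real,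
    Real.norm_of_nonneg hz.1.le]
  norm_num

lemma cross_term {s N : ℕ} {f : (Fin n → ℂ) → ℂ} (hf : Measurable f) {z : Fin n → ℂ}
    (hz : z ∈ tube n) (h : TConv s f z) :
    ∑ i, eps i * (pd i (fun x => lorC (zeta x z) ^ (N + 1)) z * pd i (TOp s f) z) =
      (-(8 * I) * (N + 1) * s) * lorC (zeta z z) ^ N *
        ∫ w in tube n, (lorC (zeta z w) ^ (s + 1))⁻¹ * (bil (zeta z w) (toC (imP z)) * f w) := by
  have h1 := fun i => pd_TOp hf hz h i
  have e : (∫ w in tube n, (lorC (zeta z w) ^ (s + 1))⁻¹ * (bil (zeta z w) (toC (imP z)) * f w)) =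
      ∑ i, eps i * (imP z i) *
        ∫ w in tube n, (lorC (zeta z w) ^ (s + 1))⁻¹ * (zeta z w i * f w) := by
    simp only [← integral_const_mul]
    rw [← integral_finsetSum _ fun i _ => (h1 i).1.const_mul _]
    refine integral_congr_ae (ae_of_all _ fun w => ?_)
    have hb : bil (zeta z w) (toC (imP z)) = ∑ i, eps i * imP z i * zeta z w i := by
      have h : ∀ i : Fin n, eps i = (2 * (if i = 0 then 1 else 0) - 1 : ℂ) := by
        intro i; by_cases h : i = 0 <;> simp [eps, h]; norm_num
      simp only [bil, toC, h, sub_mul, Finset.sum_sub_distrib]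
      simp [mul_comm]; ring
    simp only [hb, Finset.sum_mul, Finset.mul_sum]
    exact Finset.sum_congr rfl fun i _ => by ring
  rw [e, Finset.mul_sum]
  refine Finset.sum_congr rfl fun i _ => ?_
  rw [pd_lorC_pow, (h1 i).2, zeta_self]
  simp only [Pi.smul_apply, smul_eq_mul, toC]
  linear_combination (-(8 * I) * (N + 1) * s) * lorC ((2 * I) • toC (imP z)) ^ N *
    (eps i * (imP z i) * ∫ w in tube n, (lorC (zeta z w) ^ (s + 1))⁻¹ * (zeta z w i * f w)) *
      eps_mul_eps i

lemma exists_BoxOp_bound (n : ℕ) [NeZero n] (s N : ℕ) : ∃ C : ℝ, 0 ≤ C ∧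
    ∀ f : (Fin n → ℂ) → ℂ, Measurable f → ∀ z ∈ tube n, TConv s f z →
      ‖BoxOp (fun x => lorC (zeta x z) ^ (N + 2) * TOp s f x) z‖ ≤
        C * (lor (imP z) ^ (N + 1) * ∫ w in tube n, ‖(lorC (zeta z w) ^ s)⁻¹ * f w‖) := by
  refine ⟨‖(4 * (N + 2) * (N + 1 + n / 2) : ℂ)‖ * 4 ^ (N + 1) +
    4 ^ (N + 2) * ‖(4 * s * (s + 1 - n / 2) : ℂ)‖ +
    2 * (‖(-(8 * I) * ((N + 1 : ℕ) + 1) * s : ℂ)‖ * 4 ^ (N + 1) * 4), by positivity, ?_⟩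
  intro f hf z hz h
  set A := ∫ w in tube n, ‖(lorC (zeta z w) ^ s)⁻¹ * f w‖ with hA
  set d := lor (imP z) with hd
  have hd0 : 0 < d := hz.1
  have hA0 : 0 ≤ A := integral_nonneg fun _ => norm_nonneg _
  have h0 : ‖TOp s f z‖ ≤ A := norm_integral_le_integral_norm _
  have h1 : d * ‖TOp (s + 1) f z‖ ≤ A := by
    have : ‖TOp (s + 1) f z‖ ≤ ∫ w in tube n, d⁻¹ * ‖(lorC (zeta z w) ^ s)⁻¹ * f w‖ := by
      refine norm_integral_le_of_norm_le (h.norm.const_mul _)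
        ((ae_restrict_iff' measurableSet_tube).2 (ae_of_all _ fun w hw => ?_))
      have h2 : d ≤ ‖lorC (zeta z w)‖ := by
        have := lor_le_norm_zeta hz hw
        have := hw.1
        linarith
      rw [pow_succ, mul_inv, mul_right_comm, norm_mul, mul_comm, norm_inv]
      gcongr
    rw [integral_const_mul] at this
    calc d * ‖TOp (s + 1) f z‖ ≤ d * (d⁻¹ * A) := by gcongr
      _ = A := by field_simp
  have h2 : ‖∫ w in tube n, (lorC (zeta z w) ^ (s + 1))⁻¹ *
      (bil (zeta z w) (toC (imP z)) * f w)‖ ≤ 4 * A := by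
    rw [hA, ← integral_const_mul]
    refine norm_integral_le_of_norm_le (h.norm.const_mul _)
        ((ae_restrict_iff' measurableSet_tube).2 (ae_of_all _ fun w hw => ?_))
    have h3 := norm_bil_zeta_le hz hw
    have h4 : 0 < ‖lorC (zeta z w)‖ := norm_pos_iff.2 (lorC_zeta_ne hz hw)
    rw [pow_succ, mul_inv]
    calc ‖(lorC (zeta z w) ^ s)⁻¹ * (lorC (zeta z w))⁻¹ * (bil (zeta z w) (toC (imP z)) * f w)‖
        = ‖(lorC (zeta z w) ^ s)⁻¹ * f w‖ *
          (‖lorC (zeta z w)‖⁻¹ * ‖bil (zeta z w) (toC (imP z))‖) := by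
          simp only [norm_mul, norm_inv]; ring
      _ ≤ ‖(lorC (zeta z w) ^ s)⁻¹ * f w‖ * (‖lorC (zeta z w)‖⁻¹ * (4 * ‖lorC (zeta z w)‖)) := by
          gcongr
      _ = _ := by field_simp
  have hH : ContDiffOn ℂ (⊤ : ℕ∞) (TOp s f) (tube n) :=
    contDiffOn_infty.2 fun m => contDiffOn_TOp m hf hz h
  rw [BoxOp_mul (contDiff_lorC_zeta_pow z (N + 2)).contDiffOn hH hz, BoxOp_lorC_pow,
    BoxOp_TOp hf hz h, cross_term hf hz h]
  refine (norm_sub_le _ _).trans ((add_le_add_left (norm_add_le _ _) _).trans ?_)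
  simp only [norm_mul, norm_neg, norm_pow, norm_lorC_zeta_self hz, ← hd]
  rw [add_mul, add_mul]
  refine add_le_add (add_le_add ?_ ?_) ?_
  · calc _ ≤ ‖(4 : ℂ)‖ * ‖(N + 2 : ℂ)‖ * ‖(N + 1 + n / 2 : ℂ)‖ * (4 * d) ^ (N + 1) * A := by
          gcongr
      _ = _ := by rw [mul_pow]; ring
  · calc (4 * d) ^ (N + 2) * (‖(4 : ℂ)‖ * ‖(s : ℂ)‖ * ‖(s + 1 - n / 2 : ℂ)‖ * ‖TOp (s + 1) f z‖)
        = 4 ^ (N + 2) * (‖(4 : ℂ)‖ * ‖(s : ℂ)‖ * ‖(s + 1 - n / 2 : ℂ)‖) *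
          (d ^ (N + 1) * (d * ‖TOp (s + 1) f z‖)) := by rw [mul_pow, pow_succ d]; ring
      _ ≤ 4 ^ (N + 2) * (‖(4 : ℂ)‖ * ‖(s : ℂ)‖ * ‖(s + 1 - n / 2 : ℂ)‖) *
          (d ^ (N + 1) * A) := by gcongr
  · refine (mul_le_mul_of_nonneg_left (mul_le_mul_of_nonneg_left h2 (by positivity))
      (norm_nonneg _)).trans (le_of_eq ?_)
    rw [mul_pow, RCLike.norm_ofNat (K := ℂ) 2]; ring

variable {p κ : ℝ}

lemma wInt_ext0 {γ p : ℝ} (F : (Fin n → ℂ) → ℂ) :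
    (wInt γ fun w => ‖ext0 F w‖ₑ ^ p) = wInt γ fun w => ‖F w‖ₑ ^ p :=
  wInt_congr fun w hw => by simp only [ext0_eqOn F hw]

/-- The estimates for holomorphic functions in Bergman spaces. -/
lemma exists_repr_memA (hp : 1 ≤ p) (hκ : (n : ℝ) / 2 - 1 < κ) : ∃ k : ℕ, ∃ c : ℂ,
    (∃ C, C ≠ ⊤ ∧ ∀ F, memA n p κ F → (wInt (κ - n / 2 + p * (n + 2)) fun z =>
      SOp ((n + k : ℕ) + (n + 2 : ℕ)) k (fun w => ‖ext0 F w‖ₑ) z ^ p) ≤ C * lpInt n p κ F) ∧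
    ∀ b ∈ tube n, (∃ C, C ≠ ⊤ ∧ ∀ F, memA n p κ F →
      SOp ((n + k : ℕ) + (n + 2 : ℕ)) k (fun w => ‖ext0 F w‖ₑ) b ^ p ≤ C * lpInt n p κ F) ∧
    ∀ F, memA n p κ F →
      TConv (n + k) (wtd k (damp (n + 2) F b)) b ∧
      EqOn F (fun z => (c * lorC (zeta z b) ^ (n + 2)) *
        TOp (n + k) (wtd k (damp (n + 2) F b)) z) (tube n) := by
  obtain ⟨k, hk⟩ := exists_nat_gt (n + κ)
  obtain ⟨c, hc, h⟩ := exists_repr n k (n + 2)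
  have hn : (0 : ℝ) < n := by exact_mod_cast Nat.pos_of_ne_zero (NeZero.ne n)
  have e : ((n + k : ℕ) + (n + 2 : ℕ) : ℝ) - n - k = n + 2 := by push_cast; ring
  have c1 : (0 : ℝ) ≤ k := by positivity
  have c2 : 2 * (n : ℝ) < ((n + k : ℕ) + (n + 2 : ℕ) : ℝ) - k + 0 := by push_cast; linarith
  have c3 : 0 ≤ (κ - n / 2) + (((n + k : ℕ) + (n + 2 : ℕ) : ℝ) - n - k) - 0 * (p - 1) := by
    rw [e]; linarith
  have c4 : (n : ℝ) + (κ - n / 2) < k + 0 * (p - 1) := by linarith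
  have hp0 : 0 ≤ p := by linarith
  refine ⟨k, c, ?_, fun b hb => ?_⟩
  · obtain ⟨C, hC, hS⟩ := schur hp c1 c2 c3 c4
    refine ⟨C, hC, fun F hF => ?_⟩
    have := hS (fun w => ‖ext0 F w‖ₑ) (measurable_ext0 hF.1).enorm
    rw [e, wInt_ext0, ← lpInt_eq hp0] at this
    exact this
  · obtain ⟨C, hC, hS⟩ := SOp_pointwise hp c1 c2 c3 c4 hb
    have hbd : ∀ F, memA n p κ F →
        SOp ((n + k : ℕ) + (n + 2 : ℕ)) k (fun w => ‖ext0 F w‖ₑ) b ^ p ≤ C * lpInt n p κ F := by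
      intro F hF
      have := hS (fun w => ‖ext0 F w‖ₑ) (measurable_ext0 hF.1).enorm
      rw [wInt_ext0, ← lpInt_eq hp0] at this
      exact this
    refine ⟨⟨C, hC, hbd⟩, fun F hF => h F hF.1 b hb fun htop => ?_⟩
    have := hbd F hF
    rw [htop, ENNReal.top_rpow_of_pos (by linarith), top_le_iff] at this
    exact ENNReal.mul_ne_top hC hF.2.ne this

lemma memA.contDiffOn (hp : 1 ≤ p) (hκ : (n : ℝ) / 2 - 1 < κ) {F : (Fin n → ℂ) → ℂ}
    (hF : memA n p κ F) : ContDiffOn ℂ (⊤ : ℕ∞) F (tube n) := by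
  obtain ⟨k, c, -, h⟩ := exists_repr_memA hp hκ
  obtain ⟨-, h2⟩ := h (bpt n) bpt_mem
  obtain ⟨h3, h4⟩ := h2 F hF
  refine ContDiffOn.congr ?_ h4
  exact (contDiffOn_const.mul (contDiff_lorC_zeta_pow _ _).contDiffOn).mul
    (contDiffOn_infty.2 fun m => contDiffOn_TOp m (measurable_wtd k (measurable_damp hF.1 _))
      bpt_mem h3)

lemma exists_pointwise (hp : 1 ≤ p) (hκ : (n : ℝ) / 2 - 1 < κ) {z : Fin n → ℂ}
    (hz : z ∈ tube n) : ∃ C, C ≠ ⊤ ∧ ∀ F, memA n p κ F → ‖F z‖ₑ ^ p ≤ C * lpInt n p κ F := by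
  obtain ⟨k, c, -, h⟩ := exists_repr_memA hp hκ
  obtain ⟨⟨C, hC, h1⟩, h2⟩ := h z hz
  have hp0 : 0 ≤ p := by linarith
  refine ⟨‖c * lorC (zeta z z) ^ (n + 2)‖ₑ ^ p * C,
    ENNReal.mul_ne_top (ENNReal.rpow_ne_top_of_nonneg hp0 enorm_ne_top) hC, fun F hF => ?_⟩
  rw [(h2 F hF).2 hz, enorm_mul, ENNReal.mul_rpow_of_nonneg _ _ hp0, mul_assoc]
  gcongr
  refine le_trans ?_ (h1 F hF)
  gcongr
  refine (enorm_TOp_le hz).trans ?_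
  rw [SOp_damp hz]

lemma exists_BoxOp_bounded (hp : 1 ≤ p) (hκ : (n : ℝ) / 2 - 1 < κ) : ∃ C, C ≠ ⊤ ∧
    ∀ F, memA n p κ F → lpInt n p (κ + p) (BoxOp F) ≤ C * lpInt n p κ F := by
  obtain ⟨k, c, ⟨C, hC, hS⟩, h⟩ := exists_repr_memA hp hκ
  obtain ⟨C', hC', hB⟩ := exists_BoxOp_bound n (n + k) n
  have hp0 : 0 ≤ p := by linarith
  have hK : (‖c‖ₑ * ENNReal.ofReal C') ^ p ≠ ⊤ :=
    ENNReal.rpow_ne_top_of_nonneg hp0 (ENNReal.mul_ne_top enorm_ne_top ENNReal.ofReal_ne_top)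
  refine ⟨(‖c‖ₑ * ENNReal.ofReal C') ^ p * C, ENNReal.mul_ne_top hK hC, fun F hF => ?_⟩
  have key : ∀ z ∈ tube n, ‖BoxOp F z‖ₑ ^ p ≤ (‖c‖ₑ * ENNReal.ofReal C') ^ p *
      (dl z ^ (p * (n + 1)) *
        SOp ((n + k : ℕ) + (n + 2 : ℕ)) k (fun w => ‖ext0 F w‖ₑ) z ^ p) := by
    intro z hz
    obtain ⟨-, h2⟩ := h z hz
    obtain ⟨hT, hE⟩ := h2 F hF
    have hm := measurable_wtd k (measurable_damp (N := n + 2) hF.1 z)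
    have hcd : ContDiffOn ℂ (⊤ : ℕ∞) (fun x => lorC (zeta x z) ^ (n + 2) *
        TOp (n + k) (wtd k (damp (n + 2) F z)) x) (tube n) :=
      (contDiff_lorC_zeta_pow _ _).contDiffOn.mul
        (contDiffOn_infty.2 fun m => contDiffOn_TOp m hm hz hT)
    have e1 : BoxOp F z = c * BoxOp (fun x => lorC (zeta x z) ^ (n + 2) *
        TOp (n + k) (wtd k (damp (n + 2) F z)) x) z := by
      rw [BoxOp_congr hE hz]
      simp only [mul_assoc]
      rw [BoxOp_mul (P := fun _ => c) contDiffOn_const hcd hz]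
      have hpd : ∀ i : Fin n, pd i (fun _ : Fin n → ℂ => c) = fun _ => 0 := by
        intro i; funext x; simp [pd]
      have hpd0 : ∀ i : Fin n, pd i (fun _ : Fin n → ℂ => (0 : ℂ)) = fun _ => 0 := by
        intro i; funext x; simp [pd]
      simp [BoxOp_eq (fun _ : Fin n → ℂ => c), hpd, hpd0]
    have e2 : ‖BoxOp F z‖ₑ ≤ ‖c‖ₑ * ENNReal.ofReal C' * (dl z ^ ((n : ℝ) + 1) *
        SOp ((n + k : ℕ) + (n + 2 : ℕ)) k (fun w => ‖ext0 F w‖ₑ) z) := by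
      rw [e1, enorm_mul, mul_assoc]
      gcongr
      rw [← ofReal_norm]
      refine (ENNReal.ofReal_le_ofReal (hB _ hm z hz hT)).trans (le_of_eq ?_)
      rw [ENNReal.ofReal_mul hC', ENNReal.ofReal_mul (pow_nonneg hz.1.le _),
        ofReal_integral_norm_eq_lintegral_enorm hT, lintegral_enorm_TOp hz, SOp_damp hz,
        ENNReal.ofReal_pow hz.1.le, dl, ← ENNReal.rpow_natCast]
      push_cast; rfl
    refine (ENNReal.rpow_le_rpow e2 hp0).trans (le_of_eq ?_)
    rw [ENNReal.mul_rpow_of_nonneg _ _ hp0, ENNReal.mul_rpow_of_nonneg _ _ hp0,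
      ENNReal.mul_rpow_of_nonneg _ _ hp0, ← ENNReal.rpow_mul, mul_comm p]
  rw [lpInt_eq hp0]
  refine (wInt_mono key).trans ?_
  rw [wInt_const_mul hK, wInt_dl_mul, mul_assoc]
  gcongr
  refine le_trans (le_of_eq ?_) (hS F hF)
  congr 1; ring

lemma memA.boxOp (hp : 1 ≤ p) (hκ : (n : ℝ) / 2 - 1 < κ) {F : (Fin n → ℂ) → ℂ}
    (hF : memA n p κ F) : memA n p (κ + p) (BoxOp F) := by
  obtain ⟨C, hC, h⟩ := exists_BoxOp_bounded (n := n) hp hκ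
  exact ⟨fun z hz => ((hF.contDiffOn hp hκ).boxOp.differentiableAt_tube hz).differentiableWithinAt,
    (h F hF).trans_lt (ENNReal.mul_lt_top hC.lt_top hF.2)⟩

end bounded

/-! ### Regularization by translations -/

section regularization

lemma lintegral_affine_rpow {b : ℝ} (hb : -1 < b) : ∃ C : ℝ≥0∞, C ≠ ⊤ ∧ ∀ α β : ℝ, 0 < α → 0 < β →
    ∫⁻ s in Icc (1 : ℝ) 2, (if 0 < α - s * β then ENNReal.ofReal (α - s * β) ^ b else 0) ≤
      C * ENNReal.ofReal α ^ b := by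
  have hvol : (volume (Icc (1 : ℝ) 2)) = 1 := by rw [Real.volume_Icc]; norm_num
  have hconst : ∀ (α β : ℝ) (K : ℝ≥0∞), (∀ s ∈ Icc (1 : ℝ) 2, 0 < α - s * β →
      ENNReal.ofReal (α - s * β) ^ b ≤ K) →
      ∫⁻ s in Icc (1 : ℝ) 2, (if 0 < α - s * β then ENNReal.ofReal (α - s * β) ^ b else 0) ≤ K := by
    intro α β K h
    calc _ ≤ ∫⁻ s in Icc (1 : ℝ) 2, K := by
          refine setLIntegral_mono' measurableSet_Icc fun s hs => ?_
          split_ifs with h1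
          · exact h s hs h1
          · exact zero_le
      _ = K := by rw [setLIntegral_const, hvol, mul_one]
  rcases le_or_gt 0 b with h0 | h0
  · refine ⟨1, ENNReal.one_ne_top, fun α β hα hβ => ?_⟩
    rw [one_mul]
    refine hconst α β _ fun s hs h => ?_
    have : 0 ≤ s * β := mul_nonneg (by linarith [hs.1]) hβ.le
    exact ENNReal.rpow_le_rpow (ENNReal.ofReal_le_ofReal (by linarith)) h0
  · have h1 : 0 < b + 1 := by linarith
    refine ⟨ENNReal.ofReal ((1 / 2) ^ b) + ENNReal.ofReal (4 / (b + 1)), by simp,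
      fun α β hα hβ => ?_⟩
    rw [add_mul, ENNReal.ofReal_rpow_of_pos hα, ← ENNReal.ofReal_mul (by positivity),
      ← ENNReal.ofReal_mul (by positivity)]
    rcases le_or_gt β (α / 4) with h2 | h2
    · refine le_add_right (hconst α β _ fun s hs h => ?_)
      rw [ENNReal.ofReal_rpow_of_pos h, ← Real.mul_rpow (by norm_num) hα.le]
      refine ENNReal.ofReal_le_ofReal (Real.rpow_le_rpow_of_nonpos (by positivity) ?_ h0.le)
      have : s * β ≤ 2 * (α / 4) := mul_le_mul hs.2 h2 hβ.le (by norm_num)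
      linarith
    · refine le_add_left ?_
      have hq : 0 < α / β := by positivity
      have hint : IntervalIntegrable (fun s => (α - β * s) ^ b) volume 0 (α / β) := by
        have := ((IntervalIntegrable.comp_sub_left
          (intervalIntegral.intervalIntegrable_rpow' (a := 0) (b := α) hb) α).comp_mul_left
          (c := β)).symm
        simpa using this
      calc _ ≤ ∫⁻ s in Ioc (0 : ℝ) (α / β), ENNReal.ofReal ((α - β * s) ^ b) := by
            rw [← lintegral_indicator measurableSet_Icc, ← lintegral_indicator measurableSet_Ioc]
            refine lintegral_mono fun s => ?_
            simp only [indicator]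
            by_cases hs : s ∈ Icc (1 : ℝ) 2
            · simp only [hs, if_true]
              split_ifs with h3 h4
              · rw [ENNReal.ofReal_rpow_of_pos h3, mul_comm]
              · refine absurd ⟨by linarith [hs.1], ?_⟩ h4
                rw [le_div_iff₀ hβ]; linarith
              · exact zero_le
              · exact zero_le
            · simp [hs]
        _ = ENNReal.ofReal (∫ s in Ioc (0 : ℝ) (α / β), (α - β * s) ^ b) := by
            refine (ofReal_integral_eq_lintegral_ofReal hint.1
              ((ae_restrict_iff' measurableSet_Ioc).2 (ae_of_all _ fun s hs => ?_))).symm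
            have : s * β ≤ α := (le_div_iff₀ hβ).1 hs.2
            exact Real.rpow_nonneg (by linarith) _
        _ = ENNReal.ofReal (β⁻¹ * (α ^ (b + 1) / (b + 1))) := by
            rw [← intervalIntegral.integral_of_le hq.le,
              intervalIntegral.integral_comp_sub_mul (fun x => x ^ b) hβ.ne' α]
            rw [mul_div_cancel₀ _ hβ.ne', sub_self, mul_zero, sub_zero, integral_rpow (Or.inl hb),
              Real.zero_rpow h1.ne', sub_zero, smul_eq_mul]
        _ ≤ _ := by
            refine ENNReal.ofReal_le_ofReal ?_
            rw [Real.rpow_add_one hα.ne']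
            have : β⁻¹ * α ≤ 4 := by
              rw [inv_mul_le_iff₀ hβ]; linarith
            calc β⁻¹ * (α ^ b * α / (b + 1)) = (β⁻¹ * α) * (α ^ b / (b + 1)) := by ring
              _ ≤ 4 * (α ^ b / (b + 1)) := by gcongr
              _ = _ := by ring

variable {n : ℕ} [NeZero n]

/-- The null vectors `e₀ ± eⱼ`. -/
def nullv (j : Fin n) (ε : ℝ) : Fin n → ℝ := Pi.single 0 1 + ε • Pi.single j 1

lemma bil_nullv {j : Fin n} (hj : j ≠ 0) (ε δ : ℝ) :
    bil (nullv j ε) (nullv j δ) = 1 - ε * δ := by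
  simp only [nullv, bil_add_left, bil_add_right, bil_smul_left, bil_smul_right, bil_single_zero,
    bil_single_ne hj]
  simp [hj, hj.symm]
  ring

lemma nullv_zero {j : Fin n} (hj : j ≠ 0) (ε : ℝ) : nullv j ε 0 = 1 := by
  simp [nullv, hj.symm]

/-- The function `Δ ^ b` on the cone, extended by zero. -/
def gker (b : ℝ) (y : Fin n → ℝ) : ℝ≥0∞ :=
  (cone n).indicator (fun y => ENNReal.ofReal (lor y) ^ b) y

lemma gker_of_mem {b : ℝ} {y : Fin n → ℝ} (hy : y ∈ cone n) :
    gker b y = ENNReal.ofReal (lor y) ^ b := indicator_of_mem hy _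

lemma gker_of_notMem {b : ℝ} {y : Fin n → ℝ} (hy : y ∉ cone n) : gker b y = 0 :=
  indicator_of_notMem hy _

@[fun_prop]
lemma measurable_gker (b : ℝ) : Measurable (gker (n := n) b) :=
  (continuous_lor.measurable.ennreal_ofReal.pow_const b).indicator isOpen_cone.measurableSet

lemma lintegral_gker_null {b : ℝ} (hb : -1 < b) : ∃ C : ℝ≥0∞, C ≠ ⊤ ∧
    ∀ (y v : Fin n → ℝ) (t : ℝ), 0 < t → lor v = 0 → 0 < v 0 →
      ∫⁻ s in Icc (1 : ℝ) 2, gker b (y - (t * s) • v) ≤ C * gker b y := by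
  obtain ⟨C, hC, h⟩ := lintegral_affine_rpow hb
  refine ⟨C, hC, fun y v t ht hv hv0 => ?_⟩
  have hcl : ∀ s ∈ Icc (1 : ℝ) 2, y - (t * s) • v ∈ cone n → y ∈ cone n := by
    intro s hs h1
    have hts : 0 < t * s := mul_pos ht (by linarith [hs.1])
    have := (cone_add_closed h1 (y := (t * s) • v)
      (by rw [lor_eq, bil_smul_left, bil_smul_right, ← lor_eq, hv]; simp)
      (by simp only [Pi.smul_apply, smul_eq_mul]; positivity)).2
    simpa using this
  by_cases hy : y ∈ cone n
  · have hpos : 0 < bil y v := bil_pos hy hv.ge hv0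
    rw [gker_of_mem hy]
    refine le_trans (setLIntegral_mono' measurableSet_Icc fun s hs => ?_)
      (h (lor y) (2 * t * bil y v) hy.1 (by positivity))
    have e : lor (y - (t * s) • v) = lor y - s * (2 * t * bil y v) := by
      rw [lor_eq] at hv
      simp only [lor_eq, bil_sub_left, bil_sub_right, bil_smul_left, bil_smul_right, hv,
        bil_comm v y]
      ring
    by_cases h1 : y - (t * s) • v ∈ cone n
    · rw [gker_of_mem h1, e, if_pos (by rw [← e]; exact h1.1)]
    · rw [gker_of_notMem h1]; exact zero_le
  · rw [setLIntegral_congr_fun (g := fun _ => 0) measurableSet_Icc fun s hs =>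
      gker_of_notMem fun h1 => hy (hcl s hs h1)]
    simp

/-- The square of parameters used for averaging. -/
def sqr : Set (ℝ × ℝ) := Icc 1 2 ×ˢ Icc 1 2

lemma measurableSet_sqr : MeasurableSet sqr := measurableSet_Icc.prod measurableSet_Icc

lemma volume_sqr : volume sqr = 1 := by
  rw [sqr, Measure.volume_eq_prod, Measure.prod_prod, Real.volume_Icc]; norm_num

/-- The translation vectors. -/
def shv (j : Fin n) (t : ℝ) (τ : ℝ × ℝ) : Fin n → ℝ :=
  (t * τ.1) • nullv j 1 + (t * τ.2) • nullv j (-1)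

lemma continuous_shv (j : Fin n) (t : ℝ) : Continuous (shv j t) := by
  unfold shv; fun_prop

lemma shv_mem {j : Fin n} (hj : j ≠ 0) {t : ℝ} (ht : 0 < t) {τ : ℝ × ℝ} (hτ : τ ∈ sqr) :
    t ^ 2 ≤ lor (shv j t τ) ∧ shv j t τ ∈ cone n := by
  obtain ⟨⟨h1, -⟩, ⟨h2, -⟩⟩ := hτ
  have e : lor (shv j t τ) = 4 * t ^ 2 * (τ.1 * τ.2) := by
    simp only [lor_eq, shv, bil_add_left, bil_add_right, bil_smul_left, bil_smul_right,
      bil_nullv hj]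
    ring
  have h3 : 1 ≤ τ.1 * τ.2 := by nlinarith
  refine ⟨by rw [e]; nlinarith [sq_nonneg t], by rw [e]; positivity, ?_⟩
  simp only [shv, Pi.add_apply, Pi.smul_apply, nullv_zero hj, smul_eq_mul]
  nlinarith

lemma of_sub_shv_mem {j : Fin n} (hj : j ≠ 0) {t : ℝ} (ht : 0 < t) {τ : ℝ × ℝ} (hτ : τ ∈ sqr)
    {y : Fin n → ℝ} (h : y - shv j t τ ∈ cone n) :
    y ∈ cone n ∧ t ^ 2 ≤ lor y ∧ lor (y - shv j t τ) ≤ lor y := by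
  obtain ⟨h1, h2⟩ := shv_mem hj ht hτ
  have h3 := cone_add h h2
  rw [sub_add_cancel] at h3
  exact ⟨h3.2, by linarith [h3.1, h.1], by linarith [h3.1, h2.1]⟩

/-- The averaged weights. -/
def regW (j : Fin n) (b t : ℝ) (z : Fin n → ℂ) : ℝ≥0∞ :=
  ∫⁻ τ in sqr, gker b (imP z - shv j t τ)

lemma measurable_gker_shv (j : Fin n) (b t : ℝ) :
    Measurable fun q : (Fin n → ℂ) × (ℝ × ℝ) => gker b (imP q.1 - shv j t q.2) :=
  (measurable_gker b).comp (((continuous_imP.comp continuous_fst).sub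
    ((continuous_shv j t).comp continuous_snd)).measurable)

lemma measurable_gker_shv_right (j : Fin n) (b t : ℝ) (y : Fin n → ℝ) :
    Measurable fun τ : ℝ × ℝ => gker b (y - shv j t τ) :=
  (measurable_gker b).comp (continuous_const.sub (continuous_shv j t)).measurable

@[fun_prop]
lemma measurable_regW (j : Fin n) (b t : ℝ) : Measurable (regW j b t) :=
  (measurable_gker_shv j b t).lintegral_prod_right'

lemma regW_le {j : Fin n} (hj : j ≠ 0) {b t q : ℝ} (hb : -1 < b) (ht : 0 < t) (hq : 0 ≤ q) :
    ∃ C : ℝ≥0∞, C ≠ ⊤ ∧ ∀ z ∈ tube n, regW j b t z ≤ C * dl z ^ (b + q) := by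
  obtain ⟨C, hC, h⟩ := lintegral_gker_null (n := n) hb
  have ht2 : ENNReal.ofReal (t ^ 2) ≠ 0 := by simp; positivity
  refine ⟨C * C * ENNReal.ofReal (t ^ 2) ^ (-q), ENNReal.mul_ne_top (ENNReal.mul_ne_top hC hC)
    (ENNReal.rpow_ne_top_of_ne_zero ht2 ENNReal.ofReal_ne_top), fun z hz => ?_⟩
  rcases lt_or_ge (lor (imP z)) (t ^ 2) with h1 | h1
  · rw [regW, setLIntegral_congr_fun (g := fun _ => 0) measurableSet_sqr fun τ hτ =>
      gker_of_notMem fun h2 => not_le.2 h1 (of_sub_shv_mem hj ht hτ h2).2.1]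
    simp
  · have h2 : regW j b t z ≤ C * (C * dl z ^ b) := by
      rw [regW, sqr, Measure.volume_eq_prod, setLIntegral_prod
        (fun τ => gker b (imP z - shv j t τ))
        (measurable_gker_shv_right j b t _).aemeasurable]
      calc _ ≤ ∫⁻ x in Icc (1 : ℝ) 2, C * gker b (imP z - (t * x) • nullv j 1) := by
            refine setLIntegral_mono' measurableSet_Icc fun x hx => ?_
            refine le_trans (le_of_eq ?_) (h (imP z - (t * x) • nullv j 1) (nullv j (-1)) t ht
              (by rw [lor_eq, bil_nullv hj]; norm_num) (by rw [nullv_zero hj]; norm_num))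
            simp only [shv, sub_sub]
        _ = C * ∫⁻ x in Icc (1 : ℝ) 2, gker b (imP z - (t * x) • nullv j 1) :=
            lintegral_const_mul' _ _ hC
        _ ≤ C * (C * gker b (imP z)) := by
            gcongr
            exact h _ _ t ht (by rw [lor_eq, bil_nullv hj]; norm_num)
              (by rw [nullv_zero hj]; norm_num)
        _ = _ := by rw [gker_of_mem hz, dl]
    refine h2.trans ?_
    have h3 : dl z ^ b = dl z ^ (-q) * dl z ^ (b + q) := by
      rw [← dl_rpow_add hz]; congr 1; ring
    rw [h3, ← mul_assoc, ← mul_assoc]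
    gcongr ?_ * _
    refine mul_le_mul_right ?_ _
    rw [ENNReal.rpow_neg, ENNReal.rpow_neg]
    exact ENNReal.inv_le_inv.2 (ENNReal.rpow_le_rpow (ENNReal.ofReal_le_ofReal h1) hq)

lemma regW_add_le {j : Fin n} (hj : j ≠ 0) {b t p : ℝ} (ht : 0 < t) (hp : 0 ≤ p)
    {z : Fin n → ℂ} (hz : z ∈ tube n) : regW j (b + p) t z ≤ dl z ^ p * regW j b t z := by
  rw [regW, regW, ← lintegral_const_mul' _ _ (dl_rpow_ne_top hz p)]
  refine setLIntegral_mono' measurableSet_sqr fun τ hτ => ?_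
  by_cases h : imP z - shv j t τ ∈ cone n
  · rw [gker_of_mem h, gker_of_mem h, ENNReal.rpow_add _ _ (by simpa using h.1)
      ENNReal.ofReal_ne_top, mul_comm]
    gcongr
    exact ENNReal.ofReal_le_ofReal (of_sub_shv_mem hj ht hτ h).2.2
  · rw [gker_of_notMem h]; exact zero_le

lemma regW_le_of_nonneg {j : Fin n} (hj : j ≠ 0) {c t : ℝ} (ht : 0 < t) (hc : 0 ≤ c)
    (z : Fin n → ℂ) : regW j c t z ≤ dl z ^ c := by
  calc regW j c t z ≤ ∫⁻ _ in sqr, dl z ^ c := by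
        refine setLIntegral_mono' measurableSet_sqr fun τ hτ => ?_
        by_cases h : imP z - shv j t τ ∈ cone n
        · rw [gker_of_mem h]
          exact ENNReal.rpow_le_rpow
            (ENNReal.ofReal_le_ofReal (of_sub_shv_mem hj ht hτ h).2.2) hc
        · rw [gker_of_notMem h]; exact zero_le
    _ = _ := by rw [setLIntegral_const, volume_sqr, mul_one]

lemma lintegral_regW {j : Fin n} (hj : j ≠ 0) (b : ℝ) {t : ℝ} (ht : 0 < t)
    {f : (Fin n → ℂ) → ℝ≥0∞} (hf : Measurable f) :
    ∫⁻ z in tube n, regW j b t z * f z =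
      ∫⁻ τ in sqr, wInt b fun z => f (z + I • toC (shv j t τ)) := by
  have hm : Measurable fun q : (Fin n → ℂ) × (ℝ × ℝ) => gker b (imP q.1 - shv j t q.2) * f q.1 :=
    (measurable_gker_shv j b t).mul (hf.comp measurable_fst)
  calc _ = ∫⁻ z in tube n, ∫⁻ τ in sqr, gker b (imP z - shv j t τ) * f z := by
        refine lintegral_congr fun z => ?_
        rw [lintegral_mul_const _ (measurable_gker_shv_right j b t _), regW]
    _ = ∫⁻ τ in sqr, ∫⁻ z in tube n, gker b (imP z - shv j t τ) * f z :=
        lintegral_lintegral_swap hm.aemeasurable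
    _ = _ := by
        refine setLIntegral_congr_fun measurableSet_sqr fun τ hτ => ?_
        have e1 : (∫⁻ z in tube n, gker b (imP z - shv j t τ) * f z) =
            ∫⁻ z, gker b (imP z - shv j t τ) * f z := by
          rw [← lintegral_indicator measurableSet_tube]
          refine lintegral_congr fun z => ?_
          by_cases hz : z ∈ tube n
          · rw [indicator_of_mem hz]
          · rw [indicator_of_notMem hz, gker_of_notMem, zero_mul]
            exact fun h => hz (of_sub_shv_mem hj ht hτ h).1
        simp only [e1]
        rw [← lintegral_add_right_eq_self _ (I • toC (shv j t τ)), wInt,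
          ← lintegral_indicator measurableSet_tube]
        refine lintegral_congr fun z => ?_
        rw [imP_add, imP_I_smul_toC, add_sub_cancel_right]
        by_cases hz : z ∈ tube n
        · rw [indicator_of_mem hz, gker_of_mem hz, dl]
        · rw [indicator_of_notMem hz, gker_of_notMem hz, zero_mul]

lemma le_liminf_regW (j : Fin n) (b : ℝ) {z : Fin n → ℂ} (hz : z ∈ tube n) :
    dl z ^ b ≤ Filter.liminf (fun k : ℕ => regW j b (1 / ((k : ℝ) + 1)) z) Filter.atTop := by
  refine le_trans (le_of_eq ?_) (lintegral_liminf_le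
    (f := fun (k : ℕ) τ => gker b (imP z - shv j (1 / ((k : ℝ) + 1)) τ))
    fun k => measurable_gker_shv_right j b _ _)
  have h : ∀ τ : ℝ × ℝ, Filter.liminf (fun k : ℕ =>
      gker b (imP z - shv j (1 / ((k : ℝ) + 1)) τ)) Filter.atTop = dl z ^ b := by
    intro τ
    refine Filter.Tendsto.liminf_eq ?_
    have hc : Filter.Tendsto (fun t : ℝ => imP z - shv j t τ) (nhds 0) (nhds (imP z)) := by
      have : Continuous fun t : ℝ => imP z - shv j t τ := by unfold shv; fun_prop
      convert this.tendsto 0 using 2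
      simp [shv]
    have h1 : Filter.Tendsto (gker b) (nhds (imP z)) (nhds (dl z ^ b)) := by
      have : Filter.Tendsto (fun y : Fin n → ℝ => ENNReal.ofReal (lor y) ^ b) (nhds (imP z))
          (nhds (dl z ^ b)) :=
        (ENNReal.continuous_rpow_const.comp
          (ENNReal.continuous_ofReal.comp continuous_lor)).tendsto (imP z)
      refine this.congr' ?_
      filter_upwards [isOpen_cone.mem_nhds hz] with y hy
      rw [gker_of_mem hy]
    exact h1.comp (hc.comp tendsto_one_div_add_atTop_nhds_zero_nat)
  simp only [h]
  rw [setLIntegral_const, volume_sqr, mul_one]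

lemma pd_comp_add (i : Fin n) (F : (Fin n → ℂ) → ℂ) (a : Fin n → ℂ) :
    pd i (fun z => F (z + a)) = fun z => pd i F (z + a) := by
  funext z; simp only [pd]; rw [fderiv_comp_add_right]

lemma BoxOp_comp_add (F : (Fin n → ℂ) → ℂ) (a : Fin n → ℂ) :
    BoxOp (fun z => F (z + a)) = fun z => BoxOp F (z + a) := by
  funext z; simp only [BoxOp, pd_comp_add]

lemma hardy_regW {j : Fin n} (hj : j ≠ 0) {ν p : ℝ} (hν : (n : ℝ) / 2 - 1 < ν) (hp : 1 ≤ p)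
    (hH : hardy n p ν) : ∃ C : ℝ≥0∞, C ≠ ⊤ ∧ ∀ t : ℝ, 0 < t → ∀ q : ℝ, 0 ≤ q → ∀ F,
      memA n p (ν + q) F →
      ∫⁻ z in tube n, regW j (ν - n / 2) t z * ‖F z‖ₑ ^ p ≤
        C * ∫⁻ z in tube n, regW j (ν - n / 2 + p) t z * ‖BoxOp F z‖ₑ ^ p := by
  obtain ⟨C, hC, h⟩ := hH
  have hp0 : 0 ≤ p := by linarith
  refine ⟨ENNReal.ofReal C, ENNReal.ofReal_ne_top, fun t ht q hq F hF => ?_⟩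
  have hB := hF.boxOp hp (by linarith)
  have hmem : ∀ τ ∈ sqr, ∀ z ∈ tube n, z + I • toC (shv j t τ) ∈ tube n := by
    intro τ hτ z hz
    show imP _ ∈ cone n
    rw [imP_add, imP_I_smul_toC]
    exact (cone_add hz (shv_mem hj ht hτ).2).2
  have key : ∀ G : (Fin n → ℂ) → ℂ, DifferentiableOn ℂ G (tube n) → ∀ b,
      ∫⁻ z in tube n, regW j b t z * ‖G z‖ₑ ^ p =
        ∫⁻ τ in sqr, wInt b fun z => ‖G (z + I • toC (shv j t τ))‖ₑ ^ p := by
    intro G hG b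
    have h1 : ∀ G' : (Fin n → ℂ) → ℂ, EqOn G' G (tube n) →
        ∫⁻ z in tube n, regW j b t z * ‖G' z‖ₑ ^ p =
          ∫⁻ z in tube n, regW j b t z * ‖G z‖ₑ ^ p := fun G' h =>
      setLIntegral_congr_fun measurableSet_tube fun z hz => by simp only [h hz]
    rw [← h1 _ (ext0_eqOn G), lintegral_regW hj b ht ((measurable_ext0 hG).enorm.pow_const p)]
    refine setLIntegral_congr_fun measurableSet_sqr fun τ hτ => wInt_congr fun z hz => ?_
    simp only [ext0_eqOn G (hmem τ hτ z hz)]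
  rw [key F hF.1, key _ hB.1]
  have hfin : (∫⁻ τ in sqr, wInt (ν - n / 2) fun z => ‖F (z + I • toC (shv j t τ))‖ₑ ^ p) ≠ ⊤ := by
    rw [← key F hF.1]
    obtain ⟨C', hC', h1⟩ := regW_le hj (b := ν - n / 2) (by linarith) ht hq
    have h2 : ∫⁻ z in tube n, regW j (ν - n / 2) t z * ‖F z‖ₑ ^ p ≤ C' * lpInt n p (ν + q) F := by
      rw [lpInt_eq hp0, wInt, ← lintegral_const_mul' _ _ hC']
      refine setLIntegral_mono' measurableSet_tube fun z hz => ?_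
      rw [← mul_assoc]
      gcongr
      refine (h1 z hz).trans (le_of_eq ?_)
      congr 2; ring
    exact (h2.trans_lt (ENNReal.mul_lt_top hC'.lt_top hF.2)).ne
  have hmeas : Measurable fun τ : ℝ × ℝ =>
      wInt (ν - n / 2) fun z => ‖ext0 F (z + I • toC (shv j t τ))‖ₑ ^ p := by
    refine Measurable.lintegral_prod_right' (f := fun q : (ℝ × ℝ) × (Fin n → ℂ) =>
      dl q.2 ^ (ν - n / 2 : ℝ) * ‖ext0 F (q.2 + I • toC (shv j t q.1))‖ₑ ^ p) ?_
    have hc : Continuous fun q : (ℝ × ℝ) × (Fin n → ℂ) => q.2 + I • toC (shv j t q.1) := by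
      have h1 : Continuous (toC (n := n)) := by unfold toC; fun_prop
      exact continuous_snd.add ((h1.comp ((continuous_shv j t).comp continuous_fst)).const_smul I)
    exact ((measurable_dl measurable_snd).pow_const _).mul
      (((measurable_ext0 hF.1).comp hc.measurable).enorm.pow_const p)
  have heq : ∀ τ ∈ sqr, (wInt (ν - n / 2) fun z => ‖ext0 F (z + I • toC (shv j t τ))‖ₑ ^ p) =
      wInt (ν - n / 2) fun z => ‖F (z + I • toC (shv j t τ))‖ₑ ^ p := fun τ hτ =>
    wInt_congr fun z hz => by simp only [ext0_eqOn F (hmem τ hτ z hz)]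
  have hae : ∀ᵐ τ ∂volume.restrict sqr,
      (wInt (ν - n / 2) fun z => ‖F (z + I • toC (shv j t τ))‖ₑ ^ p) < ⊤ := by
    rw [← setLIntegral_congr_fun measurableSet_sqr heq] at hfin
    filter_upwards [ae_lt_top hmeas hfin, ae_restrict_mem measurableSet_sqr] with τ h1 h2
    rwa [← heq τ h2]
  rw [← lintegral_const_mul' _ _ ENNReal.ofReal_ne_top]
  refine lintegral_mono_ae ?_
  filter_upwards [hae, ae_restrict_mem measurableSet_sqr] with τ h1 h2
  have hA : memA n p ν (fun z => F (z + I • toC (shv j t τ))) := by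
    refine ⟨fun z hz => ?_, by rwa [lpInt_eq hp0]⟩
    have h3 := (hF.1 _ (hmem τ h2 z hz)).differentiableAt (isOpen_tube.mem_nhds (hmem τ h2 z hz))
    exact (h3.comp z (differentiableAt_id.add_const _)).differentiableWithinAt
  have h4 := h _ hA
  rw [lpInt_eq hp0, lpInt_eq hp0, BoxOp_comp_add] at h4
  refine h4.trans (mul_le_mul_right (le_of_eq ?_) _)
  rw [← wInt_dl_mul]
  refine wInt_congr fun z hz => ?_
  simp only [enorm_mul]
  rw [ENNReal.mul_rpow_of_nonneg _ _ hp0, dl, ← ofReal_norm (_ : ℂ), norm_real,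
    Real.norm_of_nonneg hz.1.le]

end regularization

/-! ### Linearity, and injectivity of the Box operator -/

section injective
variable {n : ℕ} [NeZero n]

lemma pd_lin {F G : (Fin n → ℂ) → ℂ} {z : Fin n → ℂ} (hF : DifferentiableAt ℂ F z)
    (hG : DifferentiableAt ℂ G z) (a b : ℂ) (i : Fin n) :
    pd i (fun z => a * F z + b * G z) z = a * pd i F z + b * pd i G z := by
  rw [pd, fderiv_fun_add (hF.const_mul a) (hG.const_mul b), fderiv_const_mul hF,
    fderiv_const_mul hG]
  simp [pd]

lemma BoxOp_lin {F G : (Fin n → ℂ) → ℂ} (hF : ContDiffOn ℂ (⊤ : ℕ∞) F (tube n))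
    (hG : ContDiffOn ℂ (⊤ : ℕ∞) G (tube n)) (a b : ℂ) :
    EqOn (BoxOp fun z => a * F z + b * G z) (fun z => a * BoxOp F z + b * BoxOp G z)
      (tube n) := by
  intro z hz
  have h : ∀ i, pd i (pd i fun z => a * F z + b * G z) z =
      a * pd i (pd i F) z + b * pd i (pd i G) z := fun i => by
    rw [pd_congr (fun x hx => pd_lin (hF.differentiableAt_tube hx)
      (hG.differentiableAt_tube hx) a b i) i hz,
      pd_lin ((hF.pd i).differentiableAt_tube hz) ((hG.pd i).differentiableAt_tube hz)]
  simp only [BoxOp_eq, h, mul_add, Finset.sum_add_distrib, mul_neg, Finset.mul_sum]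
  rw [neg_add]
  congr 2 <;> exact Finset.sum_congr rfl fun i _ => by ring

lemma ContDiffOn.boxOp_iterate {F : (Fin n → ℂ) → ℂ} (hF : ContDiffOn ℂ (⊤ : ℕ∞) F (tube n))
    (m : ℕ) : ContDiffOn ℂ (⊤ : ℕ∞) (BoxOp^[m] F) (tube n) := by
  induction m with
  | zero => exact hF
  | succ m ih => rw [Function.iterate_succ_apply']; exact ih.boxOp

lemma BoxOp_iterate_congr {F G : (Fin n → ℂ) → ℂ} (h : EqOn F G (tube n)) (m : ℕ) :
    EqOn (BoxOp^[m] F) (BoxOp^[m] G) (tube n) := by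
  induction m with
  | zero => exact h
  | succ m ih =>
    rw [Function.iterate_succ_apply', Function.iterate_succ_apply']
    exact BoxOp_congr ih

lemma BoxOp_iterate_lin {F G : (Fin n → ℂ) → ℂ} (hF : ContDiffOn ℂ (⊤ : ℕ∞) F (tube n))
    (hG : ContDiffOn ℂ (⊤ : ℕ∞) G (tube n)) (a b : ℂ) (m : ℕ) :
    EqOn (BoxOp^[m] fun z => a * F z + b * G z)
      (fun z => a * BoxOp^[m] F z + b * BoxOp^[m] G z) (tube n) := by
  induction m with
  | zero => exact fun _ _ => rfl
  | succ m ih =>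
    simp only [Function.iterate_succ_apply']
    exact (BoxOp_congr ih).trans (BoxOp_lin (hF.boxOp_iterate m) (hG.boxOp_iterate m) a b)

lemma wInt_add {γ : ℝ} {f g : (Fin n → ℂ) → ℝ≥0∞} (hf : Measurable f) :
    (wInt γ fun w => f w + g w) = wInt γ f + wInt γ g := by
  rw [wInt, wInt, wInt, ← lintegral_add_left (by fun_prop)]
  simp only [mul_add]

lemma enorm_add_rpow_le {p : ℝ} (hp : 1 ≤ p) (a b : ℂ) :
    ‖a + b‖ₑ ^ p ≤ 2 ^ (p - 1) * (‖a‖ₑ ^ p + ‖b‖ₑ ^ p) :=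
  (ENNReal.rpow_le_rpow (enorm_add_le a b) (by linarith)).trans
    (ENNReal.rpow_add_le_mul_rpow_add_rpow _ _ hp)

lemma memA.lin {p κ : ℝ} (hp : 1 ≤ p) {F G : (Fin n → ℂ) → ℂ} (hF : memA n p κ F)
    (hG : memA n p κ G) (a b : ℂ) : memA n p κ fun z => a * F z + b * G z := by
  have hp0 : 0 ≤ p := by linarith
  refine ⟨(hF.1.const_mul a).add (hG.1.const_mul b), ?_⟩
  have h1 := hF.2
  have h2 := hG.2
  rw [lpInt_eq hp0] at h1 h2 ⊢
  have ht : ∀ c : ℂ, ‖c‖ₑ ^ p ≠ ⊤ := fun c => ENNReal.rpow_ne_top_of_nonneg hp0 enorm_ne_top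
  have h2p : (2 : ℝ≥0∞) ^ (p - 1) ≠ ⊤ := ENNReal.rpow_ne_top_of_nonneg (by linarith) (by simp)
  calc _ ≤ wInt (κ - n / 2) fun w => 2 ^ (p - 1) *
        (‖a‖ₑ ^ p * ‖ext0 F w‖ₑ ^ p + ‖b‖ₑ ^ p * ‖G w‖ₑ ^ p) := wInt_mono fun w hw => by
        rw [ext0_eqOn F hw, ← ENNReal.mul_rpow_of_nonneg _ _ hp0,
          ← ENNReal.mul_rpow_of_nonneg _ _ hp0, ← enorm_mul, ← enorm_mul]
        exact enorm_add_rpow_le hp _ _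
    _ = 2 ^ (p - 1) * (‖a‖ₑ ^ p * wInt (κ - n / 2) (fun w => ‖F w‖ₑ ^ p) +
        ‖b‖ₑ ^ p * wInt (κ - n / 2) fun w => ‖G w‖ₑ ^ p) := by
        have := measurable_ext0 hF.1
        rw [wInt_const_mul h2p, wInt_add (by fun_prop), wInt_const_mul (ht a),
          wInt_const_mul (ht b), wInt_ext0]
    _ < ⊤ := ENNReal.mul_lt_top h2p.lt_top (ENNReal.add_lt_top.2
        ⟨ENNReal.mul_lt_top (ht a).lt_top h1, ENNReal.mul_lt_top (ht b).lt_top h2⟩)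

lemma memA.boxOp_iterate {p κ : ℝ} (hp : 1 ≤ p) (hκ : (n : ℝ) / 2 - 1 < κ)
    {F : (Fin n → ℂ) → ℂ} (hF : memA n p κ F) (m : ℕ) :
    memA n p (κ + m * p) (BoxOp^[m] F) := by
  induction m with
  | zero => simpa using hF
  | succ m ih =>
    rw [Function.iterate_succ_apply']
    have h : 0 ≤ m * p := by positivity
    have := ih.boxOp hp (by linarith)
    convert this using 1
    push_cast; ring

lemma exists_BoxOp_iterate_bounded {p κ : ℝ} (hp : 1 ≤ p) (hκ : (n : ℝ) / 2 - 1 < κ) (m : ℕ) :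
    ∃ C, C ≠ ⊤ ∧ ∀ F, memA n p κ F → lpInt n p (κ + m * p) (BoxOp^[m] F) ≤ C * lpInt n p κ F := by
  induction m with
  | zero => exact ⟨1, by simp, fun F _ => by simp⟩
  | succ m ih =>
    obtain ⟨C, hC, h⟩ := ih
    have hm : 0 ≤ m * p := by positivity
    obtain ⟨C', hC', h'⟩ := exists_BoxOp_bounded (n := n) (κ := κ + m * p) hp (by linarith)
    refine ⟨C' * C, ENNReal.mul_ne_top hC' hC, fun F hF => ?_⟩
    have e : κ + (m + 1 : ℕ) * p = κ + m * p + p := by push_cast; ring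
    rw [Function.iterate_succ_apply', e, mul_assoc]
    exact (h' _ (hF.boxOp_iterate hp hκ m)).trans (by gcongr; exact h F hF)

lemma wInt_le_of_regW (j : Fin n) {b : ℝ} {f : (Fin n → ℂ) → ℝ≥0∞} (hf : Measurable f)
    {A : ℝ≥0∞} (h : ∀ t : ℝ, 0 < t → ∫⁻ z in tube n, regW j b t z * f z ≤ A) :
    wInt b f ≤ A := by
  calc wInt b f ≤ ∫⁻ z in tube n, Filter.liminf
        (fun k : ℕ => regW j b (1 / ((k : ℝ) + 1)) z * f z) Filter.atTop := by
        refine setLIntegral_mono' measurableSet_tube fun z hz => ?_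
        calc _ ≤ Filter.liminf (fun k : ℕ => regW j b (1 / ((k : ℝ) + 1)) z) Filter.atTop *
              f z := mul_le_mul_left (le_liminf_regW j b hz) _
          _ ≤ _ := by
              refine le_trans ?_ (ENNReal.le_liminf_mul (f := Filter.atTop))
              simp
    _ ≤ Filter.liminf (fun k : ℕ => ∫⁻ z in tube n, regW j b (1 / ((k : ℝ) + 1)) z * f z)
        Filter.atTop := lintegral_liminf_le
          (f := fun (k : ℕ) z => regW j b (1 / ((k : ℝ) + 1)) z * f z)
          fun k => (measurable_regW j b _).mul hf
    _ ≤ A := by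
        refine Filter.liminf_le_of_le (by isBoundedDefault) fun c hc => ?_
        obtain ⟨k, hk⟩ := hc.exists
        exact hk.trans (h _ (by positivity))

lemma memA.eq_zero_of_boxOp {j : Fin n} (hj : j ≠ 0) {ν p : ℝ} (hν : (n : ℝ) / 2 - 1 < ν)
    (hp : 1 ≤ p) (hH : hardy n p ν) {q : ℝ} (hq : 0 ≤ q) {F : (Fin n → ℂ) → ℂ}
    (hF : memA n p (ν + q) F) (h : EqOn (BoxOp F) 0 (tube n)) : EqOn F 0 (tube n) := by
  obtain ⟨C, hC, hR⟩ := hardy_regW hj hν hp hH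
  have hp0 : 0 < p := by linarith
  have hm := measurable_ext0 hF.1
  have h0 : ∀ t : ℝ, 0 < t →
      ∫⁻ z in tube n, regW j (ν - n / 2) t z * ‖ext0 F z‖ₑ ^ p ≤ 0 := by
    intro t ht
    have h1 : ∫⁻ z in tube n, regW j (ν - n / 2 + p) t z * ‖BoxOp F z‖ₑ ^ p = 0 := by
      rw [setLIntegral_congr_fun (g := fun _ => 0) measurableSet_tube fun z hz => by
        simp [h hz, hp0]]
      simp
    have h2 := hR t ht q hq F hF
    rw [h1, mul_zero] at h2
    refine le_trans (le_of_eq ?_) h2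
    exact setLIntegral_congr_fun measurableSet_tube fun z hz => by simp only [ext0_eqOn F hz]
  have h3 := wInt_le_of_regW j (by fun_prop) h0
  rw [wInt_ext0, ← lpInt_eq hp0.le] at h3
  have h4 : memA n p ν F := ⟨hF.1, h3.trans_lt (by simp)⟩
  intro z hz
  obtain ⟨C', hC', h5⟩ := exists_pointwise (n := n) hp hν hz
  have h6 := h5 F h4
  rw [le_antisymm h3 zero_le, mul_zero] at h6
  simpa [hp0, hp0.le, not_lt.2 hp0.le] using h6

lemma memA.eq_zero_of_boxOp_iterate {j : Fin n} (hj : j ≠ 0) {ν p : ℝ}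
    (hν : (n : ℝ) / 2 - 1 < ν) (hp : 1 ≤ p) (hH : hardy n p ν) (m : ℕ) :
    ∀ {q : ℝ}, 0 ≤ q → ∀ {F : (Fin n → ℂ) → ℂ}, memA n p (ν + q) F →
      EqOn (BoxOp^[m] F) 0 (tube n) → EqOn F 0 (tube n) := by
  induction m with
  | zero => exact fun _ _ _ h => h
  | succ m ih =>
    intro q hq F hF h
    have h1 := hF.boxOp hp (by linarith)
    rw [add_assoc] at h1
    exact hF.eq_zero_of_boxOp hj hν hp hH hq (ih (by linarith) h1 h)

end injective

/-! ### Composition of the integral operators -/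

section composition
variable {n : ℕ} [NeZero n]

/-- The inverse power `Δ(w - z̄)^{-s}` as a function of `w`. -/
def invPow (s : ℕ) (z w : Fin n → ℂ) : ℂ := (lorC (zeta w z) ^ s)⁻¹

lemma hasFDerivAt_invPow (s : ℕ) {z w : Fin n → ℂ} (hz : z ∈ tube n) (hw : w ∈ tube n) :
    HasFDerivAt (invPow s z) ((-(2 * s) * invPow (s + 1) z w) • bilL (zeta w z)) w := by
  have h := hasFDerivAt_ker s (fun _ => 1) hw hz
  simp only [kerD, mul_one] at h
  exact h

lemma pd_invPow (s : ℕ) {z w : Fin n → ℂ} (hz : z ∈ tube n) (hw : w ∈ tube n) (i : Fin n) :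
    pd i (invPow s z) w = -(2 * s) * eps i * (zeta w z i * invPow (s + 1) z w) := by
  rw [pd, (hasFDerivAt_invPow s hz hw).fderiv]
  simp [bilL_apply, bil_single]; ring

lemma BoxOp_invPow (s : ℕ) {z w : Fin n → ℂ} (hz : z ∈ tube n) (hw : w ∈ tube n) :
    BoxOp (invPow s z) w = -(4 * s * (s + 1 - n / 2)) * invPow (s + 1) z w := by
  have h1 : ∀ i, pd i (pd i (invPow s z)) w = -(2 * s) * eps i * (invPow (s + 1) z w +
      zeta w z i * (-(2 * (s + 1)) * eps i * (zeta w z i * invPow (s + 2) z w))) := by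
    intro i
    rw [pd_congr (fun x hx => pd_invPow s hz hx i) i hw]
    have hz1 : HasFDerivAt (fun w : Fin n → ℂ => zeta w z i)
        (ContinuousLinearMap.proj (R := ℂ) (φ := fun _ : Fin n => ℂ) i) w :=
      ((ContinuousLinearMap.proj (R := ℂ) (φ := fun _ : Fin n => ℂ) i).hasFDerivAt).sub_const _
    have hd := (hasFDerivAt_invPow (s + 1) hz hw).differentiableAt
    have h2 : pd i (fun w : Fin n → ℂ => zeta w z i) w = 1 := by
      rw [pd, hz1.fderiv]; simp
    have h3 := pd_mul hz1.differentiableAt hd i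
    rw [h2, pd_invPow _ hz hw] at h3
    rw [pd, fderiv_const_mul (hz1.differentiableAt.fun_mul hd)]
    rw [pd] at h3
    rw [smul_apply, h3, smul_eq_mul]; push_cast; ring
  have h4 : lorC (zeta w z) = ∑ i, eps i * zeta w z i ^ 2 := by
    have h : ∀ i : Fin n, eps i = (2 * (if i = 0 then 1 else 0) - 1 : ℂ) := by
      intro i; by_cases h : i = 0 <;> simp [eps, h]; norm_num
    simp [lorC, h, sub_mul, Finset.sum_sub_distrib]
  have h6 : lorC (zeta w z) * invPow (s + 2) z w = invPow (s + 1) z w := by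
    have := lorC_zeta_ne hw hz
    simp only [invPow]; field_simp; ring
  rw [BoxOp_eq]
  have h5 : ∀ i : Fin n, eps i * (-(2 * (s : ℂ)) * eps i * (invPow (s + 1) z w +
      zeta w z i * (-(2 * (s + 1)) * eps i * (zeta w z i * invPow (s + 2) z w)))) =
      -(2 * (s : ℂ)) * invPow (s + 1) z w +
        4 * s * (s + 1) * invPow (s + 2) z w * (eps i * zeta w z i ^ 2) := by
    intro i
    linear_combination (-(2 * (s : ℂ)) * (invPow (s + 1) z w +
      zeta w z i * (-(2 * (s + 1)) * eps i * (zeta w z i * invPow (s + 2) z w)))) *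
        eps_mul_eps i
  simp only [h1, h5, Finset.sum_add_distrib, ← Finset.mul_sum, ← h4]
  simp
  linear_combination (-(4 * s * (s + 1)) : ℂ) * h6

lemma measurable_invPow (s : ℕ) (z : Fin n → ℂ) : Measurable (invPow s z) :=
  ((continuous_lorC.comp (continuous_zeta.comp (by fun_prop : Continuous fun w : Fin n → ℂ =>
      (w, z)))).measurable.pow_const s).inv

lemma measurable_invPow_pair (s : ℕ) :
    Measurable fun q : (Fin n → ℂ) × (Fin n → ℂ) => (lorC (zeta q.1 q.2) ^ s)⁻¹ :=
  ((continuous_lorC.comp continuous_zeta).measurable.pow_const s).inv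

lemma differentiableOn_invPow (s : ℕ) {z : Fin n → ℂ} (hz : z ∈ tube n) :
    DifferentiableOn ℂ (invPow s z) (tube n) := fun _ hw =>
  (hasFDerivAt_invPow s hz hw).differentiableAt.differentiableWithinAt

/-- The reproducing formula applied to the inverse powers. -/
lemma exists_TOp_invPow (n : ℕ) [NeZero n] (hn : 3 ≤ n) (k s : ℕ) (hs : n < s) :
    ∃ c : ℂ, c ≠ 0 ∧ ∀ z ∈ tube n, ∀ v ∈ tube n,
      TOp (n + k + 1) (wtd k (invPow s z)) v = c * invPow (s + 1) z v := by
  obtain ⟨c, hc, h⟩ := exists_reproducing n k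
  have hne : ∀ t : ℕ, n ≤ t → (-(4 * t * (t + 1 - n / 2)) : ℂ) ≠ 0 := by
    intro t ht
    have h1 : (n : ℝ) ≤ t := by exact_mod_cast ht
    have h2 : (3 : ℝ) ≤ n := by exact_mod_cast hn
    have h3 : (-(4 * t * (t + 1 - n / 2)) : ℝ) ≠ 0 := by
      have : 0 < (t : ℝ) + 1 - n / 2 := by linarith
      have h4 : 0 < (t : ℝ) := by linarith
      have : 0 < 4 * (t : ℝ) * (t + 1 - n / 2) := by positivity
      linarith
    have h4 := Complex.ofReal_ne_zero.2 h3
    push_cast at h4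
    exact h4
  have e1 := hne (n + k) (by omega)
  have e2 := hne s hs.le
  refine ⟨(-(4 * (n + k : ℕ) * ((n + k : ℕ) + 1 - n / 2)) : ℂ)⁻¹ *
    (c * -(4 * s * (s + 1 - n / 2))), mul_ne_zero (inv_ne_zero e1) (mul_ne_zero hc e2),
    fun z hz v hv => ?_⟩
  have hm := measurable_invPow (n := n) s z
  have hT : ∀ x ∈ tube n, TConv (n + k) (wtd k (invPow s z)) x := by
    refine fun x hx => TConv.of_point (measurable_wtd k hm) hz hx ?_
    refine tconv_wtd hm hz ?_
    obtain ⟨C, hC, hJ⟩ := exists_J (n := n) (α := (n + k : ℕ) + s) (β := k) (by positivity)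
      (by push_cast; have : (n : ℝ) < s := by exact_mod_cast hs
          linarith)
    refine ne_top_of_le_ne_top (ENNReal.mul_ne_top hC (dl_rpow_ne_top hz _))
      ((le_of_eq ?_).trans (hJ z hz))
    refine setLIntegral_congr_fun measurableSet_tube fun w hw => ?_
    simp only [invPow]
    rw [enorm_inv_lorC_pow hw hz, kk_comm w z, neg_add,
      ENNReal.rpow_add _ _ (kk_ne_zero hz hw) (kk_ne_top _ _)]
    ring
  have h2 : EqOn (TOp (n + k) (wtd k (invPow s z))) (fun x => c * invPow s z x + 0 * invPow s z x)
      (tube n) := fun x hx => by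
    simp only [zero_mul, add_zero]
    exact h (invPow s z) (differentiableOn_invPow s hz) x hx (hT x hx)
  have h3 := BoxOp_congr h2 hv
  have h4 : BoxOp (fun x => c * invPow s z x + 0 * invPow s z x) v =
      c * BoxOp (invPow s z) v := by
    have hd : ∀ i, DifferentiableAt ℂ (pd i (invPow s z)) v := fun i => by
      have hz1 : DifferentiableAt ℂ (fun w : Fin n → ℂ => zeta w z i) v := by
        unfold zeta; fun_prop
      refine (((hz1.fun_mul (hasFDerivAt_invPow (s + 1) hz hv).differentiableAt).const_mul
        (-(2 * s) * eps i : ℂ))).congr_of_eventuallyEq ?_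
      exact Filter.eventuallyEq_of_mem (isOpen_tube.mem_nhds hv) fun x hx => pd_invPow s hz hx i
    have h5 : ∀ i, pd i (pd i fun x => c * invPow s z x + 0 * invPow s z x) v =
        c * pd i (pd i (invPow s z)) v := fun i => by
      rw [pd_congr (fun x hx => pd_lin (hasFDerivAt_invPow s hz hx).differentiableAt
        (hasFDerivAt_invPow s hz hx).differentiableAt c 0 i) i hv, pd_lin (hd i) (hd i)]
      simp
    simp only [BoxOp_eq, h5, mul_neg, Finset.mul_sum]
    congr 1
    exact Finset.sum_congr rfl fun i _ => by ring
  rw [BoxOp_TOp (measurable_wtd k hm) hv (hT v hv), h4, BoxOp_invPow s hz hv] at h3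
  rw [mul_assoc _ (c * _), mul_assoc c, ← h3, inv_mul_cancel_left₀ e1]

lemma star_invPow (s : ℕ) (z w : Fin n → ℂ) :
    starRingEnd ℂ (invPow s z w) = (lorC (zeta z w) ^ s)⁻¹ := by
  rw [invPow, map_inv₀, map_pow, lorC_zeta_symm w z]

/-- Composition of the integral operators. -/
lemma exists_TOp_TOp (n : ℕ) [NeZero n] (hn : 3 ≤ n) (k s : ℕ) (hs : n < s) :
    ∃ c : ℂ, c ≠ 0 ∧ ∀ g : (Fin n → ℂ) → ℂ, Measurable g → ∀ z ∈ tube n,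
      SOp s k (fun w => SOp (n + k + 1 : ℕ) k (fun v => ‖g v‖ₑ) w) z ≠ ⊤ →
      TOp s (wtd k (ext0 (TOp (n + k + 1) (wtd k g)))) z = c * TOp (s + 1) (wtd k g) z := by
  obtain ⟨c, hc, h⟩ := exists_TOp_invPow n hn k s hs
  refine ⟨starRingEnd ℂ c, by simpa using hc, fun g hg z hz hfin => ?_⟩
  set Φ : (Fin n → ℂ) → (Fin n → ℂ) → ℂ := fun w v => (lorC (zeta z w) ^ s)⁻¹ *
    ((lor (imP w) : ℂ) ^ k * ((lorC (zeta w v) ^ (n + k + 1))⁻¹ * wtd k g v)) with hΦ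
  have hlor : Measurable fun w : Fin n → ℂ => (lor (imP w) : ℂ) ^ k := by
    have := measurable_wtd (n := n) k (g := fun _ => 1) measurable_const
    unfold wtd at this
    simpa only [one_mul] using this
  have hΦm : Measurable (Function.uncurry Φ) := by
    refine (((measurable_lorC_zeta z s).comp measurable_fst).mul
      ((hlor.comp measurable_fst).mul ((measurable_invPow_pair _).mul
        ((measurable_wtd k hg).comp measurable_snd))))
  have hint : Integrable (Function.uncurry Φ)
      ((volume.restrict (tube n)).prod (volume.restrict (tube n))) := by
    refine ⟨hΦm.aestronglyMeasurable, ?_⟩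
    rw [HasFiniteIntegral, lintegral_prod _ hΦm.enorm.aemeasurable]
    refine lt_of_le_of_lt (le_of_eq ?_) hfin.lt_top
    refine setLIntegral_congr_fun measurableSet_tube fun w hw => ?_
    simp only [Function.uncurry, hΦ, enorm_mul (lorC _ ^ s)⁻¹, enorm_mul ((lor _ : ℂ) ^ k)]
    rw [lintegral_const_mul' _ _ enorm_ne_top, lintegral_const_mul' _ _ enorm_ne_top,
      lintegral_enorm_TOp hw, enorm_inv_lorC_pow hz hw, ← mul_assoc]
    congr 2
    have := enorm_wtd (k := k) (g := fun _ => 1) hw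
    simpa [wtd] using this
  have hswap := integral_integral_swap hint
  calc TOp s (wtd k (ext0 (TOp (n + k + 1) (wtd k g)))) z
      = ∫ w in tube n, ∫ v in tube n, Φ w v := by
        refine setIntegral_congr_fun measurableSet_tube fun w hw => ?_
        simp only [hΦ, integral_const_mul, wtd, ext0_eqOn _ hw]
        rw [mul_comm (TOp _ _ w)]; rfl
    _ = ∫ v in tube n, ∫ w in tube n, Φ w v := hswap
    _ = ∫ v in tube n, starRingEnd ℂ c * ((lorC (zeta z v) ^ (s + 1))⁻¹ * wtd k g v) := by
        refine setIntegral_congr_fun measurableSet_tube fun v hv => ?_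
        simp only [hΦ]
        have h1 := congrArg (starRingEnd ℂ) (h z hz v hv)
        rw [map_mul, star_invPow, TOp, ← integral_conj] at h1
        rw [← mul_assoc, ← h1, ← integral_mul_const]
        refine integral_congr_ae (ae_of_all _ fun w => ?_)
        simp only [wtd, map_mul, star_invPow, map_pow, conj_ofReal, map_inv₀]
        rw [← lorC_zeta_symm v w]
        ring
    _ = _ := integral_const_mul _ _

end composition

/-! ### Decomposition along the level sets of `Δ(Im z)` -/

section levels
variable {n : ℕ} [NeZero n]

/-- The superlevel sets of `Δ(Im w)`. -/
def superlevel (n : ℕ) [NeZero n] (ρ : ℝ) : Set (Fin n → ℂ) := {w | ρ < lor (imP w)}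

/-- The shells `ρ < Δ(Im z) ≤ 2ρ`. -/
def shell (n : ℕ) [NeZero n] (ρ : ℝ) : Set (Fin n → ℂ) :=
  {z | ρ < lor (imP z) ∧ lor (imP z) ≤ 2 * ρ}

lemma continuous_lor_imP : Continuous fun w : Fin n → ℂ => lor (imP w) :=
  continuous_lor.comp continuous_imP

lemma measurableSet_superlevel (ρ : ℝ) : MeasurableSet (superlevel n ρ) :=
  measurableSet_lt measurable_const continuous_lor_imP.measurable

lemma measurableSet_shell (ρ : ℝ) : MeasurableSet (shell n ρ) :=
  (measurableSet_superlevel ρ).inter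
    (measurableSet_le continuous_lor_imP.measurable measurable_const)

lemma measurable_superlevel_pair {f : (Fin n → ℂ) → ℝ≥0∞} (hf : Measurable f) :
    Measurable fun q : ℝ × (Fin n → ℂ) => (superlevel n q.1).indicator f q.2 := by
  have hs : MeasurableSet {q : ℝ × (Fin n → ℂ) | q.1 < lor (imP q.2)} :=
    measurableSet_lt measurable_fst (continuous_lor_imP.measurable.comp measurable_snd)
  exact (hf.comp measurable_snd).indicator hs

lemma measurable_superlevel_compl_pair {f : (Fin n → ℂ) → ℝ≥0∞} (hf : Measurable f) :
    Measurable fun q : ℝ × (Fin n → ℂ) => (superlevel n q.1)ᶜ.indicator f q.2 := by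
  have hs : MeasurableSet {q : ℝ × (Fin n → ℂ) | q.1 < lor (imP q.2)} :=
    measurableSet_lt measurable_fst (continuous_lor_imP.measurable.comp measurable_snd)
  exact (hf.comp measurable_snd).indicator hs.compl

lemma measurable_shell_pair {ε : ℝ} {f : (Fin n → ℂ) → ℝ≥0∞} (hf : Measurable f) :
    Measurable fun q : ℝ × (Fin n → ℂ) => (shell n (ε * q.1)).indicator f q.2 := by
  have hl : Measurable fun q : ℝ × (Fin n → ℂ) => lor (imP q.2) :=
    continuous_lor_imP.measurable.comp measurable_snd
  have hs : MeasurableSet {q : ℝ × (Fin n → ℂ) |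
      ε * q.1 < lor (imP q.2) ∧ lor (imP q.2) ≤ 2 * (ε * q.1)} :=
    (measurableSet_lt (by fun_prop) hl).inter (measurableSet_le hl (by fun_prop))
  exact (hf.comp measurable_snd).indicator hs

lemma one_le_lintegral_shell {ε : ℝ} (hε : 0 < ε) {z : Fin n → ℂ} (hz : z ∈ tube n) :
    1 ≤ 2 * ∫⁻ ρ in Ioi (0 : ℝ), (ENNReal.ofReal ρ)⁻¹ * (shell n (ε * ρ)).indicator 1 z := by
  set x := lor (imP z) with hx
  have hx0 : 0 < x := hz.1
  have hsub : Ico (x / (2 * ε)) (x / ε) ⊆ Ioi 0 := fun ρ hρ =>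
    lt_of_lt_of_le (by positivity) hρ.1
  calc (1 : ℝ≥0∞) = 2 * ∫⁻ _ in Ico (x / (2 * ε)) (x / ε), (ENNReal.ofReal (x / ε))⁻¹ := by
        rw [lintegral_const, Measure.restrict_apply_univ, Real.volume_Ico,
          ← ENNReal.ofReal_inv_of_pos (by positivity), ← ENNReal.ofReal_mul (by positivity),
          show (2 : ℝ≥0∞) = ENNReal.ofReal 2 by simp, ← ENNReal.ofReal_mul (by positivity)]
        rw [← ENNReal.ofReal_one]; congr 1; field_simp; ring
    _ ≤ 2 * ∫⁻ ρ in Ico (x / (2 * ε)) (x / ε),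
        (ENNReal.ofReal ρ)⁻¹ * (shell n (ε * ρ)).indicator 1 z := by
        gcongr 2 * ?_
        refine setLIntegral_mono' measurableSet_Ico fun ρ hρ => ?_
        have h1 : z ∈ shell n (ε * ρ) := by
          refine ⟨?_, ?_⟩
          · have := (lt_div_iff₀ hε).1 hρ.2; rw [← hx]; linarith
          · have := (div_le_iff₀ (by positivity)).1 hρ.1; rw [← hx]; linarith
        rw [indicator_of_mem h1, Pi.one_apply, mul_one]
        exact ENNReal.inv_le_inv.2 (ENNReal.ofReal_le_ofReal hρ.2.le)
    _ ≤ _ := by gcongr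

lemma lintegral_le_shell {ε : ℝ} (hε : 0 < ε) {X : (Fin n → ℂ) → ℝ≥0∞} (hX : Measurable X) :
    ∫⁻ z in tube n, X z ≤ 2 * ∫⁻ ρ in Ioi (0 : ℝ), (ENNReal.ofReal ρ)⁻¹ *
      ∫⁻ z in tube n, (shell n (ε * ρ)).indicator X z := by
  have h2 : (2 : ℝ≥0∞) ≠ ⊤ := by simp
  have hm : Measurable fun q : ℝ × (Fin n → ℂ) =>
      (ENNReal.ofReal q.1)⁻¹ * (shell n (ε * q.1)).indicator X q.2 :=
    (measurable_fst.ennreal_ofReal.inv).mul (measurable_shell_pair hX)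
  have hm1 : ∀ z, Measurable fun ρ : ℝ =>
      (ENNReal.ofReal ρ)⁻¹ * (shell n (ε * ρ)).indicator (1 : (Fin n → ℂ) → ℝ≥0∞) z := by
    intro z
    have hs : MeasurableSet {ρ : ℝ | ε * ρ < lor (imP z) ∧ lor (imP z) ≤ 2 * (ε * ρ)} :=
      (measurableSet_lt (measurable_id.const_mul ε) measurable_const).inter
        (measurableSet_le measurable_const ((measurable_id.const_mul ε).const_mul 2))
    exact (measurable_id.ennreal_ofReal.inv).mul ((measurable_const (a := (1 : ℝ≥0∞))).indicator hs)
  calc ∫⁻ z in tube n, X z ≤ ∫⁻ z in tube n, 2 * ∫⁻ ρ in Ioi (0 : ℝ),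
        (ENNReal.ofReal ρ)⁻¹ * (shell n (ε * ρ)).indicator X z := by
        refine setLIntegral_mono' measurableSet_tube fun z hz => ?_
        calc X z ≤ X z * (2 * ∫⁻ ρ in Ioi (0 : ℝ),
              (ENNReal.ofReal ρ)⁻¹ * (shell n (ε * ρ)).indicator 1 z) :=
              le_mul_of_one_le_right' (one_le_lintegral_shell hε hz)
          _ = 2 * ∫⁻ ρ in Ioi (0 : ℝ), X z *
              ((ENNReal.ofReal ρ)⁻¹ * (shell n (ε * ρ)).indicator 1 z) := by
              rw [lintegral_const_mul _ (hm1 z)]; ring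
          _ = _ := by
              congr 1
              refine lintegral_congr fun ρ => ?_
              by_cases h : z ∈ shell n (ε * ρ)
              · simp [h, mul_comm]
              · simp [h]
    _ = 2 * ∫⁻ ρ in Ioi (0 : ℝ), ∫⁻ z in tube n,
        (ENNReal.ofReal ρ)⁻¹ * (shell n (ε * ρ)).indicator X z := by
        rw [lintegral_const_mul' _ _ h2, lintegral_lintegral_swap]
        exact (hm.comp measurable_swap).aemeasurable
    _ = _ := by
        congr 1
        refine setLIntegral_congr_fun measurableSet_Ioi fun ρ hρ => ?_
        exact lintegral_const_mul' _ _ (ENNReal.inv_ne_top.2 (by simpa using hρ))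

lemma lintegral_wInt {γ : ℝ} {a : ℝ → ℝ≥0∞} (ha : Measurable a)
    {f : ℝ → (Fin n → ℂ) → ℝ≥0∞} (hf : Measurable fun q : ℝ × (Fin n → ℂ) => f q.1 q.2)
    (hat : ∀ ρ, 0 < ρ → a ρ ≠ ⊤) :
    ∫⁻ ρ in Ioi (0 : ℝ), a ρ * wInt γ (f ρ) =
      wInt γ fun w => ∫⁻ ρ in Ioi (0 : ℝ), a ρ * f ρ w := by
  have hm : Measurable fun q : ℝ × (Fin n → ℂ) => a q.1 * (dl q.2 ^ γ * f q.1 q.2) :=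
    (ha.comp measurable_fst).mul
      (((measurable_dl measurable_snd).pow_const γ).mul hf)
  calc _ = ∫⁻ ρ in Ioi (0 : ℝ), ∫⁻ w in tube n, a ρ * (dl w ^ γ * f ρ w) :=
        setLIntegral_congr_fun measurableSet_Ioi fun ρ hρ =>
          (lintegral_const_mul' _ _ (hat ρ hρ)).symm
    _ = ∫⁻ w in tube n, ∫⁻ ρ in Ioi (0 : ℝ), a ρ * (dl w ^ γ * f ρ w) :=
        lintegral_lintegral_swap hm.aemeasurable
    _ = _ := setLIntegral_congr_fun measurableSet_tube fun w hw => by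
        simp only []
        rw [← lintegral_const_mul' _ _ (dl_rpow_ne_top hw γ)]
        exact lintegral_congr fun ρ => by ring

lemma lintegral_superlevel_le {γ p : ℝ} (hp : 1 ≤ p) {f : (Fin n → ℂ) → ℝ≥0∞}
    (hf : Measurable f) :
    ∫⁻ ρ in Ioi (0 : ℝ), (ENNReal.ofReal ρ) ^ (p - 1) *
      wInt (γ - p) ((superlevel n ρ).indicator f) ≤ wInt γ f := by
  rw [lintegral_wInt (by fun_prop) (measurable_superlevel_pair hf)
    fun ρ _ => ENNReal.rpow_ne_top_of_nonneg (by linarith) (by simp)]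
  calc _ ≤ wInt (γ - p) fun w => dl w ^ p * f w := wInt_mono fun w hw => ?_
    _ = wInt γ f := by rw [wInt_dl_mul]; congr 1; ring
  calc _ ≤ ∫⁻ ρ in Ioi (0 : ℝ), (Ioo 0 (lor (imP w))).indicator
        (fun _ => dl w ^ (p - 1) * f w) ρ := by
        refine setLIntegral_mono' measurableSet_Ioi fun ρ hρ => ?_
        by_cases h : ρ < lor (imP w)
        · rw [indicator_of_mem (show w ∈ superlevel n ρ from h),
            indicator_of_mem (show ρ ∈ Ioo 0 (lor (imP w)) from ⟨hρ, h⟩)]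
          exact mul_le_mul_left
            (ENNReal.rpow_le_rpow (ENNReal.ofReal_le_ofReal h.le) (by linarith)) _
        · rw [indicator_of_notMem (show w ∉ superlevel n ρ from h), mul_zero]; exact zero_le
    _ ≤ ∫⁻ ρ, (Ioo 0 (lor (imP w))).indicator (fun _ => dl w ^ (p - 1) * f w) ρ :=
        setLIntegral_le_lintegral _ _
    _ = dl w ^ p * f w := by
        rw [lintegral_indicator measurableSet_Ioo, setLIntegral_const, Real.volume_Ioo, sub_zero]
        rw [mul_right_comm]
        congr 1
        have := dl_rpow_add hw (p - 1) 1
        rw [sub_add_cancel, ENNReal.rpow_one] at this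
        exact this.symm

lemma lintegral_superlevel_compl_le {γ L : ℝ} (hL : 0 < L) {f : (Fin n → ℂ) → ℝ≥0∞}
    (hf : Measurable f) :
    ∫⁻ ρ in Ioi (0 : ℝ), (ENNReal.ofReal ρ) ^ (-L - 1) *
      wInt (γ + L) ((superlevel n ρ)ᶜ.indicator f) ≤ ENNReal.ofReal (1 / L) * wInt γ f := by
  rw [lintegral_wInt (by fun_prop) (measurable_superlevel_compl_pair hf)
    fun ρ hρ => ENNReal.rpow_ne_top_of_ne_zero (by simpa using hρ) (by simp)]
  calc _ ≤ wInt (γ + L) fun w => ENNReal.ofReal (1 / L) * (dl w ^ (-L) * f w) :=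
        wInt_mono fun w hw => ?_
    _ = _ := by rw [wInt_const_mul (by simp), wInt_dl_mul]; congr 2; ring
  have hx : 0 < lor (imP w) := hw.1
  have hr : ∀ ρ : ℝ, 0 < ρ → (ENNReal.ofReal ρ) ^ (-L - 1) = ENNReal.ofReal (ρ ^ (-L - 1)) :=
    fun ρ hρ => ENNReal.ofReal_rpow_of_pos hρ
  calc _ = ∫⁻ ρ in Ioi (0 : ℝ), (Ici (lor (imP w))).indicator
        (fun ρ => (ENNReal.ofReal ρ) ^ (-L - 1) * f w) ρ := by
        refine setLIntegral_congr_fun measurableSet_Ioi fun ρ hρ => ?_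
        by_cases h : ρ < lor (imP w)
        · simp [superlevel, h]
        · simp [superlevel, h, not_lt.1 h]
    _ = ∫⁻ ρ in Ici (lor (imP w)), (ENNReal.ofReal ρ) ^ (-L - 1) * f w := by
        have h : Ici (lor (imP w)) ⊆ Ioi 0 := fun ρ hρ => hx.trans_le hρ
        rw [setLIntegral_indicator measurableSet_Ici, inter_eq_left.2 h]
    _ = (∫⁻ ρ in Ioi (lor (imP w)), ENNReal.ofReal (ρ ^ (-L - 1))) * f w := by
        rw [lintegral_mul_const _ (by fun_prop), setLIntegral_congr Ioi_ae_eq_Ici.symm]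
        congr 1
        exact setLIntegral_congr_fun measurableSet_Ioi fun ρ hρ => hr ρ (hx.trans hρ)
    _ = ENNReal.ofReal (1 / L) * (dl w ^ (-L) * f w) := by
        rw [← ofReal_integral_eq_lintegral_ofReal
          (integrableOn_Ioi_rpow_of_lt (by linarith) hx), integral_Ioi_rpow_of_lt (by linarith) hx,
          dl, ENNReal.ofReal_rpow_of_pos hx, ← mul_assoc, ← ENNReal.ofReal_mul (by positivity)]
        · congr 2
          rw [sub_add_cancel]; field_simp
        · exact ae_restrict_of_forall_mem measurableSet_Ioi fun ρ hρ =>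
            Real.rpow_nonneg (hx.trans hρ).le _
    _ ≤ _ := le_rfl

end levels

/-! ### The family of integral operators -/

section family
variable {n : ℕ} [NeZero n] {p γ : ℝ} {M l : ℕ}

lemma measurable_SOp {s β : ℝ} {f : (Fin n → ℂ) → ℝ≥0∞} (hf : Measurable f) :
    Measurable (SOp s β f) := by
  have hm : Measurable fun q : (Fin n → ℂ) × (Fin n → ℂ) =>
      kk q.1 q.2 ^ (-s) * dl q.2 ^ β * f q.2 := by fun_prop
  exact hm.lintegral_prod_right'

lemma schur_shift {j : ℝ} {s : ℕ} (hp : 1 ≤ p) (hl : n + 1 ≤ l) (hj : 0 ≤ j)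
    (hj' : j ≤ n + M + 1) (hs : (s : ℝ) = n + l + j)
    (h3 : 0 ≤ γ + (j - M) - (n + M - j + 1) * (p - 1)) (h4 : n + γ < M + l) :
    (∃ C : ℝ≥0∞, C ≠ ⊤ ∧ ∀ f : (Fin n → ℂ) → ℝ≥0∞, Measurable f →
      wInt (γ + p * (j - M)) (fun z => SOp s (M + l : ℕ) f z ^ p) ≤
        C * wInt γ (fun w => f w ^ p)) ∧
    ∀ z ∈ tube n, ∃ C : ℝ≥0∞, C ≠ ⊤ ∧ ∀ f : (Fin n → ℂ) → ℝ≥0∞, Measurable f →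
      SOp s (M + l : ℕ) f z ^ p ≤ C * wInt γ (fun w => f w ^ p) := by
  have hl' : (n : ℝ) + 1 ≤ l := by exact_mod_cast hl
  have e : (s : ℝ) - n - (M + l : ℕ) = j - M := by rw [hs]; push_cast; ring
  have h1 : (n + M - j + 1 : ℝ) ≤ (M + l : ℕ) := by push_cast; linarith
  have h2 : 2 * n < (s : ℝ) - (M + l : ℕ) + (n + M - j + 1) := by linarith
  have h5 : n + γ < (M + l : ℕ) + (n + M - j + 1) * (p - 1) := by
    have : 0 ≤ (n + M - j + 1) * (p - 1) := mul_nonneg (by linarith) (by linarith)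
    push_cast; linarith
  rw [← e] at h3 ⊢
  exact ⟨schur hp h1 h2 h3 h5, fun z hz => SOp_pointwise hp h1 h2 h3 h5 hz⟩

lemma SOp_ne_top_of_rpow_le {s β : ℝ} (hp : 1 ≤ p) {f : (Fin n → ℂ) → ℝ≥0∞}
    {z : Fin n → ℂ} {A : ℝ≥0∞} (hA : A ≠ ⊤) (h : SOp s β f z ^ p ≤ A) : SOp s β f z ≠ ⊤ := by
  intro h1
  rw [h1, ENNReal.top_rpow_of_pos (by linarith)] at h
  exact hA (top_le_iff.1 h)

lemma wInt_TOp_le {s k : ℕ} (hp : 1 ≤ p) {g : (Fin n → ℂ) → ℂ} :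
    (wInt γ fun z => ‖TOp s (wtd k g) z‖ₑ ^ p) ≤
      wInt γ fun z => SOp s k (fun w => ‖g w‖ₑ) z ^ p :=
  wInt_mono fun _ hz => ENNReal.rpow_le_rpow (enorm_TOp_le hz) (by linarith)

variable {b : ℝ}

/-- Boundedness and holomorphy of the first operator of the family. -/
lemma exists_TOp_zero (hp : 1 ≤ p) (hl : n + 1 ≤ l) (hb : -1 < b)
    (h4 : n + (b + M * p + (n + 2) * p) < M + l) :
    (∃ C : ℝ≥0∞, C ≠ ⊤ ∧ ∀ f : (Fin n → ℂ) → ℝ≥0∞, Measurable f →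
      wInt (b + (n + 2) * p) (fun z => SOp (n + l : ℕ) (M + l : ℕ) f z ^ p) ≤
        C * wInt (b + M * p + (n + 2) * p) (fun w => f w ^ p)) ∧
    ∀ z ∈ tube n, ∀ f : (Fin n → ℂ) → ℝ≥0∞, Measurable f →
      wInt (b + M * p + (n + 2) * p) (fun w => f w ^ p) ≠ ⊤ →
        SOp (n + l : ℕ) (M + l : ℕ) f z ≠ ⊤ := by
  obtain ⟨⟨C, hC, h1⟩, h2⟩ := schur_shift (n := n) (j := 0) (s := n + l)
    (γ := b + M * p + (n + 2) * p) (M := M) hp hl le_rfl (by positivity) (by push_cast; ring)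
    (by nlinarith) h4
  refine ⟨⟨C, hC, fun f hf => ?_⟩, fun z hz f hf hfin => ?_⟩
  · convert h1 f hf using 2; ring
  · obtain ⟨C', hC', h3⟩ := h2 z hz
    exact SOp_ne_top_of_rpow_le hp (ENNReal.mul_ne_top hC' hfin) (h3 f hf)

lemma memA_TOp (hp : 1 ≤ p) (hl : n + 1 ≤ l) (hb : -1 < b)
    (h4 : n + (b + M * p + (n + 2) * p) < M + l) {g : (Fin n → ℂ) → ℂ} (hg : Measurable g)
    (hfin : wInt (b + M * p + (n + 2) * p) (fun w => ‖g w‖ₑ ^ p) ≠ ⊤) :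
    (∀ z ∈ tube n, TConv (n + l) (wtd (M + l) g) z) ∧
      memA n p (b + n / 2 + (n + 2) * p) (TOp (n + l) (wtd (M + l) g)) := by
  obtain ⟨⟨C, hC, h1⟩, h2⟩ := exists_TOp_zero hp hl hb h4
  have hT : ∀ z ∈ tube n, TConv (n + l) (wtd (M + l) g) z := fun z hz =>
    tconv_wtd hg hz (h2 z hz _ hg.enorm hfin)
  refine ⟨hT, differentiableOn_TOp (measurable_wtd _ hg) bpt_mem (hT _ bpt_mem), ?_⟩
  rw [lpInt_eq (by linarith)]
  refine lt_of_le_of_lt ((wInt_TOp_le hp).trans ?_) (ENNReal.mul_lt_top hC.lt_top hfin.lt_top)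
  rw [show b + n / 2 + (n + 2) * p - n / 2 = b + (n + 2) * p by ring]
  exact h1 _ hg.enorm

lemma exists_TOp_one (hp : 1 ≤ p) (hl : n + 1 ≤ l) (hb : -1 < b)
    (h4 : n + (b + M * p + (n + 2) * p) < M + l) :
    ∃ C : ℝ≥0∞, C ≠ ⊤ ∧ ∀ g : (Fin n → ℂ) → ℂ, Measurable g →
      wInt (b + p + (n + 2) * p) (fun z => ‖TOp (n + l + 1) (wtd (M + l) g) z‖ₑ ^ p) ≤
        C * wInt (b + M * p + (n + 2) * p) (fun w => ‖g w‖ₑ ^ p) := by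
  obtain ⟨⟨C, hC, h1⟩, -⟩ := schur_shift (n := n) (j := 1) (s := n + l + 1)
    (γ := b + M * p + (n + 2) * p) (M := M) hp hl zero_le_one
    (by have : (0 : ℝ) ≤ n + M := by positivity
        linarith) (by push_cast; ring)
    (by nlinarith) h4
  rw [show b + M * p + (n + 2) * p + p * (1 - M : ℝ) = b + p + (n + 2) * p by ring] at h1
  exact ⟨C, hC, fun g hg => (wInt_TOp_le hp).trans (h1 _ hg.enorm)⟩

/-- Factorization of the second operator of the family through the first one. -/
lemma exists_factor (hn : 3 ≤ n) (hp : 1 ≤ p) (hl : n + 1 ≤ l) (hM : n + 1 ≤ M) (hb : -1 < b)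
    (h4 : n + (b + M * p + (n + 2) * p) < M + l) :
    ∃ a : ℂ, ∃ C : ℝ≥0∞, C ≠ ⊤ ∧ ∀ g : (Fin n → ℂ) → ℂ, Measurable g →
      wInt (b + M * p - p + (n + 2) * p) (fun w => ‖g w‖ₑ ^ p) ≠ ⊤ →
      ∃ h : (Fin n → ℂ) → ℂ, Measurable h ∧
        EqOn (TOp (n + l + 1) (wtd (M + l) g)) (fun z => a * TOp (n + l) (wtd (M + l) h) z)
          (tube n) ∧
        wInt (b + M * p) (fun w => ‖h w‖ₑ ^ p) ≤
          C * wInt (b + M * p - p) (fun w => ‖g w‖ₑ ^ p) ∧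
        wInt (b + M * p + (n + 2) * p) (fun w => ‖h w‖ₑ ^ p) ≤
          C * wInt (b + M * p - p + (n + 2) * p) (fun w => ‖g w‖ₑ ^ p) := by
  have hM' : (n : ℝ) + 1 ≤ M := by exact_mod_cast hM
  have hn0 : (0 : ℝ) ≤ n := by positivity
  have hL : 0 ≤ (n + 2) * p := by positivity
  have hMp : 0 ≤ b + M * p - p + 1 - n * (p - 1) := by nlinarith
  obtain ⟨⟨C₁, hC₁, h1⟩, -⟩ := schur_shift (n := n) (j := M + 1) (s := n + (M + l) + 1)
    (γ := b + M * p - p) (M := M) hp hl (by positivity) (by linarith) (by push_cast; ring)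
    (by nlinarith) (by linarith)
  obtain ⟨⟨C₂, hC₂, h2⟩, h2'⟩ := schur_shift (n := n) (j := M + 1) (s := n + (M + l) + 1)
    (γ := b + M * p - p + (n + 2) * p) (M := M) hp hl (by positivity) (by linarith)
    (by push_cast; ring) (by nlinarith) (by linarith)
  obtain ⟨c, hc, hcomp⟩ := exists_TOp_TOp n hn (M + l) (n + l) (by omega)
  refine ⟨c⁻¹, max C₁ C₂, (max_lt hC₁.lt_top hC₂.lt_top).ne, fun g hg hfin => ?_⟩
  have hT : ∀ z ∈ tube n, TConv (n + (M + l) + 1) (wtd (M + l) g) z := fun z hz => by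
    obtain ⟨C', hC', h3⟩ := h2' z hz
    exact tconv_wtd hg hz
      (SOp_ne_top_of_rpow_le hp (ENNReal.mul_ne_top hC' hfin) (h3 _ hg.enorm))
  have hd := differentiableOn_TOp (measurable_wtd _ hg) bpt_mem (hT _ bpt_mem)
  have e1 : b + M * p - p + p * (M + 1 - M : ℝ) = b + M * p := by ring
  have e2 : b + M * p - p + (n + 2) * p + p * (M + 1 - M : ℝ) = b + M * p + (n + 2) * p := by ring
  rw [e1] at h1
  rw [e2] at h2
  refine ⟨ext0 (TOp (n + (M + l) + 1) (wtd (M + l) g)), measurable_ext0 hd, fun z hz => ?_, ?_, ?_⟩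
  · have h3 := hcomp g hg z hz ((exists_TOp_zero hp hl hb h4).2 z hz _
      (measurable_SOp hg.enorm) (ne_top_of_le_ne_top (ENNReal.mul_ne_top hC₂ hfin)
        (h2 _ hg.enorm)))
    simp only []
    rw [h3, inv_mul_cancel_left₀ hc]
  · rw [wInt_ext0]
    exact (wInt_TOp_le hp).trans ((h1 _ hg.enorm).trans (by gcongr; exact le_max_left _ _))
  · rw [wInt_ext0]
    exact (wInt_TOp_le hp).trans ((h2 _ hg.enorm).trans (by gcongr; exact le_max_right _ _))

end family

/-! ### The bootstrap estimate -/

section bootstrap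
variable {n : ℕ} [NeZero n] {p b : ℝ} {M l : ℕ}

lemma measurable_TOp {s : ℕ} {f : (Fin n → ℂ) → ℂ} (hf : Measurable f) :
    Measurable (TOp s f) := by
  have hc : Continuous fun q : (Fin n → ℂ) × (Fin n → ℂ) => lorC (zeta q.1 q.2) :=
    continuous_lorC.comp continuous_zeta
  have hm : Measurable fun q : (Fin n → ℂ) × (Fin n → ℂ) => (lorC (zeta q.1 q.2) ^ s)⁻¹ * f q.2 :=
    ((hc.measurable.pow_const s).inv).mul (hf.comp measurable_snd)
  exact (StronglyMeasurable.integral_prod_right (ν := volume.restrict (tube n))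
    hm.stronglyMeasurable).measurable

lemma enorm_indicator_rpow (hp : 0 < p) (S : Set (Fin n → ℂ)) (g : (Fin n → ℂ) → ℂ) :
    (fun w => ‖S.indicator g w‖ₑ ^ p) = S.indicator fun w => ‖g w‖ₑ ^ p := by
  funext w
  by_cases h : w ∈ S
  · simp [h]
  · simp [h, hp]

lemma wtd_indicator_add_compl (k : ℕ) (S : Set (Fin n → ℂ)) (g : (Fin n → ℂ) → ℂ)
    (w : Fin n → ℂ) : wtd k (S.indicator g) w + wtd k (Sᶜ.indicator g) w = wtd k g w := by
  rw [wtd, wtd, wtd, ← add_mul]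
  congr 1
  exact indicator_self_add_compl_apply S g w

lemma TOp_indicator_add_compl {s k : ℕ} {S : Set (Fin n → ℂ)} {g : (Fin n → ℂ) → ℂ}
    {z : Fin n → ℂ} (h1 : TConv s (wtd k (S.indicator g)) z)
    (h2 : TConv s (wtd k (Sᶜ.indicator g)) z) :
    TOp s (wtd k g) z = TOp s (wtd k (S.indicator g)) z + TOp s (wtd k (Sᶜ.indicator g)) z := by
  rw [TOp, TOp, TOp, ← integral_add h1 h2]
  refine integral_congr_ae (Filter.Eventually.of_forall fun w => ?_)
  simp only [← mul_add, wtd_indicator_add_compl]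

lemma wInt_indicator_le {γ : ℝ} (S : Set (Fin n → ℂ)) (f : (Fin n → ℂ) → ℝ≥0∞) :
    wInt γ (S.indicator f) ≤ wInt γ f :=
  wInt_mono fun w _ => indicator_le_self _ _ w

lemma wInt_superlevel_ne_top {δ ρ : ℝ} (hp : 0 ≤ p) (hρ : 0 < ρ) {f : (Fin n → ℂ) → ℝ≥0∞}
    (h : wInt δ f ≠ ⊤) : wInt (δ - p) ((superlevel n ρ).indicator f) ≠ ⊤ := by
  have hρ' : ENNReal.ofReal ρ ^ (-p) ≠ ⊤ :=
    ENNReal.rpow_ne_top_of_ne_zero (by simpa using hρ) ENNReal.ofReal_ne_top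
  refine ne_top_of_le_ne_top (ENNReal.mul_ne_top hρ' h) ?_
  rw [sub_eq_add_neg, ← wInt_dl_mul, ← wInt_const_mul hρ']
  refine wInt_mono fun w hw => ?_
  by_cases h1 : w ∈ superlevel n ρ
  · rw [indicator_of_mem h1, ENNReal.rpow_neg, ENNReal.rpow_neg]
    gcongr
    exact ENNReal.ofReal_le_ofReal (le_of_lt h1)
  · rw [indicator_of_notMem h1]; simp

lemma measurable_wInt_param {γ : ℝ} {f : ℝ → (Fin n → ℂ) → ℝ≥0∞}
    (hf : Measurable fun q : ℝ × (Fin n → ℂ) => f q.1 q.2) : Measurable fun ρ => wInt γ (f ρ) := by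
  have hm : Measurable fun q : ℝ × (Fin n → ℂ) => dl q.2 ^ γ * f q.1 q.2 :=
    ((measurable_dl measurable_snd).pow_const γ).mul hf
  exact hm.lintegral_prod_right'

/-- The a priori size of the data in the regularized estimate. -/
def dataInt (n : ℕ) [NeZero n] (p b : ℝ) (M : ℕ) (c : ℝ≥0∞) (g : (Fin n → ℂ) → ℂ) : ℝ≥0∞ :=
  wInt (b + M * p) (fun w => ‖g w‖ₑ ^ p) + c * wInt (b + M * p + (n + 2) * p) fun w => ‖g w‖ₑ ^ p

/-- The regularized estimate with constant `K`. -/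
def RegBound (j : Fin n) (p b t : ℝ) (M l : ℕ) (c K : ℝ≥0∞) : Prop :=
  ∀ g : (Fin n → ℂ) → ℂ, Measurable g → dataInt n p b M c g ≠ ⊤ →
    ∫⁻ z in tube n, regW j b t z * ‖TOp (n + l) (wtd (M + l) g) z‖ₑ ^ p ≤ K * dataInt n p b M c g

lemma RegBound.mono {j : Fin n} {t : ℝ} {c K K' : ℝ≥0∞} (h : RegBound j p b t M l c K)
    (hK : K ≤ K') : RegBound j p b t M l c K' := fun g hg hfin =>
  (h g hg hfin).trans (by gcongr)

lemma wInt_ne_top_of_dataInt {c : ℝ≥0∞} (hc : c ≠ 0) {g : (Fin n → ℂ) → ℂ}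
    (h : dataInt n p b M c g ≠ ⊤) :
    wInt (b + M * p) (fun w => ‖g w‖ₑ ^ p) ≠ ⊤ ∧
      wInt (b + M * p + (n + 2) * p) (fun w => ‖g w‖ₑ ^ p) ≠ ⊤ := by
  rw [dataInt, ENNReal.add_ne_top] at h
  refine ⟨h.1, fun h' => h.2 ?_⟩
  rw [h', ENNReal.mul_top hc]

lemma exists_regBound (hp : 1 ≤ p) (hl : n + 1 ≤ l) (hb : -1 < b)
    (h4 : n + (b + M * p + (n + 2) * p) < M + l) {j : Fin n} (hj : j ≠ 0) {t : ℝ} (ht : 0 < t)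
    {c : ℝ≥0∞} (hc : c ≠ 0) (hc' : c ≠ ⊤) : ∃ K : ℝ≥0∞, K ≠ ⊤ ∧ RegBound j p b t M l c K := by
  obtain ⟨⟨C, hC, h1⟩, -⟩ := exists_TOp_zero (n := n) hp hl hb h4
  obtain ⟨C', hC', h2⟩ := regW_le (n := n) (q := (n + 2) * p) hj hb ht (by positivity)
  refine ⟨C' * C * c⁻¹, ENNReal.mul_ne_top (ENNReal.mul_ne_top hC' hC) (by simpa using hc),
    fun g hg hfin => ?_⟩
  calc _ ≤ ∫⁻ z in tube n, C' * (dl z ^ (b + (n + 2) * p) *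
        ‖TOp (n + l) (wtd (M + l) g) z‖ₑ ^ p) := by
        refine setLIntegral_mono' measurableSet_tube fun z hz => ?_
        rw [← mul_assoc]
        gcongr
        exact h2 z hz
    _ = C' * wInt (b + (n + 2) * p) fun z => ‖TOp (n + l) (wtd (M + l) g) z‖ₑ ^ p :=
        lintegral_const_mul' _ _ hC'
    _ ≤ C' * (C * wInt (b + M * p + (n + 2) * p) fun w => ‖g w‖ₑ ^ p) := by
        gcongr
        exact (wInt_TOp_le hp).trans (h1 _ hg.enorm)
    _ = C' * C * c⁻¹ * (c * wInt (b + M * p + (n + 2) * p) fun w => ‖g w‖ₑ ^ p) := by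
        rw [mul_assoc _ c⁻¹, ← mul_assoc c⁻¹, ENNReal.inv_mul_cancel hc hc', one_mul, mul_assoc]
    _ ≤ _ := by
        gcongr
        exact le_add_self

/-- The contribution of the data living far from the boundary. -/
lemma exists_low (hn : 3 ≤ n) (hp : 1 ≤ p) (hl : n + 1 ≤ l) (hM : n + 1 ≤ M) (hb : -1 < b)
    (h4 : n + (b + M * p + (n + 2) * p) < M + l) {j : Fin n} (hj : j ≠ 0) :
    ∃ A : ℝ≥0∞, A ≠ ⊤ ∧ ∀ t ε ρ : ℝ, 0 < t → 0 < ε → 0 < ρ → ∀ c K : ℝ≥0∞, c ≠ 0 → c ≠ ⊤ →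
      RegBound j p b t M l c K → ∀ g : (Fin n → ℂ) → ℂ, Measurable g →
      dataInt n p b M c g ≠ ⊤ →
      ∫⁻ z in tube n, (shell n (ε * ρ)).indicator (fun z => regW j (b + p) t z *
        ‖TOp (n + l + 1) (wtd (M + l) ((superlevel n ρ).indicator g)) z‖ₑ ^ p) z ≤
      (A * ENNReal.ofReal ε ^ p * K) * (ENNReal.ofReal ρ ^ p *
        (wInt (b + M * p - p) ((superlevel n ρ).indicator fun w => ‖g w‖ₑ ^ p) +
          c * wInt (b + M * p + (n + 2) * p - p)
            ((superlevel n ρ).indicator fun w => ‖g w‖ₑ ^ p))) := by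
  obtain ⟨a, C, hC, hfac⟩ := exists_factor (n := n) hn hp hl hM hb h4
  have hp0 : 0 < p := by linarith
  have e0 : b + M * p - p + (n + 2) * p = b + M * p + (n + 2) * p - p := by ring
  refine ⟨2 ^ p * ‖a‖ₑ ^ p * C, ENNReal.mul_ne_top (ENNReal.mul_ne_top
    (ENNReal.rpow_ne_top_of_nonneg hp0.le (by simp))
    (ENNReal.rpow_ne_top_of_nonneg hp0.le enorm_ne_top)) hC,
    fun t ε ρ ht hε hρ c K hc hc' hK g hg hfin => ?_⟩
  obtain ⟨hf1, hf2⟩ := wInt_ne_top_of_dataInt hc hfin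
  have hx1 := wInt_superlevel_ne_top hp0.le hρ hf1
  have hx2 := wInt_superlevel_ne_top hp0.le hρ hf2
  obtain ⟨h, hh, heq, hh1, hh2⟩ := hfac ((superlevel n ρ).indicator g)
    (hg.indicator (measurableSet_superlevel ρ)) (by rw [enorm_indicator_rpow hp0, e0]; exact hx2)
  rw [enorm_indicator_rpow hp0] at hh1 hh2
  rw [e0] at hh2
  set x₁ := wInt (b + M * p - p) ((superlevel n ρ).indicator fun w => ‖g w‖ₑ ^ p)
  set x₂ := wInt (b + M * p + (n + 2) * p - p) ((superlevel n ρ).indicator fun w => ‖g w‖ₑ ^ p)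
  have hd : dataInt n p b M c h ≤ C * (x₁ + c * x₂) := by
    calc _ ≤ C * x₁ + c * (C * x₂) := by unfold dataInt; gcongr
      _ = _ := by ring
  have hdfin : dataInt n p b M c h ≠ ⊤ := ne_top_of_le_ne_top
    (ENNReal.mul_ne_top hC (ENNReal.add_ne_top.2 ⟨hx1, ENNReal.mul_ne_top hc' hx2⟩)) hd
  have hB : (2 * ENNReal.ofReal ε * ENNReal.ofReal ρ) ^ p * ‖a‖ₑ ^ p ≠ ⊤ :=
    ENNReal.mul_ne_top (ENNReal.rpow_ne_top_of_nonneg hp0.le (by finiteness))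
      (ENNReal.rpow_ne_top_of_nonneg hp0.le enorm_ne_top)
  calc _ ≤ ∫⁻ z in tube n, ((2 * ENNReal.ofReal ε * ENNReal.ofReal ρ) ^ p * ‖a‖ₑ ^ p) *
        (regW j b t z * ‖TOp (n + l) (wtd (M + l) h) z‖ₑ ^ p) := by
        refine setLIntegral_mono' measurableSet_tube fun z hz => ?_
        by_cases hs : z ∈ shell n (ε * ρ)
        · rw [indicator_of_mem hs, heq hz]
          have h5 : dl z ≤ 2 * ENNReal.ofReal ε * ENNReal.ofReal ρ := by
            rw [show (2 : ℝ≥0∞) = ENNReal.ofReal 2 by simp, ← ENNReal.ofReal_mul (by positivity),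
              ← ENNReal.ofReal_mul (by positivity)]
            exact ENNReal.ofReal_le_ofReal (hs.2.trans_eq (by ring))
          simp only [enorm_mul, ENNReal.mul_rpow_of_nonneg _ _ hp0.le]
          simp only [← ENNReal.mul_rpow_of_nonneg _ _ hp0.le]
          calc _ ≤ dl z ^ p * regW j b t z * (‖a‖ₑ * ‖TOp (n + l) (wtd (M + l) h) z‖ₑ) ^ p := by
                gcongr
                exact regW_add_le hj ht hp0.le hz
            _ ≤ (2 * ENNReal.ofReal ε * ENNReal.ofReal ρ) ^ p * regW j b t z *
                  (‖a‖ₑ * ‖TOp (n + l) (wtd (M + l) h) z‖ₑ) ^ p := by gcongr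
            _ = _ := by simp only [ENNReal.mul_rpow_of_nonneg _ _ hp0.le]; ring
        · rw [indicator_of_notMem hs]; exact zero_le
    _ = ((2 * ENNReal.ofReal ε * ENNReal.ofReal ρ) ^ p * ‖a‖ₑ ^ p) *
        ∫⁻ z in tube n, regW j b t z * ‖TOp (n + l) (wtd (M + l) h) z‖ₑ ^ p :=
        lintegral_const_mul' _ _ hB
    _ ≤ ((2 * ENNReal.ofReal ε * ENNReal.ofReal ρ) ^ p * ‖a‖ₑ ^ p) *
        (K * (C * (x₁ + c * x₂))) := by
        gcongr
        exact (hK h hh hdfin).trans (by gcongr)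
    _ = _ := by simp only [ENNReal.mul_rpow_of_nonneg _ _ hp0.le]; ring

/-- The contribution of the data living close to the boundary. -/
lemma exists_high (hp : 1 ≤ p) (hl : n + 1 ≤ l) (hb : -1 < b)
    (h4 : n + (b + M * p + (n + 2) * p) < M + l) {j : Fin n} (hj : j ≠ 0) :
    ∃ A : ℝ≥0∞, A ≠ ⊤ ∧ ∀ t ε ρ : ℝ, 0 < t → 0 < ε → 0 < ρ →
      ∀ g : (Fin n → ℂ) → ℂ, Measurable g →
      ∫⁻ z in tube n, (shell n (ε * ρ)).indicator (fun z => regW j (b + p) t z *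
        ‖TOp (n + l + 1) (wtd (M + l) ((superlevel n ρ)ᶜ.indicator g)) z‖ₑ ^ p) z ≤
      (A * ENNReal.ofReal ε ^ (-((n + 2) * p))) * (ENNReal.ofReal ρ ^ (-((n + 2) * p)) *
        wInt (b + M * p + (n + 2) * p) ((superlevel n ρ)ᶜ.indicator fun w => ‖g w‖ₑ ^ p)) := by
  obtain ⟨C, hC, h1⟩ := exists_TOp_one (n := n) hp hl hb h4
  have hp0 : 0 < p := by linarith
  refine ⟨C, hC, fun t ε ρ ht hε hρ g hg => ?_⟩
  have hερ : ENNReal.ofReal (ε * ρ) ≠ 0 := by simp; positivity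
  have hB : ENNReal.ofReal (ε * ρ) ^ (-((n + 2) * p)) ≠ ⊤ :=
    ENNReal.rpow_ne_top_of_ne_zero hερ ENNReal.ofReal_ne_top
  calc _ ≤ ∫⁻ z in tube n, ENNReal.ofReal (ε * ρ) ^ (-((n + 2) * p)) *
        (dl z ^ (b + p + (n + 2) * p) *
          ‖TOp (n + l + 1) (wtd (M + l) ((superlevel n ρ)ᶜ.indicator g)) z‖ₑ ^ p) := by
        refine setLIntegral_mono' measurableSet_tube fun z hz => ?_
        by_cases hs : z ∈ shell n (ε * ρ)
        · rw [indicator_of_mem hs, ← mul_assoc]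
          gcongr
          have h5 : ENNReal.ofReal (ε * ρ) ≤ dl z := ENNReal.ofReal_le_ofReal hs.1.le
          calc _ ≤ dl z ^ (b + p) := regW_le_of_nonneg hj ht (by linarith) z
            _ = dl z ^ (-((n + 2) * p)) * dl z ^ (b + p + (n + 2) * p) := by
                rw [← dl_rpow_add hz]; congr 1; ring
            _ ≤ _ := by
                gcongr ?_ * _
                rw [ENNReal.rpow_neg, ENNReal.rpow_neg]
                gcongr
        · rw [indicator_of_notMem hs]; exact zero_le
    _ = ENNReal.ofReal (ε * ρ) ^ (-((n + 2) * p)) * wInt (b + p + (n + 2) * p) fun z =>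
          ‖TOp (n + l + 1) (wtd (M + l) ((superlevel n ρ)ᶜ.indicator g)) z‖ₑ ^ p :=
        lintegral_const_mul' _ _ hB
    _ ≤ ENNReal.ofReal (ε * ρ) ^ (-((n + 2) * p)) * (C * wInt (b + M * p + (n + 2) * p)
          ((superlevel n ρ)ᶜ.indicator fun w => ‖g w‖ₑ ^ p)) := by
        rw [← enorm_indicator_rpow hp0]
        gcongr
        exact h1 _ (hg.indicator (measurableSet_superlevel ρ).compl)
    _ = _ := by
        rw [ENNReal.ofReal_mul hε.le, ENNReal.mul_rpow_of_ne_top ENNReal.ofReal_ne_top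
          ENNReal.ofReal_ne_top]
        ring

end bootstrap

section bootstrap
variable {n : ℕ} [NeZero n] {p b : ℝ} {M l : ℕ}

/-- The decomposition of the regularized norm over shells. -/
lemma exists_lintegral_TOp_one (hn : 3 ≤ n) (hp : 1 ≤ p) (hl : n + 1 ≤ l) (hM : n + 1 ≤ M)
    (hb : -1 < b) (h4 : n + (b + M * p + (n + 2) * p) < M + l) {j : Fin n} (hj : j ≠ 0) :
    ∃ A : ℝ≥0∞, A ≠ ⊤ ∧ ∀ t ε : ℝ, 0 < t → 0 < ε → ∀ c K : ℝ≥0∞, c ≠ 0 → c ≠ ⊤ → K ≠ ⊤ →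
      RegBound j p b t M l c K → ∀ g : (Fin n → ℂ) → ℂ, Measurable g →
      dataInt n p b M c g ≠ ⊤ →
      ∫⁻ z in tube n, regW j (b + p) t z * ‖TOp (n + l + 1) (wtd (M + l) g) z‖ₑ ^ p ≤
        (A * ENNReal.ofReal ε ^ p * K + A * ENNReal.ofReal ε ^ (-((n + 2) * p))) *
          dataInt n p b M c g := by
  obtain ⟨A₁, hA₁, hlow⟩ := exists_low (n := n) hn hp hl hM hb h4 hj
  obtain ⟨A₂, hA₂, hhigh⟩ := exists_high (n := n) hp hl hb h4 hj
  have hp0 : 0 < p := by linarith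
  have hL : 0 < ((n : ℝ) + 2) * p := by positivity
  set L := ((n : ℝ) + 2) * p with hLdef
  set B : ℝ≥0∞ := 2 * 2 ^ (p - 1) with hBdef
  have h2 : (2 : ℝ≥0∞) ^ (p - 1) ≠ ⊤ := ENNReal.rpow_ne_top_of_nonneg (by linarith) (by simp)
  have hB : B ≠ ⊤ := ENNReal.mul_ne_top (by simp) h2
  refine ⟨B * A₁ + B * A₂ * ENNReal.ofReal (1 / L), ENNReal.add_ne_top.2
    ⟨ENNReal.mul_ne_top hB hA₁, ENNReal.mul_ne_top (ENNReal.mul_ne_top hB hA₂) (by simp)⟩,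
    fun t ε ht hε c K hc hc' hK' hK g hg hfin => ?_⟩
  obtain ⟨-, hf2⟩ := wInt_ne_top_of_dataInt hc hfin
  have hgp : Measurable fun w => ‖g w‖ₑ ^ p := hg.enorm.pow_const p
  have hTm : ∀ f : (Fin n → ℂ) → ℂ, Measurable f → Measurable fun z =>
      regW j (b + p) t z * ‖TOp (n + l + 1) (wtd (M + l) f) z‖ₑ ^ p := fun f hf =>
    (measurable_regW j _ t).mul ((measurable_TOp (measurable_wtd _ hf)).enorm.pow_const p)
  have hconv : ∀ S : Set (Fin n → ℂ), MeasurableSet S → ∀ z ∈ tube n,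
      TConv (n + l + 1) (wtd (M + l) (S.indicator g)) z := fun S hS z hz =>
    TConv.succ (measurable_wtd _ (hg.indicator hS)) hz ((memA_TOp hp hl hb h4 (hg.indicator hS)
      (by rw [enorm_indicator_rpow hp0]
          exact ne_top_of_le_ne_top hf2 (wInt_indicator_le _ _))).1 z hz)
  set B₁ := B * (A₁ * ENNReal.ofReal ε ^ p * K) with hB₁
  set B₂ := B * (A₂ * ENNReal.ofReal ε ^ (-L)) with hB₂
  set w₁ : ℝ → ℝ≥0∞ := fun ρ =>
    wInt (b + M * p - p) ((superlevel n ρ).indicator fun w => ‖g w‖ₑ ^ p)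
  set w₂ : ℝ → ℝ≥0∞ := fun ρ =>
    wInt (b + M * p + L - p) ((superlevel n ρ).indicator fun w => ‖g w‖ₑ ^ p)
  set w₃ : ℝ → ℝ≥0∞ := fun ρ =>
    wInt (b + M * p + L) ((superlevel n ρ)ᶜ.indicator fun w => ‖g w‖ₑ ^ p)
  have hw₁ : Measurable w₁ := measurable_wInt_param (measurable_superlevel_pair hgp)
  have hw₂ : Measurable w₂ := measurable_wInt_param (measurable_superlevel_pair hgp)
  have hw₃ : Measurable w₃ := measurable_wInt_param (measurable_superlevel_compl_pair hgp)
  have hshell : ∀ ρ : ℝ, 0 < ρ → ∫⁻ z in tube n, (shell n (ε * ρ)).indicator (fun z =>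
      regW j (b + p) t z * ‖TOp (n + l + 1) (wtd (M + l) g) z‖ₑ ^ p) z ≤
      2 ^ (p - 1) * ((A₁ * ENNReal.ofReal ε ^ p * K) * (ENNReal.ofReal ρ ^ p *
        (w₁ ρ + c * w₂ ρ)) + (A₂ * ENNReal.ofReal ε ^ (-L)) *
          (ENNReal.ofReal ρ ^ (-L) * w₃ ρ)) := by
    intro ρ hρ
    have hS := measurableSet_superlevel (n := n) ρ
    refine le_trans ?_ (mul_le_mul_right (add_le_add
      (hlow t ε ρ ht hε hρ c K hc hc' hK g hg hfin) (hhigh t ε ρ ht hε hρ g hg)) _)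
    rw [← lintegral_add_left ((hTm _ (hg.indicator hS)).indicator (measurableSet_shell _)),
      ← lintegral_const_mul' _ _ h2]
    refine setLIntegral_mono' measurableSet_tube fun z hz => ?_
    by_cases hs : z ∈ shell n (ε * ρ)
    · simp only [indicator_of_mem hs]
      rw [TOp_indicator_add_compl (hconv _ hS z hz) (hconv _ hS.compl z hz), ← mul_add,
        mul_left_comm]
      gcongr
      exact enorm_add_rpow_le hp _ _
    · simp only [indicator_of_notMem hs]; exact zero_le
  have hcoef : ∀ ρ ∈ Ioi (0 : ℝ), 2 * ((ENNReal.ofReal ρ)⁻¹ * (2 ^ (p - 1) *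
      ((A₁ * ENNReal.ofReal ε ^ p * K) * (ENNReal.ofReal ρ ^ p * (w₁ ρ + c * w₂ ρ)) +
        (A₂ * ENNReal.ofReal ε ^ (-L)) * (ENNReal.ofReal ρ ^ (-L) * w₃ ρ)))) =
      B₁ * (ENNReal.ofReal ρ ^ (p - 1) * w₁ ρ) + B₁ * c * (ENNReal.ofReal ρ ^ (p - 1) * w₂ ρ) +
        B₂ * (ENNReal.ofReal ρ ^ (-L - 1) * w₃ ρ) := by
    intro ρ hρ
    have h0 : ENNReal.ofReal ρ ≠ 0 := by simpa using hρ
    have e : ∀ x : ℝ, ENNReal.ofReal ρ ^ (x - 1) = (ENNReal.ofReal ρ)⁻¹ * ENNReal.ofReal ρ ^ x :=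
      fun x => by
        rw [sub_eq_neg_add, ENNReal.rpow_add _ _ h0 ENNReal.ofReal_ne_top, ENNReal.rpow_neg_one]
    rw [e, e, hB₁, hB₂, hBdef]
    ring
  calc _ ≤ 2 * ∫⁻ ρ in Ioi (0 : ℝ), (ENNReal.ofReal ρ)⁻¹ * ∫⁻ z in tube n,
        (shell n (ε * ρ)).indicator (fun z => regW j (b + p) t z *
          ‖TOp (n + l + 1) (wtd (M + l) g) z‖ₑ ^ p) z := lintegral_le_shell hε (hTm g hg)
    _ = ∫⁻ ρ in Ioi (0 : ℝ), 2 * ((ENNReal.ofReal ρ)⁻¹ * ∫⁻ z in tube n,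
        (shell n (ε * ρ)).indicator (fun z => regW j (b + p) t z *
          ‖TOp (n + l + 1) (wtd (M + l) g) z‖ₑ ^ p) z) :=
        (lintegral_const_mul' _ _ (by simp)).symm
    _ ≤ ∫⁻ ρ in Ioi (0 : ℝ), (B₁ * (ENNReal.ofReal ρ ^ (p - 1) * w₁ ρ) +
          B₁ * c * (ENNReal.ofReal ρ ^ (p - 1) * w₂ ρ) +
          B₂ * (ENNReal.ofReal ρ ^ (-L - 1) * w₃ ρ)) := by
        refine setLIntegral_mono' measurableSet_Ioi fun ρ hρ => ?_
        rw [← hcoef ρ hρ]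
        gcongr
        exact hshell ρ hρ
    _ = B₁ * (∫⁻ ρ in Ioi (0 : ℝ), ENNReal.ofReal ρ ^ (p - 1) * w₁ ρ) +
          B₁ * c * (∫⁻ ρ in Ioi (0 : ℝ), ENNReal.ofReal ρ ^ (p - 1) * w₂ ρ) +
          B₂ * ∫⁻ ρ in Ioi (0 : ℝ), ENNReal.ofReal ρ ^ (-L - 1) * w₃ ρ := by
        rw [lintegral_add_left (by fun_prop), lintegral_add_left (by fun_prop),
          lintegral_const_mul _ (by fun_prop), lintegral_const_mul _ (by fun_prop),
          lintegral_const_mul _ (by fun_prop)]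
    _ ≤ B₁ * (wInt (b + M * p) fun w => ‖g w‖ₑ ^ p) +
          B₁ * c * (wInt (b + M * p + L) fun w => ‖g w‖ₑ ^ p) +
          B₂ * (ENNReal.ofReal (1 / L) * wInt (b + M * p) fun w => ‖g w‖ₑ ^ p) := by
        gcongr
        · exact lintegral_superlevel_le hp hgp
        · exact lintegral_superlevel_le hp hgp
        · exact lintegral_superlevel_compl_le hL hgp
    _ ≤ B₁ * dataInt n p b M c g + B₂ * ENNReal.ofReal (1 / L) * dataInt n p b M c g := by
        rw [mul_assoc B₁ c, ← mul_add, ← mul_assoc B₂]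
        gcongr
        · exact le_rfl
        · exact le_self_add
    _ ≤ _ := by
        rw [← add_mul, hB₁, hB₂]
        gcongr ?_ * _
        refine add_le_add ?_ ?_
        · calc _ = B * A₁ * ENNReal.ofReal ε ^ p * K := by ring
            _ ≤ _ := by gcongr; exact le_self_add
        · calc _ = B * A₂ * ENNReal.ofReal (1 / L) * ENNReal.ofReal ε ^ (-L) := by ring
            _ ≤ _ := by gcongr; exact le_add_self

/-- The improvement of the regularized estimate by means of the Hardy inequality. -/
lemma exists_regBound_improve (hn : 3 ≤ n) (hp : 1 ≤ p) (hl : n + 1 ≤ l) (hM : n + 1 ≤ M)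
    (hb : -1 < b) (h4 : n + (b + M * p + (n + 2) * p) < M + l) {j : Fin n} (hj : j ≠ 0)
    (hH : hardy n p (b + n / 2)) :
    ∃ D : ℝ≥0∞, D ≠ ⊤ ∧ ∀ t : ℝ, 0 < t → ∀ c K : ℝ≥0∞, c ≠ 0 → c ≠ ⊤ → K ≠ ⊤ →
      RegBound j p b t M l c K → RegBound j p b t M l c (2⁻¹ * K + D) := by
  obtain ⟨A, hA, h1⟩ := exists_lintegral_TOp_one (n := n) hn hp hl hM hb h4 hj
  obtain ⟨C, hC, hC1⟩ := hardy_regW (n := n) hj (ν := b + n / 2) (by linarith) hp hH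
  simp only [add_sub_cancel_right] at hC1
  have hp0 : 0 < p := by linarith
  set c₀ : ℂ := -(4 * ((n + l : ℕ) : ℂ) * (((n + l : ℕ) : ℂ) + 1 - n / 2)) with hc₀
  have hc₀' : ‖c₀‖ₑ ^ p ≠ ⊤ := ENNReal.rpow_ne_top_of_nonneg hp0.le enorm_ne_top
  set A' := C * ‖c₀‖ₑ ^ p * A with hA'
  have hA'fin : A' ≠ ⊤ := ENNReal.mul_ne_top (ENNReal.mul_ne_top hC hc₀') hA
  obtain ⟨ε, hε, hε1, hεA⟩ : ∃ ε : ℝ, 0 < ε ∧ ε ≤ 1 ∧ A' * ENNReal.ofReal ε ≤ 2⁻¹ := by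
    have hx : (0 : ℝ) ≤ A'.toReal := ENNReal.toReal_nonneg
    refine ⟨(2 * (A'.toReal + 1))⁻¹, by positivity, inv_le_one_of_one_le₀ (by linarith), ?_⟩
    rw [← ENNReal.ofReal_toReal hA'fin, ← ENNReal.ofReal_mul hx,
      show (2 : ℝ≥0∞)⁻¹ = ENNReal.ofReal 2⁻¹ by
        rw [ENNReal.ofReal_inv_of_pos (by norm_num)]; simp]
    refine ENNReal.ofReal_le_ofReal ?_
    rw [ENNReal.toReal_ofReal hx, mul_inv, ← div_eq_mul_inv]
    rw [← mul_comm_div, div_mul_eq_mul_div, div_le_iff₀ (by positivity)]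
    linarith
  have hεp : ENNReal.ofReal ε ^ p ≤ ENNReal.ofReal ε := by
    simpa using ENNReal.rpow_le_rpow_of_exponent_ge (ENNReal.ofReal_le_one.2 hε1) hp
  refine ⟨A' * ENNReal.ofReal ε ^ (-((n + 2) * p)), ENNReal.mul_ne_top hA'fin
    (ENNReal.rpow_ne_top_of_ne_zero (by simpa using hε) ENNReal.ofReal_ne_top),
    fun t ht c K hc hc' hK' hK g hg hfin => ?_⟩
  obtain ⟨-, hf2⟩ := wInt_ne_top_of_dataInt hc hfin
  obtain ⟨hT, hmem⟩ := memA_TOp hp hl hb h4 hg hf2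
  calc _ ≤ C * ∫⁻ z in tube n, regW j (b + p) t z * ‖BoxOp (TOp (n + l) (wtd (M + l) g)) z‖ₑ ^ p :=
        hC1 t ht _ (by positivity) _ hmem
    _ = C * ∫⁻ z in tube n, ‖c₀‖ₑ ^ p * (regW j (b + p) t z *
          ‖TOp (n + l + 1) (wtd (M + l) g) z‖ₑ ^ p) := by
        congr 1
        refine setLIntegral_congr_fun measurableSet_tube fun z hz => ?_
        rw [BoxOp_TOp (measurable_wtd _ hg) hz (hT z hz), enorm_mul,
          ENNReal.mul_rpow_of_nonneg _ _ hp0.le, ← hc₀]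
        ring
    _ = C * ‖c₀‖ₑ ^ p * ∫⁻ z in tube n, regW j (b + p) t z *
          ‖TOp (n + l + 1) (wtd (M + l) g) z‖ₑ ^ p := by
        rw [lintegral_const_mul' _ _ hc₀', mul_assoc]
    _ ≤ C * ‖c₀‖ₑ ^ p * ((A * ENNReal.ofReal ε ^ p * K +
          A * ENNReal.ofReal ε ^ (-((n + 2) * p))) * dataInt n p b M c g) := by
        gcongr
        exact h1 t ε ht hε c K hc hc' hK' hK g hg hfin
    _ = (A' * ENNReal.ofReal ε ^ p * K + A' * ENNReal.ofReal ε ^ (-((n + 2) * p))) *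
          dataInt n p b M c g := by rw [hA']; ring
    _ ≤ _ := by
        gcongr
        exact (mul_le_mul_right hεp A').trans hεA

/-- Boundedness of the first operator of the family without loss of weight. -/
theorem exists_TOp_bounded (hn : 3 ≤ n) (hp : 1 ≤ p) (hl : n + 1 ≤ l) (hM : n + 1 ≤ M)
    (hb : -1 < b) (h4 : n + (b + M * p + (n + 2) * p) < M + l)
    (hH : hardy n p (b + n / 2)) :
    ∃ D : ℝ≥0∞, D ≠ ⊤ ∧ ∀ g : (Fin n → ℂ) → ℂ, Measurable g →
      wInt (b + M * p) (fun w => ‖g w‖ₑ ^ p) ≠ ⊤ →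
      wInt (b + M * p + (n + 2) * p) (fun w => ‖g w‖ₑ ^ p) ≠ ⊤ →
      wInt b (fun z => ‖TOp (n + l) (wtd (M + l) g) z‖ₑ ^ p) ≤
        D * wInt (b + M * p) (fun w => ‖g w‖ₑ ^ p) := by
  obtain ⟨j, hj⟩ : ∃ j : Fin n, j ≠ 0 := ⟨⟨1, by omega⟩, by simp [Fin.ext_iff]⟩
  obtain ⟨D, hD, himp⟩ := exists_regBound_improve (n := n) hn hp hl hM hb h4 hj hH
  have hpow : Filter.Tendsto (fun i : ℕ => (2⁻¹ : ℝ≥0∞) ^ i) Filter.atTop (nhds 0) :=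
    ENNReal.tendsto_pow_atTop_nhds_zero_of_lt_one (by simp)
  have htwo : (2 : ℝ≥0∞)⁻¹ * (2 * D) = D := by
    rw [← mul_assoc, ENNReal.inv_mul_cancel (by simp) (by simp), one_mul]
  have hstable : ∀ t : ℝ, 0 < t → ∀ c : ℝ≥0∞, c ≠ 0 → c ≠ ⊤ → RegBound j p b t M l c (2 * D) := by
    intro t ht c hc hc' g hg hfin
    obtain ⟨K, hK, hreg⟩ := exists_regBound (n := n) hp hl hb h4 hj ht hc hc'
    have hiter : ∀ i : ℕ, RegBound j p b t M l c (K * 2⁻¹ ^ i + 2 * D) := by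
      intro i
      induction i with
      | zero => exact hreg.mono (by simp)
      | succ i ih =>
        refine (himp t ht c _ hc hc' (by finiteness) ih).mono (le_of_eq ?_)
        rw [mul_add, htwo, pow_succ]
        ring
    have hlim : Filter.Tendsto (fun i : ℕ => (K * 2⁻¹ ^ i + 2 * D) * dataInt n p b M c g)
        Filter.atTop (nhds ((K * 0 + 2 * D) * dataInt n p b M c g)) :=
      ENNReal.Tendsto.mul_const ((ENNReal.Tendsto.const_mul hpow (Or.inr hK)).add_const _)
        (Or.inr hfin)
    rw [mul_zero, zero_add] at hlim
    exact ge_of_tendsto' hlim fun i => hiter i g hg hfin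
  refine ⟨2 * D, by finiteness, fun g hg h1 h2 => wInt_le_of_regW j
    ((measurable_TOp (measurable_wtd _ hg)).enorm.pow_const p) fun t ht => ?_⟩
  have hlim : Filter.Tendsto (fun i : ℕ => 2 * D * dataInt n p b M (2⁻¹ ^ i) g)
      Filter.atTop (nhds (2 * D * (wInt (b + M * p) (fun w => ‖g w‖ₑ ^ p) +
        0 * wInt (b + M * p + (n + 2) * p) fun w => ‖g w‖ₑ ^ p))) :=
    ENNReal.Tendsto.const_mul ((ENNReal.Tendsto.mul_const hpow (Or.inr h2)).const_add _)
      (Or.inr (by finiteness))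
  rw [zero_mul, add_zero] at hlim
  refine ge_of_tendsto' hlim fun i => hstable t ht (2⁻¹ ^ i) (by simp) (by finiteness) g hg ?_
  exact ENNReal.add_ne_top.2 ⟨h1, ENNReal.mul_ne_top (by finiteness) h2⟩

end bootstrap

/-! ### Solving the wave equation in Bergman spaces -/

section solve
variable {n : ℕ} [NeZero n] {p b : ℝ} {M l : ℕ}

lemma lintegral_le_of_tendsto {α : Type*} [MeasurableSpace α] {μ : Measure α} {S : Set α}
    (hS : MeasurableSet S) {f : ℕ → α → ℝ≥0∞} {F : α → ℝ≥0∞} {A : ℝ≥0∞}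
    (hf : ∀ i, Measurable (f i))
    (hlim : ∀ w ∈ S, Filter.Tendsto (fun i => f i w) Filter.atTop (nhds (F w)))
    (hA : ∀ i, ∫⁻ w in S, f i w ∂μ ≤ A) : ∫⁻ w in S, F w ∂μ ≤ A :=
  calc _ = ∫⁻ w in S, Filter.liminf (fun i => f i w) Filter.atTop ∂μ :=
        setLIntegral_congr_fun hS fun w hw => (hlim w hw).liminf_eq.symm
    _ ≤ Filter.liminf (fun i => ∫⁻ w in S, f i w ∂μ) Filter.atTop :=
        lintegral_liminf_le (f := f) hf
    _ ≤ A := Filter.liminf_le_of_frequently_le' (Filter.Frequently.of_forall hA)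

lemma eventually_superlevel_compl_indicator {β : Type*} [Zero β] (g : (Fin n → ℂ) → β)
    (w : Fin n → ℂ) :
    ∀ᶠ i : ℕ in Filter.atTop, (superlevel n (i : ℝ))ᶜ.indicator g w = g w := by
  obtain ⟨i₀, hi₀⟩ := exists_nat_ge (lor (imP w))
  filter_upwards [Filter.eventually_ge_atTop i₀] with i hi
  have hi' : (i₀ : ℝ) ≤ i := by exact_mod_cast hi
  exact indicator_of_mem (show w ∈ (superlevel n (i : ℝ))ᶜ from not_lt.2 (hi₀.trans hi')) g

lemma wInt_superlevel_compl_ne_top {γ L ρ : ℝ} (hL : 0 ≤ L) {f : (Fin n → ℂ) → ℝ≥0∞}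
    (h : wInt γ f ≠ ⊤) : wInt (γ + L) ((superlevel n ρ)ᶜ.indicator f) ≠ ⊤ := by
  have hρ : ENNReal.ofReal ρ ^ L ≠ ⊤ := ENNReal.rpow_ne_top_of_nonneg hL ENNReal.ofReal_ne_top
  refine ne_top_of_le_ne_top (ENNReal.mul_ne_top hρ h) ?_
  rw [← wInt_dl_mul, ← wInt_const_mul hρ]
  refine wInt_mono fun w hw => ?_
  by_cases h1 : w ∈ (superlevel n ρ)ᶜ
  · rw [indicator_of_mem h1]
    gcongr
    exact ENNReal.ofReal_le_ofReal (not_lt.1 h1)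
  · rw [indicator_of_notMem h1]; simp

/-- Pointwise bound for the absolute values of the integrand, by adjusting phases. -/
lemma exists_SOp_bound (hn : 3 ≤ n) (hp : 1 ≤ p) (hl : n + 1 ≤ l) (hM : n + 1 ≤ M)
    (hb : -1 < b) (h4 : n + (b + M * p + (n + 2) * p) < M + l)
    (hH : hardy n p (b + n / 2)) {z : Fin n → ℂ} (hz : z ∈ tube n) :
    ∃ C : ℝ≥0∞, C ≠ ⊤ ∧ ∀ g : (Fin n → ℂ) → ℂ, Measurable g →
      wInt (b + M * p) (fun w => ‖g w‖ₑ ^ p) ≠ ⊤ →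
      wInt (b + M * p + (n + 2) * p) (fun w => ‖g w‖ₑ ^ p) ≠ ⊤ →
      SOp (n + l : ℕ) (M + l : ℕ) (fun w => ‖g w‖ₑ) z ^ p ≤
        C * wInt (b + M * p) (fun w => ‖g w‖ₑ ^ p) := by
  obtain ⟨D, hD, hbd⟩ := exists_TOp_bounded (n := n) hn hp hl hM hb h4 hH
  obtain ⟨C, hC, hpt⟩ := exists_pointwise (n := n) (κ := b + n / 2) hp (by linarith) hz
  have hp0 : 0 < p := by linarith
  refine ⟨C * D, ENNReal.mul_ne_top hC hD, fun g hg h1 h2 => ?_⟩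
  set q : (Fin n → ℂ) → ℂ := fun w => (lorC (zeta z w) ^ (n + l))⁻¹ * wtd (M + l) g w with hq
  set θ : (Fin n → ℂ) → ℂ := fun w => starRingEnd ℂ (q w) / ‖q w‖ with hθ
  have hqm : Measurable q := (measurable_lorC_zeta z _).mul (measurable_wtd _ hg)
  have hθm : Measurable θ := (continuous_conj.measurable.comp hqm).div
    (continuous_ofReal.measurable.comp hqm.norm)
  have hθ1 : ∀ w, ‖θ w‖ ≤ 1 := fun w => by
    simp only [hθ, norm_div, RCLike.norm_conj, norm_real, norm_norm]
    exact div_self_le_one _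
  have hθq : ∀ w, θ w * q w = (‖q w‖ : ℂ) := fun w => by
    rcases eq_or_ne (q w) 0 with h0 | h0
    · simp [h0]
    · have h5 : (‖q w‖ : ℂ) ≠ 0 := by simpa using h0
      simp only [hθ]
      rw [div_mul_eq_mul_div, mul_comm, mul_conj, normSq_eq_norm_sq, div_eq_iff h5]
      push_cast; ring
  have hle : ∀ w, ‖θ w * g w‖ₑ ^ p ≤ ‖g w‖ₑ ^ p := fun w => by
    refine ENNReal.rpow_le_rpow ?_ hp0.le
    rw [enorm_mul]
    refine mul_le_of_le_one_left zero_le ?_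
    rw [← ofReal_norm]
    exact ENNReal.ofReal_le_one.2 (hθ1 w)
  have hhm : Measurable fun w => θ w * g w := hθm.mul hg
  have hh : ∀ γ, wInt γ (fun w => ‖θ w * g w‖ₑ ^ p) ≤ wInt γ fun w => ‖g w‖ₑ ^ p := fun γ =>
    wInt_mono fun w _ => hle w
  have hh1 := ne_top_of_le_ne_top h1 (hh _)
  have hh2 := ne_top_of_le_ne_top h2 (hh _)
  have hbound := hbd _ hhm hh1 hh2
  have hmem : memA n p (b + n / 2) (TOp (n + l) (wtd (M + l) fun w => θ w * g w)) := by
    refine ⟨(memA_TOp hp hl hb h4 hhm hh2).2.1, ?_⟩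
    rw [lpInt_eq hp0.le, add_sub_cancel_right]
    exact lt_of_le_of_lt hbound (ENNReal.mul_lt_top hD.lt_top hh1.lt_top)
  have hint : IntegrableOn q (tube n) := (memA_TOp hp hl hb h4 hg h2).1 z hz
  have hval : ‖TOp (n + l) (wtd (M + l) fun w => θ w * g w) z‖ₑ =
      SOp (n + l : ℕ) (M + l : ℕ) (fun w => ‖g w‖ₑ) z := by
    have e : TOp (n + l) (wtd (M + l) fun w => θ w * g w) z =
        ((∫ w in tube n, ‖q w‖ : ℝ) : ℂ) := by
      rw [← integral_complex_ofReal]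
      refine integral_congr_ae (Filter.Eventually.of_forall fun w => ?_)
      refine Eq.trans ?_ (hθq w)
      simp only [hq, wtd]; ring
    rw [e, ← ofReal_norm, norm_real, Real.norm_of_nonneg (integral_nonneg fun w => norm_nonneg _),
      ofReal_integral_norm_eq_lintegral_enorm hint, lintegral_enorm_TOp hz]
  calc _ ≤ C * lpInt n p (b + n / 2) (TOp (n + l) (wtd (M + l) fun w => θ w * g w)) := by
        rw [← hval]; exact hpt _ hmem
    _ ≤ C * (D * wInt (b + M * p) fun w => ‖g w‖ₑ ^ p) := by
        rw [lpInt_eq hp0.le, add_sub_cancel_right]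
        gcongr
        exact hbound.trans (by gcongr; exact hh _)
    _ = _ := (mul_assoc _ _ _).symm

/-- The first operator of the family on the whole weighted space. -/
lemma exists_TOp_bounded' (hn : 3 ≤ n) (hp : 1 ≤ p) (hl : n + 1 ≤ l) (hM : n + 1 ≤ M)
    (hb : -1 < b) (h4 : n + (b + M * p + (n + 2) * p) < M + l)
    (hH : hardy n p (b + n / 2)) :
    ∃ D : ℝ≥0∞, D ≠ ⊤ ∧ ∀ g : (Fin n → ℂ) → ℂ, Measurable g →
      wInt (b + M * p) (fun w => ‖g w‖ₑ ^ p) ≠ ⊤ →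
      (∀ z ∈ tube n, TConv (n + l) (wtd (M + l) g) z) ∧
      wInt b (fun z => ‖TOp (n + l) (wtd (M + l) g) z‖ₑ ^ p) ≤
        D * wInt (b + M * p) (fun w => ‖g w‖ₑ ^ p) := by
  obtain ⟨D, hD, hbd⟩ := exists_TOp_bounded (n := n) hn hp hl hM hb h4 hH
  have hp0 : 0 < p := by linarith
  refine ⟨D, hD, fun g hg hfin => ?_⟩
  have hgi : ∀ i : ℕ, Measurable ((superlevel n (i : ℝ))ᶜ.indicator g) := fun i =>
    hg.indicator (measurableSet_superlevel _).compl
  have hi1 : ∀ i : ℕ, wInt (b + M * p) (fun w => ‖(superlevel n (i : ℝ))ᶜ.indicator g w‖ₑ ^ p) ≤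
      wInt (b + M * p) fun w => ‖g w‖ₑ ^ p := fun i => by
    rw [enorm_indicator_rpow hp0]; exact wInt_indicator_le _ _
  have hi1' := fun i => ne_top_of_le_ne_top hfin (hi1 i)
  have hi2 : ∀ i : ℕ, wInt (b + M * p + (n + 2) * p)
      (fun w => ‖(superlevel n (i : ℝ))ᶜ.indicator g w‖ₑ ^ p) ≠ ⊤ := fun i => by
    rw [enorm_indicator_rpow hp0]
    exact wInt_superlevel_compl_ne_top (by positivity) hfin
  have hT : ∀ z ∈ tube n, TConv (n + l) (wtd (M + l) g) z := by
    intro z hz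
    obtain ⟨C, hC, h1⟩ := exists_SOp_bound hn hp hl hM hb h4 hH hz
    refine tconv_wtd hg hz (ne_top_of_le_ne_top
      (b := (C * wInt (b + M * p) fun w => ‖g w‖ₑ ^ p) ^ p⁻¹)
      (ENNReal.rpow_ne_top_of_nonneg (by positivity) (ENNReal.mul_ne_top hC hfin)) ?_)
    refine lintegral_le_of_tendsto measurableSet_tube (f := fun (i : ℕ) w =>
      kk z w ^ (-((n + l : ℕ) : ℝ)) * dl w ^ ((M + l : ℕ) : ℝ) *
        ‖(superlevel n (i : ℝ))ᶜ.indicator g w‖ₑ) (fun i => ?_) (fun w _ => ?_) fun i => ?_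
    · have := (hgi i).enorm
      fun_prop
    · refine tendsto_const_nhds.congr' ?_
      filter_upwards [eventually_superlevel_compl_indicator g w] with i hi
      rw [hi]
    · refine (ENNReal.le_rpow_inv_iff hp0).2 ((h1 _ (hgi i) (hi1' i) (hi2 i)).trans ?_)
      gcongr
      exact hi1 i
  refine ⟨hT, lintegral_le_of_tendsto measurableSet_tube (f := fun (i : ℕ) z => dl z ^ b *
    ‖TOp (n + l) (wtd (M + l) ((superlevel n (i : ℝ))ᶜ.indicator g)) z‖ₑ ^ p)
    (fun i => ?_) (fun z hz => ?_) fun i =>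
      (hbd _ (hgi i) (hi1' i) (hi2 i)).trans (by gcongr; exact hi1 i)⟩
  · have := (measurable_TOp (s := n + l) (measurable_wtd (M + l) (hgi i))).enorm
    fun_prop
  · refine ENNReal.Tendsto.const_mul ?_ (Or.inr (dl_rpow_ne_top hz b))
    refine (ENNReal.continuous_rpow_const.tendsto _).comp
      ((continuous_enorm.tendsto _).comp ?_)
    refine tendsto_integral_of_dominated_convergence
      (fun w => ‖(lorC (zeta z w) ^ (n + l))⁻¹ * wtd (M + l) g w‖)
      (fun i => ((measurable_lorC_zeta z _).mul (measurable_wtd _ (hgi i))).aestronglyMeasurable)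
      (hT z hz).norm (fun i => ae_of_all _ fun w => ?_) (ae_of_all _ fun w => ?_)
    · by_cases h : w ∈ (superlevel n (i : ℝ))ᶜ
      · simp only [wtd, indicator_of_mem h]; exact le_rfl
      · simp only [wtd, indicator_of_notMem h, zero_mul, mul_zero, norm_zero]; exact norm_nonneg _
    · refine tendsto_const_nhds.congr' ?_
      filter_upwards [eventually_superlevel_compl_indicator g w] with i hi
      rw [wtd, wtd, hi]

lemma TOp_const_mul (s : ℕ) (c : ℂ) (f : (Fin n → ℂ) → ℂ) (z : Fin n → ℂ) :
    TOp s (fun w => c * f w) z = c * TOp s f z := by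
  rw [TOp, TOp, ← integral_const_mul]
  refine integral_congr_ae (ae_of_all _ fun w => ?_)
  simp only []; ring

lemma TConv.const_mul {s : ℕ} {f : (Fin n → ℂ) → ℂ} {z : Fin n → ℂ} (h : TConv s f z) (c : ℂ) :
    TConv s (fun w => c * f w) z := by
  refine (Integrable.const_mul h c).congr (ae_of_all _ fun w => ?_)
  simp only []; ring

lemma exists_BoxOp_iterate_TOp (m : ℕ) : ∀ s : ℕ, n ≤ s → ∃ c : ℂ, c ≠ 0 ∧
    ∀ f : (Fin n → ℂ) → ℂ, Measurable f → (∀ z ∈ tube n, TConv s f z) →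
      (∀ z ∈ tube n, TConv (s + m) f z) ∧
      EqOn (BoxOp^[m] (TOp s f)) (fun z => c * TOp (s + m) f z) (tube n) := by
  induction m with
  | zero => exact fun s _ => ⟨1, one_ne_zero, fun f _ h => ⟨h, fun z _ => by simp⟩⟩
  | succ m ih =>
    intro s hs
    obtain ⟨c, hc, h⟩ := ih (s + 1) (by omega)
    have hn0 : 0 < n := Nat.pos_of_ne_zero (NeZero.ne n)
    have hs0 : (s : ℂ) ≠ 0 := by exact_mod_cast (by omega : s ≠ 0)
    have hs1 : (s : ℂ) + 1 - n / 2 ≠ 0 := by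
      intro h0
      have h1 : ((2 * s + 2 : ℕ) : ℂ) = (n : ℕ) := by push_cast; linear_combination 2 * h0
      have h2 : 2 * s + 2 = n := by exact_mod_cast h1
      omega
    refine ⟨c * -(4 * s * (s + 1 - n / 2)), mul_ne_zero hc (neg_ne_zero.2
      (mul_ne_zero (mul_ne_zero (by norm_num) hs0) hs1)), fun f hf hT => ?_⟩
    have hT1 : ∀ z ∈ tube n, TConv (s + 1) f z := fun z hz => (hT z hz).succ hf hz
    obtain ⟨-, h2⟩ := h _ (hf.const_mul (-(4 * s * (s + 1 - n / 2))))
      fun z hz => (hT1 z hz).const_mul _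
    obtain ⟨h3, -⟩ := h f hf hT1
    have e : s + 1 + m = s + (m + 1) := by omega
    rw [e] at h2 h3
    refine ⟨h3, fun z hz => ?_⟩
    rw [Function.iterate_succ_apply, BoxOp_iterate_congr (G := TOp (s + 1)
      fun w => -(4 * s * (s + 1 - n / 2)) * f w) (fun w hw => ?_) m hz, h2 hz]
    · simp only [TOp_const_mul]; ring
    · rw [BoxOp_TOp hf hw (hT w hw), TOp_const_mul]

lemma lpInt_const_mul {ν : ℝ} (hp : 0 ≤ p) (c : ℂ) (F : (Fin n → ℂ) → ℂ) :
    lpInt n p ν (fun z => c * F z) = ‖c‖ₑ ^ p * lpInt n p ν F := by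
  rw [lpInt_eq hp, lpInt_eq hp,
    ← wInt_const_mul (ENNReal.rpow_ne_top_of_nonneg hp enorm_ne_top)]
  simp only [enorm_mul, ENNReal.mul_rpow_of_nonneg _ _ hp]

/-- Solvability of `□^M F = G` with bounds for large `M`. -/
theorem exists_solution {ν : ℝ} (hn : 3 ≤ n) (hp : 1 ≤ p) (hM : n + 1 ≤ M)
    (hν : (n : ℝ) / 2 - 1 < ν) (hH : hardy n p ν) :
    ∃ D : ℝ≥0∞, D ≠ ⊤ ∧ ∀ G, memA n p (ν + M * p) G →
      ∃ F, memA n p ν F ∧ EqOn (BoxOp^[M] F) G (tube n) ∧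
        lpInt n p ν F ≤ D * lpInt n p (ν + M * p) G := by
  have hp0 : 0 ≤ p := by linarith
  obtain ⟨l, hl⟩ := exists_nat_gt (max ((n : ℝ) + 1)
    (n + (ν - n / 2 + M * p + (n + 2) * p) - M))
  have hl1 : n + 1 ≤ l := by exact_mod_cast ((le_max_left _ _).trans hl.le)
  have hl2 := (le_max_right _ _).trans_lt hl
  obtain ⟨D, hD, hbd⟩ := exists_TOp_bounded' (n := n) (b := ν - n / 2) hn hp hl1 hM
    (by linarith) (by linarith) (by rwa [sub_add_cancel])
  obtain ⟨c₁, hc₁, hbox⟩ := exists_BoxOp_iterate_TOp (n := n) M (n + l) (by omega)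
  obtain ⟨c₂, hc₂, hrep⟩ := exists_reproducing n (M + l)
  set c := (c₁ * c₂)⁻¹ with hc
  have e1 : ν + M * p - n / 2 = ν - n / 2 + M * p := by ring
  refine ⟨D * ‖c‖ₑ ^ p, ENNReal.mul_ne_top hD (ENNReal.rpow_ne_top_of_nonneg hp0 enorm_ne_top),
    fun G hG => ?_⟩
  have hcG : DifferentiableOn ℂ (fun z => c * G z) (tube n) := hG.1.const_mul c
  have hgm := measurable_ext0 hcG
  have hnorm : wInt (ν - n / 2 + M * p) (fun w => ‖ext0 (fun z => c * G z) w‖ₑ ^ p) =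
      ‖c‖ₑ ^ p * lpInt n p (ν + M * p) G := by
    rw [wInt_ext0, ← lpInt_const_mul hp0, lpInt_eq hp0, e1]
  obtain ⟨hT, hF⟩ := hbd _ hgm (by
    rw [hnorm]
    exact ENNReal.mul_ne_top (ENNReal.rpow_ne_top_of_nonneg hp0 enorm_ne_top) hG.2.ne)
  rw [hnorm, ← mul_assoc, ← lpInt_eq hp0] at hF
  obtain ⟨hT', hEq⟩ := hbox _ (measurable_wtd _ hgm) hT
  rw [show n + l + M = n + (M + l) by omega] at hT' hEq
  refine ⟨_, ⟨differentiableOn_TOp (measurable_wtd _ hgm) bpt_mem (hT _ bpt_mem),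
    lt_of_le_of_lt hF (ENNReal.mul_lt_top (ENNReal.mul_lt_top hD.lt_top
      (ENNReal.rpow_lt_top_of_nonneg hp0 enorm_ne_top)) hG.2)⟩, fun z hz => ?_, hF⟩
  have hcongr : EqOn (fun w => (lorC (zeta z w) ^ (n + (M + l)))⁻¹ *
      wtd (M + l) (ext0 fun z => c * G z) w) (repIntegrand n (M + l) (fun z => c * G z) z)
      (tube n) := fun w hw => by
    simp only [wtd, repIntegrand, ext0_eqOn (fun z => c * G z) hw]
  have h5 : TOp (n + (M + l)) (wtd (M + l) (ext0 fun z => c * G z)) z = c₂ * (c * G z) := by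
    rw [← hrep _ hcG z hz ((hT' z hz).congr_fun hcongr measurableSet_tube)]
    exact setIntegral_congr_fun measurableSet_tube hcongr
  refine (hEq hz).trans ?_
  change c₁ * TOp (n + (M + l)) _ z = G z
  rw [h5, hc]
  field_simp

end solve

/-! ### Injectivity and the norm bound -/

section conclusion
variable {n : ℕ} [NeZero n] {p ν : ℝ}

lemma injective_boxOp_iterate (hn : 3 ≤ n) (hν : (n : ℝ) / 2 - 1 < ν) (hp : 1 ≤ p)
    (hH : hardy n p ν) (m : ℕ) {q : ℝ} (hq : 0 ≤ q) {F₁ F₂ : (Fin n → ℂ) → ℂ}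
    (h1 : memA n p (ν + q) F₁) (h2 : memA n p (ν + q) F₂)
    (h : EqOn (BoxOp^[m] F₁) (BoxOp^[m] F₂) (tube n)) : EqOn F₁ F₂ (tube n) := by
  have hj : (⟨1, by omega⟩ : Fin n) ≠ 0 := by simp [Fin.ext_iff]
  have h3 := memA.eq_zero_of_boxOp_iterate hj hν hp hH m hq (memA.lin hp h1 h2 1 (-1))
    fun z hz => by
      rw [BoxOp_iterate_lin (h1.contDiffOn hp (by linarith)) (h2.contDiffOn hp (by linarith))
        1 (-1) m hz]
      simp [h hz]
  intro z hz
  have h4 : 1 * F₁ z + -1 * F₂ z = 0 := h3 hz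
  linear_combination h4

lemma lpInt_congr {κ : ℝ} (hp : 0 ≤ p) {F G : (Fin n → ℂ) → ℂ} (h : EqOn F G (tube n)) :
    lpInt n p κ F = lpInt n p κ G := by
  rw [lpInt_eq hp, lpInt_eq hp]
  exact wInt_congr fun z hz => by simp only [h hz]

lemma exists_lpNorm_le {m : ℕ} (hp : 1 ≤ p) {K : ℝ≥0∞} (hK : K ≠ ⊤)
    (h : ∀ F, memA n p ν F → lpInt n p ν F ≤ K * lpInt n p (ν + m * p) (BoxOp^[m] F)) :
    ∃ C : ℝ, 0 < C ∧ ∀ F, memA n p ν F →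
      lpNorm n p ν F ≤ ENNReal.ofReal C * lpNorm n p (ν + m * p) (BoxOp^[m] F) := by
  have hp0 : 0 ≤ 1 / p := by positivity
  have hK' : K ^ (1 / p) ≠ ⊤ := ENNReal.rpow_ne_top_of_nonneg hp0 hK
  refine ⟨(K ^ (1 / p)).toReal + 1, by positivity, fun F hF => ?_⟩
  calc lpNorm n p ν F ≤ (K * lpInt n p (ν + m * p) (BoxOp^[m] F)) ^ (1 / p) :=
        ENNReal.rpow_le_rpow (h F hF) hp0
    _ = K ^ (1 / p) * lpNorm n p (ν + m * p) (BoxOp^[m] F) :=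
        ENNReal.mul_rpow_of_nonneg _ _ hp0
    _ ≤ _ := by
        gcongr
        exact (ENNReal.le_ofReal_iff_toReal_le hK' (by positivity)).2 (by linarith)

end conclusion

/-- Corollary: under the Hardy inequality for `(p,ν)`,
`□^m : A^p_ν → A^p_{ν+mp}` is a bijection with `‖F‖_{L^p_ν} ≤ C ‖□^m F‖_{L^p_{ν+mp}}`. -/
theorem box_isomorphism (n : ℕ) [NeZero n] (hn : 3 ≤ n) (ν p : ℝ)
    (hν : (n : ℝ) / 2 - 1 < ν) (hp : 1 ≤ p)
    (hp2 : p < (ν + (n : ℝ) - 1) / ((n : ℝ) / 2 - 1)) (hH : hardy n p ν) :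
    ∀ m : ℕ, 1 ≤ m →
      (∀ F₁ F₂, memA n p ν F₁ → memA n p ν F₂ →
        Set.EqOn (BoxOp^[m] F₁) (BoxOp^[m] F₂) (tube n) → Set.EqOn F₁ F₂ (tube n)) ∧
      (∀ G, memA n p (ν + m * p) G →
        ∃ F, memA n p ν F ∧ Set.EqOn (BoxOp^[m] F) G (tube n)) ∧
      (∃ C : ℝ, 0 < C ∧ ∀ F, memA n p ν F →
        lpNorm n p ν F ≤ ENNReal.ofReal C * lpNorm n p (ν + m * p) (BoxOp^[m] F)) := by
  intro m _
  have hinj : ∀ k : ℕ, ∀ F₁ F₂, memA n p ν F₁ → memA n p ν F₂ →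
      EqOn (BoxOp^[k] F₁) (BoxOp^[k] F₂) (tube n) → EqOn F₁ F₂ (tube n) :=
    fun k F₁ F₂ h1 h2 h => injective_boxOp_iterate hn hν hp hH k le_rfl
      (by rwa [add_zero]) (by rwa [add_zero]) h
  have hp0 : 0 ≤ p := by linarith
  have hmp : 0 ≤ m * p := by positivity
  obtain ⟨r, hr⟩ : ∃ r : ℕ, n + 1 ≤ r + m := ⟨n + 1, by omega⟩
  obtain ⟨D, hD, hsol⟩ := exists_solution (M := r + m) hn hp hr hν hH
  have e : ν + (r + m : ℕ) * p = ν + m * p + r * p := by push_cast; ring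
  rw [e] at hsol
  refine ⟨hinj m, fun G hG => ?_, ?_⟩
  · obtain ⟨F, hF, hFG, -⟩ := hsol _ (hG.boxOp_iterate hp (by linarith) r)
    rw [Function.iterate_add_apply] at hFG
    exact ⟨F, hF, injective_boxOp_iterate hn hν hp hH r hmp (hF.boxOp_iterate hp hν m) hG hFG⟩
  · obtain ⟨C, hC, hbd⟩ := exists_BoxOp_iterate_bounded (n := n) (κ := ν + m * p) hp
      (by linarith) r
    refine exists_lpNorm_le hp (ENNReal.mul_ne_top hD hC) fun F hF => ?_
    have hmF := hF.boxOp_iterate hp hν m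
    obtain ⟨F', hF', hEq, hle⟩ := hsol _ (hmF.boxOp_iterate hp (by linarith) r)
    rw [← Function.iterate_add_apply] at hEq
    rw [← lpInt_congr hp0 (hinj _ _ _ hF' hF hEq), mul_assoc]
    exact hle.trans (by gcongr; exact hbd _ hmF)
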